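/- Let (f_1,...,f_d) be a d-tuple of pairwise commuting orientation-preserving real-analytic diffeomorphisms of [0,1]. Then either there exists a real-analytic vector field X on [0,1] and real numbers τ_1,...,τ_d such that each f_i is the time-τ_i map of the flow of X, or there exists an orientation-preserving real-analytic diffeomorphism f of [0,1] and integers k_1,...,k_d such that f_i = f^{k_i} for every i (i.e. the d-tuple lies in an infinite cyclic subgroup). -/

import Mathlib

open Set MeasureTheory Filter Topology

noncomputable section

/-- An orientation-preserving real-analytic diffeomorphism of the interval `[0,1]`. -/
structure AnDiffeo : Type where
  toFun : ℝ → ℝ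
  map_zero : toFun 0 = 0
  map_one : toFun 1 = 1
  bijOn : BijOn toFun (Icc (0:ℝ) 1) (Icc (0:ℝ) 1)
  analytic : AnalyticOnNhd ℝ toFun (Icc (0:ℝ) 1)
  deriv_pos : ∀ x ∈ Icc (0:ℝ) 1, 0 < deriv toFun x

/-- `Φ` is the flow of the real-analytic vector field `X` on `[0,1]` (tangent to the
boundary, i.e. vanishing at the endpoints). -/
def IsAnalyticFlowOf (Φ : ℝ → ℝ → ℝ) (X : ℝ → ℝ) : Prop :=
  AnalyticOnNhd ℝ X (Icc (0:ℝ) 1) ∧ X 0 = 0 ∧ X 1 = 0 ∧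
  (∀ t : ℝ, MapsTo (Φ t) (Icc (0:ℝ) 1) (Icc (0:ℝ) 1)) ∧
  (∀ x ∈ Icc (0:ℝ) 1, Φ 0 x = x) ∧
  (∀ s t : ℝ, ∀ x ∈ Icc (0:ℝ) 1, Φ (s + t) x = Φ s (Φ t x)) ∧
  (∀ x ∈ Icc (0:ℝ) 1, ∀ t : ℝ, HasDerivAt (fun τ => Φ τ x) (X (Φ t x)) t)

/-- The `k`-th power (`k ∈ ℤ`) of a map `f` with inverse `g`. -/
def zpowFun (f g : ℝ → ℝ) (k : ℤ) : ℝ → ℝ :=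
  if 0 ≤ k then f^[k.toNat] else g^[(-k).toNat]


/-! ## Part 1: invariant fields on nested petals -/

def qf (F : ℂ → ℂ) (z : ℂ) : ℂ := (F (F z) - F z) / (deriv F z * (F z - z))

def Lf (F : ℂ → ℂ) (z : ℂ) : ℂ := ∑' n : ℕ, Complex.log (qf F (F^[n] z))

def Xf (F : ℂ → ℂ) (z : ℂ) : ℂ := (F z - z) * Complex.exp (Lf F z)

structure Petal (F : ℂ → ℂ) (U : ℕ → Set ℂ) (β : ℕ → ℝ) : Prop where
  isOpen : ∀ m, IsOpen (U m)
  anti : ∀ m, U (m+1) ⊆ U m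
  maps : ∀ m, MapsTo F (U m) (U (m+1))
  bound : ∀ m, ∀ z ∈ U m, ‖qf F z - 1‖ ≤ β m
  summ : Summable β
  half : ∀ m, β m ≤ 1/2
  small : ∀ ε > 0, ∃ m, U m ⊆ Metric.ball 0 ε
  diff : ∀ z ∈ U 0, AnalyticAt ℂ F z
  deriv_ne : ∀ z ∈ U 0, deriv F z ≠ 0
  ne : ∀ z ∈ U 0, F z - z ≠ 0

namespace Petal
variable {F : ℂ → ℂ} {U : ℕ → Set ℂ} {β : ℕ → ℝ}

lemma anti0 (P : Petal F U β) : Antitone U := antitone_nat_of_succ_le P.anti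

lemma sub0 (P : Petal F U β) (m : ℕ) : U m ⊆ U 0 := P.anti0 (Nat.zero_le m)

lemma iter (P : Petal F U β) (n m : ℕ) : MapsTo F^[n] (U m) (U (m+n)) := by
  induction n with
  | zero => intro z hz; simpa using hz
  | succ n ih =>
    intro z hz
    rw [Function.iterate_succ_apply']
    exact P.maps _ (ih hz)

lemma iter0 (P : Petal F U β) (n : ℕ) {z : ℂ} (hz : z ∈ U 0) : F^[n] z ∈ U 0 :=
  P.sub0 _ (P.iter n 0 hz)

lemma iter_an (P : Petal F U β) (n : ℕ) : ∀ z ∈ U 0, AnalyticAt ℂ F^[n] z := by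
  induction n with
  | zero => intro z hz; exact analyticAt_id
  | succ n ih =>
    intro z hz
    rw [Function.iterate_succ']
    exact (P.diff _ (P.iter0 n hz)).comp (ih z hz)

lemma tendsto_iter (P : Petal F U β) {z : ℂ} (hz : z ∈ U 0) :
    Tendsto (fun n => F^[n] z) atTop (𝓝 0) := by
  rw [Metric.tendsto_atTop]
  intro ε hε
  obtain ⟨m, hm⟩ := P.small ε hε
  refine ⟨m, fun n hn => ?_⟩
  have := P.iter n 0 hz
  rw [zero_add] at this
  exact hm (P.anti0 hn this)

lemma tail_summ (P : Petal F U β) (m : ℕ) : Summable (fun n => β (m+n)) := by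
  have := (summable_nat_add_iff m).2 P.summ
  simpa [add_comm] using this

lemma log_bound (P : Petal F U β) (m n : ℕ) {z : ℂ} (hz : z ∈ U m) :
    ‖Complex.log (qf F (F^[n] z))‖ ≤ 3/2 * β (m+n) := by
  have h := P.bound _ _ (P.iter n m hz)
  have h2 := Complex.norm_log_one_add_half_le_self (h.trans (P.half _))
  rw [add_sub_cancel] at h2
  linarith

lemma q_ne (P : Petal F U β) {z : ℂ} (hz : z ∈ U 0) : qf F z ≠ 0 := by
  intro h
  have h1 := (P.bound _ _ hz).trans (P.half _)
  rw [h] at h1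
  norm_num at h1

lemma q_slit (P : Petal F U β) {z : ℂ} (hz : z ∈ U 0) : qf F z ∈ Complex.slitPlane := by
  have h1 := (P.bound _ _ hz).trans (P.half _)
  left
  have := (Complex.abs_re_le_norm (qf F z - 1)).trans h1
  rw [abs_le] at this
  simp at this
  linarith

lemma L_bound (P : Petal F U β) (m : ℕ) {z : ℂ} (hz : z ∈ U m) :
    ‖Lf F z‖ ≤ 3/2 * ∑' n, β (m+n) := by
  rw [← tsum_mul_left]
  exact tsum_of_norm_bounded ((P.tail_summ m).mul_left _).hasSum (fun n => P.log_bound m n hz)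

lemma tail_tendsto (P : Petal F U β) : Tendsto (fun m => 3/2 * ∑' n, β (m+n)) atTop (𝓝 0) := by
  have := tendsto_sum_nat_add β
  have h2 := this.const_mul (3/2)
  simp only [mul_zero] at h2
  refine h2.congr (fun m => ?_)
  simp [add_comm]

lemma q_diff (P : Petal F U β) {z : ℂ} (hz : z ∈ U 0) : DifferentiableAt ℂ (qf F) z := by
  have h1 := P.diff z hz
  have hFz := P.sub0 1 (P.maps 0 hz)
  have h2 := (P.diff _ hFz).comp h1
  refine DifferentiableAt.div (h2.differentiableAt.sub h1.differentiableAt)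
    (h1.deriv.differentiableAt.mul (h1.differentiableAt.sub differentiableAt_id)) ?_
  exact mul_ne_zero (P.deriv_ne z hz) (P.ne z hz)

lemma L_diff (P : Petal F U β) : DifferentiableOn ℂ (Lf F) (U 0) := by
  refine Complex.differentiableOn_tsum_of_summable_norm (u := fun n => 3/2 * β (0+n))
    ((P.tail_summ 0).mul_left _) (fun n => ?_) (P.isOpen 0) (fun n w hw => P.log_bound 0 n hw)
  intro z hz
  have hz' := P.iter0 n hz
  have : DifferentiableAt ℂ (fun z => qf F (F^[n] z)) z :=
    DifferentiableAt.comp z (P.q_diff hz') (P.iter_an n z hz).differentiableAt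
  exact (this.clog (P.q_slit hz')).differentiableWithinAt

lemma X_diff (P : Petal F U β) : DifferentiableOn ℂ (Xf F) (U 0) := by
  intro z hz
  exact ((P.diff z hz).differentiableAt.sub differentiableAt_id).differentiableWithinAt.mul
    (P.L_diff z hz).cexp

lemma X_ne (P : Petal F U β) {z : ℂ} (hz : z ∈ U 0) : Xf F z ≠ 0 :=
  mul_ne_zero (P.ne z hz) (Complex.exp_ne_zero _)

lemma L_step (P : Petal F U β) {z : ℂ} (hz : z ∈ U 0) :
    Lf F z = Complex.log (qf F z) + Lf F (F z) := by
  have hs : Summable (fun n : ℕ => Complex.log (qf F (F^[n] z))) :=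
    Summable.of_norm_bounded ((P.tail_summ 0).mul_left (3/2)) (fun n => P.log_bound 0 n hz)
  unfold Lf
  rw [hs.tsum_eq_zero_add]
  simp [Function.iterate_succ_apply]

lemma X_step (P : Petal F U β) {z : ℂ} (hz : z ∈ U 0) :
    Xf F (F z) = deriv F z * Xf F z := by
  have h := P.L_step hz
  unfold Xf
  rw [h, Complex.exp_add, Complex.exp_log (P.q_ne hz), qf]
  field_simp [P.ne z hz, P.deriv_ne z hz]

lemma X_iter (P : Petal F U β) (n : ℕ) {z : ℂ} (hz : z ∈ U 0) :
    Xf F (F^[n] z) = deriv F^[n] z * Xf F z := by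
  induction n with
  | zero => simp
  | succ n ih =>
    have h1 := P.iter0 n hz
    rw [Function.iterate_succ_apply', P.X_step h1, ih, Function.iterate_succ',
      deriv_comp _ (P.diff _ h1).differentiableAt (P.iter_an n z hz).differentiableAt]
    ring

lemma X_close (P : Petal F U β) {ε : ℝ} (hε : 0 < ε) :
    ∃ m0, ∀ m ≥ m0, ∀ z ∈ U m, ‖Complex.exp (Lf F z) - 1‖ ≤ ε := by
  have h := P.tail_tendsto
  have h1 : ∀ᶠ m in atTop, 3/2 * ∑' n, β (m+n) < min 1 (ε/2) :=
    h.eventually_lt_const (by positivity)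
  obtain ⟨m0, hm0⟩ := eventually_atTop.1 h1
  refine ⟨m0, fun m hm z hz => ?_⟩
  have h2 := (P.L_bound m hz).trans (hm0 m hm).le
  have := Complex.norm_exp_sub_one_le (h2.trans (min_le_left _ _))
  have h3 := h2.trans (min_le_right _ _)
  linarith

lemma exp_tendsto (P : Petal F U β) {z : ℂ} (hz : z ∈ U 0) :
    Tendsto (fun n => Complex.exp (Lf F (F^[n] z))) atTop (𝓝 1) := by
  rw [Metric.tendsto_atTop]
  intro ε hε
  obtain ⟨m0, hm⟩ := P.X_close (half_pos hε)
  refine ⟨m0, fun n hn => ?_⟩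
  have := P.iter n 0 hz
  rw [zero_add] at this
  rw [dist_eq_norm]
  linarith [hm n hn _ this]

/-- Invariance under commuting germs. -/
lemma X_comm (P : Petal F U β) {H : ℂ → ℂ} {N : Set ℂ} (hN : IsOpen N) (hUN : U 0 ⊆ N)
    (hHan : ∀ z ∈ N, AnalyticAt ℂ H z)
    (h0 : (0:ℂ) ∈ N) (hH0 : deriv H 0 ≠ 0) (hH' : ∀ z ∈ N, deriv H z ≠ 0)
    (hc : ∀ z ∈ N, H (F z) = F (H z)) {z : ℂ} (hz : z ∈ U 0) (hHz : H z ∈ U 0) :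
    Xf F (H z) = deriv H z * Xf F z := by
  have hcn : ∀ n, H (F^[n] z) = F^[n] (H z) := by
    intro n
    induction n with
    | zero => rfl
    | succ n ih =>
      rw [Function.iterate_succ_apply', Function.iterate_succ_apply', ← ih,
        hc _ (hUN (P.iter0 n hz))]
  have hzn : ∀ n, F^[n] z ∈ U 0 := fun n => P.iter0 n hz
  have hHzn : ∀ n, H (F^[n] z) ∈ U 0 := fun n => by rw [hcn]; exact P.iter0 n hHz
  have hd : ∀ n, deriv H (F^[n+1] z) * deriv F (F^[n] z)
      = deriv F (H (F^[n] z)) * deriv H (F^[n] z) := by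
    intro n
    have e : H ∘ F =ᶠ[𝓝 (F^[n] z)] F ∘ H := by
      filter_upwards [hN.mem_nhds (hUN (hzn n))] with w hw using hc w hw
    have e2 := e.deriv_eq
    rw [Function.iterate_succ_apply']
    rw [deriv_comp, deriv_comp] at e2
    · exact e2
    · exact (P.diff _ (hHzn n)).differentiableAt
    · exact (hHan _ (hUN (hzn n))).differentiableAt
    · have := hzn (n+1)
      rw [Function.iterate_succ_apply'] at this
      exact (hHan _ (hUN this)).differentiableAt
    · exact (P.diff _ (hzn n)).differentiableAt
  set ρ : ℕ → ℂ := fun n => Xf F (H (F^[n] z)) / (deriv H (F^[n] z) * Xf F (F^[n] z)) with hρ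
  have hstep : ∀ n, ρ (n+1) = ρ n := by
    intro n
    have e1 : Xf F (H (F^[n+1] z)) = deriv F (H (F^[n] z)) * Xf F (H (F^[n] z)) := by
      rw [Function.iterate_succ_apply', hc _ (hUN (hzn n)), P.X_step (hHzn n)]
    have e2 : Xf F (F^[n+1] z) = deriv F (F^[n] z) * Xf F (F^[n] z) := by
      rw [Function.iterate_succ_apply', P.X_step (hzn n)]
    simp only [hρ]
    rw [e1, e2, ← mul_assoc, hd, mul_assoc,
      mul_div_mul_left _ _ (P.deriv_ne _ (hHzn n))]
  have hconst : ∀ n, ρ n = ρ 0 := by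
    intro n
    induction n with
    | zero => rfl
    | succ n ih => rw [hstep, ih]
  have hlim : Tendsto ρ atTop (𝓝 1) := by
    have t1 := P.tendsto_iter hz
    have t2 : Tendsto (fun n => F^[n+1] z) atTop (𝓝 0) := (tendsto_add_atTop_iff_nat 1).2 t1
    have hs : HasStrictDerivAt H (deriv H 0) 0 := (hHan 0 h0).hasStrictDerivAt
    have hsl : Tendsto (fun n => (H (F^[n+1] z) - H (F^[n] z)) / (F^[n+1] z - F^[n] z)) atTop
        (𝓝 (deriv H 0)) := by
      have := hs.isLittleO.comp_tendsto (t2.prodMk_nhds t1)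
      have h3 := this.tendsto_div_nhds_zero
      have h4 := h3.add_const (deriv H 0)
      rw [zero_add] at h4
      refine h4.congr (fun n => ?_)
      have hne : F^[n+1] z - F^[n] z ≠ 0 := by
        rw [Function.iterate_succ_apply']; exact P.ne _ (hzn n)
      simp only [Function.comp]
      field_simp
      simp
    have hdv : Tendsto (fun n => deriv H (F^[n] z)) atTop (𝓝 (deriv H 0)) :=
      ((hHan 0 h0).deriv.continuousAt.tendsto).comp t1
    have hex1 := P.exp_tendsto hz
    have hex2 := P.exp_tendsto hHz
    have := (hsl.div hdv hH0).mul (hex2.div hex1 one_ne_zero)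
    rw [div_self hH0, div_one, one_mul] at this
    refine this.congr (fun n => ?_)
    simp only [hρ, Xf, Pi.div_apply]
    have e : F (H (F^[n] z)) = H (F^[n+1] z) := by
      rw [Function.iterate_succ_apply', hc _ (hUN (hzn n))]
    rw [e, ← hcn, Function.iterate_succ_apply' F n z]
    have n1 := P.ne _ (hzn n)
    have n2 := hH' _ (hUN (hzn n))
    have n3 := Complex.exp_ne_zero (Lf F (F^[n] z))
    field_simp
  have h1 : ρ 0 = 1 := by
    refine tendsto_nhds_unique ?_ hlim
    exact tendsto_const_nhds.congr (fun n => (hconst n).symm)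
  simp only [hρ, Function.iterate_zero, id] at h1
  rw [div_eq_one_iff_eq] at h1
  · exact h1
  · exact mul_ne_zero (hH' _ (hUN hz)) (P.X_ne hz)

end Petal


/-! ## Part 2: local theory, hyperbolic case and petals in the parabolic case -/

lemma Petal.shift {F : ℂ → ℂ} {U : ℕ → Set ℂ} {β : ℕ → ℝ} (P : Petal F U β) (j : ℕ) :
    Petal F (fun m => U (m+j)) (fun m => β (m+j)) where
  isOpen m := P.isOpen _
  anti m := by
    have := P.anti (m+j)
    rwa [add_right_comm] at this
  maps m := by
    have := P.maps (m+j)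
    rwa [add_right_comm] at this
  bound m := P.bound _
  summ := (summable_nat_add_iff j).2 P.summ
  half m := P.half _
  small ε hε := by
    obtain ⟨m, hm⟩ := P.small ε hε
    exact ⟨m, (P.anti0 (Nat.le_add_right m j)).trans hm⟩
  diff z hz := P.diff z (P.sub0 _ hz)
  deriv_ne z hz := P.deriv_ne z (P.sub0 _ hz)
  ne z hz := P.ne z (P.sub0 _ hz)

/-- removable singularity for the invariant field -/
lemma field_analytic {F X : ℂ → ℂ} (hF : AnalyticAt ℂ F 0) (hF0 : F 0 = 0) (hX0 : X 0 = 0)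
    (hd : ∀ᶠ z in 𝓝[≠] (0:ℂ), DifferentiableAt ℂ X z)
    (hne : ∀ᶠ z in 𝓝[≠] (0:ℂ), F z - z ≠ 0)
    (hl : Tendsto (fun z => X z / (F z - z)) (𝓝[≠] 0) (𝓝 1)) : AnalyticAt ℂ X 0 := by
  apply Complex.analyticAt_of_differentiable_on_punctured_nhds_of_continuousAt hd
  rw [continuousAt_iff_punctured_nhds, hX0]
  have h1 : Tendsto (fun z => F z - z) (𝓝[≠] (0:ℂ)) (𝓝 0) := by
    have : ContinuousAt (fun z => F z - z) 0 := hF.continuousAt.sub continuousAt_id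
    have := this.tendsto
    simp only [hF0, sub_zero] at this
    exact this.mono_left nhdsWithin_le_nhds
  have h2 := hl.mul h1
  rw [one_mul] at h2
  refine h2.congr' ?_
  filter_upwards [hne] with z hz
  field_simp

/-- Good neighbourhood for a commuting germ. -/
lemma good_nhd {F H : ℂ → ℂ} (hH : AnalyticAt ℂ H 0) (hH' : deriv H 0 ≠ 0)
    (hc : ∀ᶠ z in 𝓝 (0:ℂ), H (F z) = F (H z)) :
    ∃ ε > 0, ∀ z ∈ Metric.ball (0:ℂ) ε, AnalyticAt ℂ H z ∧ deriv H z ≠ 0 ∧ H (F z) = F (H z) := by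
  have h1 := hH.eventually_analyticAt
  have h2 : ∀ᶠ z in 𝓝 (0:ℂ), deriv H z ≠ 0 := hH.deriv.continuousAt.eventually_ne hH'
  exact Metric.eventually_nhds_iff_ball.1 (h1.and (h2.and hc))

lemma hyp_local {F : ℂ → ℂ} (hF : AnalyticAt ℂ F 0) (hF0 : F 0 = 0) (hF' : deriv F 0 ≠ 0)
    (hF1 : ‖deriv F 0‖ < 1) :
    ∃ X : ℂ → ℂ, AnalyticAt ℂ X 0 ∧ X 0 = 0 ∧
      Tendsto (fun z => X z / (F z - z)) (𝓝[≠] 0) (𝓝 1) ∧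
      ∀ H : ℂ → ℂ, AnalyticAt ℂ H 0 → H 0 = 0 → deriv H 0 ≠ 0 →
        (∀ᶠ z in 𝓝 (0:ℂ), H (F z) = F (H z)) →
        ∀ᶠ z in 𝓝 (0:ℂ), X (H z) = deriv H z * X z := by
  set lam := deriv F 0 with hlam
  have hne1 : lam - 1 ≠ 0 := by
    intro h
    rw [sub_eq_zero.1 h] at hF1
    simp at hF1
  set w : ℂ → ℂ := dslope F 0 with hw
  have hwan : AnalyticAt ℂ w 0 := by
    obtain ⟨p, hp⟩ := hF
    exact ⟨_, hp.has_fpower_series_dslope_fslope⟩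
  have hw0 : w 0 = lam := by simp [hw, hlam]
  have hFw : ∀ z, F z = z * w z := by
    intro z
    have := sub_smul_dslope F 0 z
    simp only [sub_zero, hF0, smul_eq_mul] at this
    exact this.symm
  -- the regularised quotient
  set Q : ℂ → ℂ := fun z => w z * (w (F z) - 1) / (deriv F z * (w z - 1)) with hQ
  have hQq : ∀ z ≠ 0, qf F z = Q z := by
    intro z hz
    have e1 : F (F z) - F z = z * (w z * (w (F z) - 1)) := by
      rw [hFw (F z), mul_sub, mul_sub, mul_one, ← mul_assoc, ← hFw z]
    have e2 : F z - z = z * (w z - 1) := by rw [hFw z]; ring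
    rw [qf, e1, e2, hQ]
    rw [show deriv F z * (z * (w z - 1)) = z * (deriv F z * (w z - 1)) by ring,
      mul_div_mul_left _ _ hz]
  have hQan : DifferentiableAt ℂ Q 0 := by
    have hwF : AnalyticAt ℂ (fun z => w (F z)) 0 := by
      apply AnalyticAt.fun_comp (by rwa [hF0]) hF
    refine DifferentiableAt.div (hwan.differentiableAt.mul (hwF.differentiableAt.sub_const 1))
      (hF.deriv.differentiableAt.mul (hwan.differentiableAt.sub_const 1)) ?_
    rw [hw0]
    exact mul_ne_zero hF' hne1
  have hQ0 : Q 0 = 1 := by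
    simp only [hQ, hF0, hw0]
    rw [← hlam]
    exact div_self (mul_ne_zero hF' hne1)
  have hO := hQan.isBigO_sub
  rw [hQ0] at hO
  obtain ⟨C0, hC0⟩ := hO.bound
  set C := max C0 1 with hC
  have hCpos : 0 < C := lt_of_lt_of_le one_pos (le_max_right _ _)
  obtain ⟨μ, hμ1, hμ2⟩ := exists_between hF1
  have hμ0 : 0 < μ := lt_of_le_of_lt (norm_nonneg _) hμ1
  have ev : ∀ᶠ z in 𝓝 (0:ℂ), ‖Q z - 1‖ ≤ C0 * ‖z - 0‖ ∧ ‖w z‖ < μ ∧ w z ≠ 0 ∧ w z - 1 ≠ 0 ∧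
      AnalyticAt ℂ F z ∧ deriv F z ≠ 0 := by
    refine hC0.and (Eventually.and ?_ (Eventually.and ?_ (Eventually.and ?_ (Eventually.and ?_ ?_))))
    · exact hwan.continuousAt.norm.eventually_lt_const (by simpa [hw0] using hμ1)
    · exact hwan.continuousAt.eventually_ne (by rw [hw0]; exact hF')
    · exact (hwan.continuousAt.sub continuousAt_const).eventually_ne (by simpa [hw0] using hne1)
    · exact hF.eventually_analyticAt
    · exact hF.deriv.continuousAt.eventually_ne hF'
  obtain ⟨r0, hr0, hr⟩ := Metric.eventually_nhds_iff_ball.1 ev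
  set r := min r0 (1/(2*C)) with hrdef
  have hrpos : 0 < r := lt_min hr0 (by positivity)
  have hrC : C * r ≤ 1/2 := by
    have : r ≤ 1/(2*C) := min_le_right _ _
    calc C * r ≤ C * (1/(2*C)) := by gcongr
      _ = 1/2 := by field_simp
  have hμm : ∀ m : ℕ, μ^m ≤ 1 := fun m => pow_le_one₀ hμ0.le hμ2.le
  let U : ℕ → Set ℂ := fun m => {z | z ≠ 0 ∧ ‖z‖ < r * μ^m}
  have hUr : ∀ m z, z ∈ U m → z ∈ Metric.ball (0:ℂ) r0 := by
    intro m z hz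
    rw [mem_ball_zero_iff]
    have := hz.2
    have h2 : r * μ^m ≤ r * 1 := by gcongr; exact hμm m
    have h3 : r ≤ r0 := min_le_left _ _
    linarith
  have P : Petal F U (fun m => C * (r * μ^m)) :=
    { isOpen := fun m => by
        have h1 : IsOpen {z : ℂ | z ≠ 0} := isOpen_ne
        exact h1.inter (isOpen_lt continuous_norm continuous_const)
      anti := fun m z hz => ⟨hz.1, hz.2.trans_le (by
        rw [pow_succ]
        have : μ^m * μ ≤ μ^m * 1 := by gcongr
        rw [mul_one] at this
        gcongr)⟩
      maps := fun m z hz => by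
        have h := hr z (hUr m z hz)
        refine ⟨?_, ?_⟩
        · rw [hFw]; exact mul_ne_zero hz.1 h.2.2.1
        · rw [hFw, norm_mul, pow_succ, ← mul_assoc]
          exact mul_lt_mul'' hz.2 h.2.1 (norm_nonneg _) (norm_nonneg _)
      bound := fun m z hz => by
        have h := (hr z (hUr m z hz)).1
        rw [hQq z hz.1]
        refine h.trans ?_
        rw [sub_zero]
        have := hz.2
        gcongr
        exact le_max_left _ _
      summ := ((summable_geometric_of_lt_one hμ0.le hμ2).mul_left r).mul_left C
      half := fun m => by
        have h2 : r * μ^m ≤ r * 1 := by gcongr; exact hμm m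
        calc C * (r * μ^m) ≤ C * (r*1) := by gcongr
          _ ≤ 1/2 := by rw [mul_one]; exact hrC
      small := fun ε hε => by
        have : Tendsto (fun m : ℕ => r * μ^m) atTop (𝓝 (r*0)) :=
          (tendsto_pow_atTop_nhds_zero_of_lt_one hμ0.le hμ2).const_mul r
        rw [mul_zero] at this
        obtain ⟨m, hm⟩ := (this.eventually_lt_const hε).exists
        exact ⟨m, fun z hz => by rw [mem_ball_zero_iff]; exact hz.2.trans hm⟩
      diff := fun z hz => (hr z (hUr 0 z hz)).2.2.2.2.1
      deriv_ne := fun z hz => (hr z (hUr 0 z hz)).2.2.2.2.2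
      ne := fun z hz => by
        have h := (hr z (hUr 0 z hz)).2.2.2.1
        rw [hFw, show z * w z - z = z * (w z - 1) by ring]
        exact mul_ne_zero hz.1 h }
  have hUnhd : ∀ m, ∀ᶠ z in 𝓝[≠] (0:ℂ), z ∈ U m := by
    intro m
    have h1 : ∀ᶠ z in 𝓝 (0:ℂ), ‖z‖ < r * μ^m :=
      continuous_norm.continuousAt.eventually_lt_const (by simp only [norm_zero]; positivity)
    filter_upwards [h1.filter_mono nhdsWithin_le_nhds, self_mem_nhdsWithin] with z hz hz2
    exact ⟨hz2, hz⟩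
  have hX0 : Xf F 0 = 0 := by simp [Xf, hF0]
  have hlim : Tendsto (fun z => Xf F z / (F z - z)) (𝓝[≠] 0) (𝓝 1) := by
    rw [Metric.tendsto_nhds]
    intro ε hε
    obtain ⟨m0, hm0⟩ := P.X_close (half_pos hε)
    filter_upwards [hUnhd m0] with z hz
    rw [Xf, mul_div_cancel_left₀ _ (P.ne z (P.sub0 _ hz)), dist_eq_norm]
    linarith [hm0 m0 le_rfl z hz]
  refine ⟨Xf F, ?_, hX0, hlim, ?_⟩
  · refine field_analytic hF hF0 hX0 ?_ ?_ hlim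
    · filter_upwards [hUnhd 0] with z hz
      exact (P.X_diff z hz).differentiableAt ((P.isOpen 0).mem_nhds hz)
    · filter_upwards [hUnhd 0] with z hz using P.ne z hz
  · intro H hH hH0 hH' hc
    obtain ⟨ε, hε, hN⟩ := good_nhd hH hH' hc
    obtain ⟨m, hm⟩ := P.small ε hε
    have P' := P.shift m
    have hne : ∀ᶠ z in 𝓝[≠] (0:ℂ), H z ≠ 0 := by
      have := (hH.differentiableAt.hasDerivAt).eventually_ne (c := 0) hH'
      exact this
    have ht : Tendsto H (𝓝[≠] (0:ℂ)) (𝓝[≠] 0) := by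
      refine tendsto_nhdsWithin_iff.2 ⟨?_, hne⟩
      have := hH.continuousAt.tendsto
      rw [hH0] at this
      exact this.mono_left nhdsWithin_le_nhds
    have : ∀ᶠ z in 𝓝[≠] (0:ℂ), Xf F (H z) = deriv H z * Xf F z := by
      filter_upwards [hUnhd m, ht.eventually (hUnhd m)] with z hz hz2
      refine P'.X_comm (N := Metric.ball 0 ε) Metric.isOpen_ball ?_ (fun z hz => (hN z hz).1)
        (Metric.mem_ball_self hε) hH' (fun z hz => (hN z hz).2.1) (fun z hz => (hN z hz).2.2)
        ?_ ?_
      · simpa using hm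
      · simpa using hz
      · simpa using hz2
    rw [eventually_nhdsWithin_iff] at this
    filter_upwards [this] with z hz
    by_cases h : z = 0
    · subst h; rw [hH0, hX0]; simp
    · exact hz h

/-! ### parabolic estimates -/

lemma cont_isBigO_one {f : ℂ → ℂ} {x : ℂ} (h : ContinuousAt f x) :
    f =O[𝓝 x] (fun _ : ℂ => (1:ℂ)) := h.tendsto.isBigO_one ℂ


lemma one_add_pow_expand (n : ℕ) : ∃ g : ℂ → ℂ, Continuous g ∧
    ∀ w, (1 + w)^n = 1 + n * w + w^2 * g w := by
  induction n with
  | zero => exact ⟨fun _ => 0, continuous_const, by simp⟩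
  | succ n ih =>
    obtain ⟨g, hg, h⟩ := ih
    refine ⟨fun w => n + g w + w * g w, by fun_prop, fun w => ?_⟩
    rw [pow_succ, h]
    push_cast
    ring

def uf (k : ℕ) (c z : ℂ) : ℂ := -1 / (k * c * z^k)

lemma uf_expand (k : ℕ) (hk : 1 ≤ k) : ∃ E : ℂ → ℂ, ContinuousAt E 0 ∧ E 0 = 1 ∧
    ∀ c z W : ℂ, c ≠ 0 → z ≠ 0 → 1 + W ≠ 0 →
      uf k c (z * (1 + W)) - uf k c z = W / (c * z^k) * E W := by
  obtain ⟨g, hg, h⟩ := one_add_pow_expand k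
  have hk0 : (k:ℂ) ≠ 0 := by exact_mod_cast (by omega : k ≠ 0)
  refine ⟨fun W => (k + W * g W) / (k * (1 + W)^k), ?_, ?_, ?_⟩
  · refine ContinuousAt.div (by fun_prop) (by fun_prop) ?_
    simpa using (by omega : k ≠ 0)
  · simp [hk0]
  · intro c z W hc hz hW
    unfold uf
    rw [mul_pow]
    have hW' : (1 + W)^k ≠ 0 := pow_ne_zero _ hW
    have hz' : z^k ≠ 0 := pow_ne_zero _ hz
    have e := h W
    have e2 : (1+W)^k - 1 = W * (k + W * g W) := by rw [e]; ring
    field_simp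
    rw [← e2]
    ring

def sg (u : ℂ) : ℝ := u.re + |u.im|

lemma sg_le (u : ℂ) : sg u ≤ 2 * ‖u‖ := by
  unfold sg
  have h1 := Complex.abs_re_le_norm u
  have h2 := Complex.abs_im_le_norm u
  have := le_abs_self u.re
  linarith

lemma sg_add (a b : ℂ) : sg a - 2 * ‖b‖ ≤ sg (a + b) := by
  unfold sg
  have h1 := Complex.abs_re_le_norm b
  have h2 := Complex.abs_im_le_norm b
  have h3 := neg_abs_le b.re
  have h4 : |a.im| ≤ |a.im + b.im| + |b.im| := by
    have := abs_sub (a.im + b.im) b.im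
    simpa using this
  simp only [Complex.add_re, Complex.add_im]
  linarith

lemma sg_continuous : Continuous sg := by unfold sg; fun_prop

/-- `u (H z) - u z → T / c`. -/
lemma uf_tendsto {k : ℕ} (hk : 1 ≤ k) {c T : ℂ} (hc : c ≠ 0) {H : ℂ → ℂ}
    (hH : Tendsto (fun z => (H z - z) / z^(k+1)) (𝓝[≠] 0) (𝓝 T)) :
    Tendsto (fun z => uf k c (H z) - uf k c z) (𝓝[≠] 0) (𝓝 (T / c)) := by
  obtain ⟨E, hE, hE1, hu⟩ := uf_expand k hk
  set W : ℂ → ℂ := fun z => z^k * ((H z - z) / z^(k+1)) with hW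
  have hzk : Tendsto (fun z : ℂ => z^k) (𝓝[≠] 0) (𝓝 0) := by
    have : ContinuousAt (fun z : ℂ => z^k) 0 := by fun_prop
    have := this.tendsto
    rw [zero_pow (by omega)] at this
    exact this.mono_left nhdsWithin_le_nhds
  have hWt : Tendsto W (𝓝[≠] 0) (𝓝 0) := by
    have := hzk.mul hH
    rwa [zero_mul] at this
  have hEt : Tendsto (fun z => E (W z)) (𝓝[≠] 0) (𝓝 1) := by
    have := hE.tendsto.comp hWt
    rwa [hE1] at this
  have hW1 : ∀ᶠ z in 𝓝[≠] (0:ℂ), 1 + W z ≠ 0 := by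
    have : Tendsto (fun z => 1 + W z) (𝓝[≠] 0) (𝓝 (1+0)) := hWt.const_add 1
    exact this.eventually_ne (by simp)
  have := (hH.div_const c).mul hEt
  rw [mul_one] at this
  refine this.congr' ?_
  filter_upwards [hW1, self_mem_nhdsWithin] with z h1 hz
  have hz : z ≠ 0 := hz
  have e : H z = z * (1 + W z) := by
    simp only [hW]; field_simp; ring
  rw [e, hu c z (W z) hc hz h1, ← e]
  congr 1
  simp only [hW]
  field_simp

/-- Data of a parabolic germ. -/
structure Parab (F : ℂ → ℂ) (k : ℕ) (c : ℂ) (v : ℂ → ℂ) : Prop where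
  hk : 1 ≤ k
  hF : AnalyticAt ℂ F 0
  hv : AnalyticAt ℂ v 0
  hv0 : v 0 = c
  hc : c ≠ 0
  eq : ∀ᶠ z in 𝓝 (0:ℂ), F z - z = z^(k+1) * v z

namespace Parab
variable {F v : ℂ → ℂ} {k : ℕ} {c : ℂ}

lemma F0 (h : Parab F k c v) : F 0 = 0 := by
  have := h.eq.self_of_nhds
  simpa using this

lemma deriv_eq (h : Parab F k c v) :
    ∀ᶠ z in 𝓝 (0:ℂ), deriv F z = 1 + (k+1) * z^k * v z + z^(k+1) * deriv v z := by
  filter_upwards [h.eq.eventually_nhds, h.hv.eventually_analyticAt] with z hz hvz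
  have e : F =ᶠ[𝓝 z] fun z => z + z^(k+1) * v z := by
    filter_upwards [hz] with w hw
    rw [← hw]; ring
  rw [e.deriv_eq]
  have : HasDerivAt (fun z => z + z^(k+1) * v z)
      (1 + (((k+1 : ℕ) : ℂ) * z^k * v z + z^(k+1) * deriv v z)) z :=
    (hasDerivAt_id z).add ((hasDerivAt_pow (k+1) z).mul hvz.differentiableAt.hasDerivAt)
  rw [this.deriv]
  push_cast
  ring

lemma deriv0 (h : Parab F k c v) : deriv F 0 = 1 := by
  have := h.deriv_eq.self_of_nhds
  have hk := h.hk
  rw [this]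
  rw [zero_pow (by omega), zero_pow (by omega)]
  ring

lemma q_bound (h : Parab F k c v) :
    ∃ C > 0, ∀ᶠ z in 𝓝[≠] (0:ℂ), ‖qf F z - 1‖ ≤ C * ‖z‖^(k+1) := by
  obtain ⟨g, hg, hgx⟩ := one_add_pow_expand (k+1)
  have hk := h.hk
  -- all pieces
  set w : ℂ → ℂ := fun z => z^k * v z with hw
  set A : ℂ → ℂ := fun z => z^(k-1) * (v z)^2 * g (w z) * v (F z) with hA
  have hvF : AnalyticAt ℂ (fun z => v (F z)) 0 := AnalyticAt.fun_comp (by rw [h.F0]; exact h.hv) h.hF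
  -- v (F z) - v z = O(z^(k+1))
  have hs : HasStrictDerivAt v (deriv v 0) 0 := h.hv.hasStrictDerivAt
  have hO1 : (fun z => v (F z) - v z) =O[𝓝 0] (fun z => F z - z) := by
    have h1 := hs.hasStrictFDerivAt.isBigO_sub
    have ht : Tendsto (fun z => (F z, z)) (𝓝 0) (𝓝 ((0:ℂ), (0:ℂ))) := by
      have h2 : Tendsto F (𝓝 0) (𝓝 0) := by
        have := h.hF.continuousAt.tendsto
        rwa [h.F0] at this
      exact h2.prodMk_nhds tendsto_id
    exact h1.comp_tendsto ht
  have hO2 : (fun z => F z - z) =O[𝓝 0] (fun z : ℂ => z^(k+1)) := by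
    have : (fun z => z^(k+1) * v z) =O[𝓝 0] (fun z : ℂ => z^(k+1) * 1) :=
      (Asymptotics.isBigO_refl _ _).mul (h.hv.continuousAt.isBigO_one ℂ)
    simp only [mul_one] at this
    exact this.congr' (h.eq.mono fun z hz => hz.symm) EventuallyEq.rfl
  have hO3 := hO1.trans hO2
  -- numerator
  set Nn : ℂ → ℂ := fun z => A z * z^(k+1) + (1 + (k+1) * w z) * (v (F z) - v z)
      - z^(k+1) * (v z * deriv v z) with hN
  have hNO : Nn =O[𝓝 0] (fun z : ℂ => z^(k+1)) := by
    have a1 : (fun z => A z * z^(k+1)) =O[𝓝 0] (fun z : ℂ => 1 * z^(k+1)) := by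
      refine Asymptotics.IsBigO.mul ?_ (Asymptotics.isBigO_refl _ _)
      apply cont_isBigO_one
      have h1 := h.hv.continuousAt
      have h2 := hvF.continuousAt
      have h3 : ContinuousAt w 0 := (continuousAt_id.pow k).mul h1
      have h4 : ContinuousAt (fun z => g (w z)) 0 := hg.continuousAt.comp h3
      exact (((continuousAt_id.pow (k-1)).mul (h1.pow 2)).mul h4).mul h2
    have a2 : (fun z => (1 + (k+1) * w z) * (v (F z) - v z)) =O[𝓝 0]
        (fun z : ℂ => 1 * z^(k+1)) := by
      refine Asymptotics.IsBigO.mul ?_ hO3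
      apply cont_isBigO_one
      have h1 := h.hv.continuousAt
      have h3 : ContinuousAt w 0 := (continuousAt_id.pow k).mul h1
      exact continuousAt_const.add (continuousAt_const.mul h3)
    have a3 : (fun z => z^(k+1) * (v z * deriv v z)) =O[𝓝 0] (fun z : ℂ => z^(k+1) * 1) := by
      refine Asymptotics.IsBigO.mul (Asymptotics.isBigO_refl _ _) ?_
      apply cont_isBigO_one
      exact h.hv.continuousAt.mul h.hv.deriv.continuousAt
    simp only [one_mul] at a1 a2
    simp only [mul_one] at a3
    exact (a1.add a2).sub a3
  set D : ℂ → ℂ := fun z => (v z * deriv F z)⁻¹ with hD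
  have hDO : D =O[𝓝 0] (fun _ : ℂ => (1:ℂ)) := by
    apply cont_isBigO_one
    refine ContinuousAt.inv₀ (h.hv.continuousAt.mul h.hF.deriv.continuousAt) ?_
    rw [h.hv0, h.deriv0, mul_one]; exact h.hc
  have hQO : (fun z => Nn z * D z) =O[𝓝 0] (fun z : ℂ => z^(k+1) * 1) := hNO.mul hDO
  simp only [mul_one] at hQO
  obtain ⟨C, hC⟩ := hQO.bound
  have heqF : ∀ᶠ z in 𝓝 (0:ℂ), F (F z) - F z = (F z)^(k+1) * v (F z) := by
    have : Tendsto F (𝓝 0) (𝓝 0) := by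
      have := h.hF.continuousAt.tendsto
      rwa [h.F0] at this
    exact this.eventually h.eq
  have hvne : ∀ᶠ z in 𝓝 (0:ℂ), v z ≠ 0 := h.hv.continuousAt.eventually_ne (by rw [h.hv0]; exact h.hc)
  have hdne : ∀ᶠ z in 𝓝 (0:ℂ), deriv F z ≠ 0 :=
    h.hF.deriv.continuousAt.eventually_ne (by rw [h.deriv0]; exact one_ne_zero)
  refine ⟨max C 1, lt_of_lt_of_le one_pos (le_max_right _ _), ?_⟩
  have hall := hC.and (heqF.and (h.eq.and (hvne.and (hdne.and h.deriv_eq))))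
  filter_upwards [hall.filter_mono nhdsWithin_le_nhds, self_mem_nhdsWithin] with z hz hz0
  obtain ⟨hb, e1, e2, n1, n2, e3⟩ := hz
  have hz0 : z ≠ 0 := hz0
  have key : qf F z - 1 = Nn z * D z := by
    rw [qf, e1, e2]
    have e4 : F z = z * (1 + w z) := by
      simp only [hw]
      have : F z = z + z^(k+1) * v z := by rw [← e2]; ring
      rw [this]; ring
    have e5 : (F z)^(k+1) = z^(k+1) * (1 + (k+1) * w z + (w z)^2 * g (w z)) := by
      rw [e4, mul_pow, hgx]; push_cast; ring
    rw [e5]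
    have e6 : (w z)^2 * g (w z) * v (F z) = A z * z^(k+1) := by
      simp only [hA, hw]
      obtain ⟨j, rfl⟩ : ∃ j, k = j + 1 := ⟨k-1, by omega⟩
      simp only [Nat.add_sub_cancel]
      ring
    have e7 : Nn z = (1 + (k+1) * w z + (w z)^2 * g (w z)) * v (F z) - v z * deriv F z := by
      simp only [hN]
      rw [e3, ← e6]
      simp only [hw]
      ring
    rw [e7]
    simp only [hD]
    field_simp
  rw [key]
  refine hb.trans ?_
  rw [norm_pow]
  gcongr
  exact le_max_left _ _

end Parab


/-! ## Part 3: parabolic petals and the parabolic local theorem -/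

def pet (k : ℕ) (c : ℂ) (j : ℕ) : Set ℂ := {z | z ≠ 0 ∧ (j:ℝ)/2 < sg (uf k c z)}

lemma uf_neg (k : ℕ) (c z : ℂ) : uf k (-c) z = - uf k c z := by
  unfold uf
  rw [show (k:ℂ) * (-c) * z^k = -(k * c * z^k) by ring, div_neg]

lemma uf_contAt {k : ℕ} {c z : ℂ} (hk : 1 ≤ k) (hc : c ≠ 0) (hz : z ≠ 0) :
    ContinuousAt (uf k c) z := by
  have hk0 : (k:ℂ) ≠ 0 := by exact_mod_cast (by omega : k ≠ 0)
  unfold uf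
  refine ContinuousAt.div continuousAt_const (by fun_prop) ?_
  exact mul_ne_zero (mul_ne_zero hk0 hc) (pow_ne_zero _ hz)

lemma pet_isOpen {k : ℕ} {c : ℂ} (hk : 1 ≤ k) (hc : c ≠ 0) (j : ℕ) : IsOpen (pet k c j) := by
  rw [isOpen_iff_mem_nhds]
  rintro z ⟨hz, hs⟩
  have h1 : ∀ᶠ w in 𝓝 z, w ≠ 0 := isOpen_ne.mem_nhds hz
  have h2 : ContinuousAt (fun w => sg (uf k c w)) z :=
    sg_continuous.continuousAt.comp (uf_contAt hk hc hz)
  have h3 := h2.eventually_const_lt hs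
  filter_upwards [h1, h3] with w a b using ⟨a, b⟩

lemma pet_anti (k : ℕ) (c : ℂ) : Antitone (pet k c) := by
  intro i j hij z hz
  refine ⟨hz.1, lt_of_le_of_lt ?_ hz.2⟩
  have : (i:ℝ) ≤ j := by exact_mod_cast hij
  linarith

lemma norm_uf (k : ℕ) (c z : ℂ) : ‖uf k c z‖ = 1 / (k * ‖c‖ * ‖z‖^k) := by
  unfold uf; simp

lemma pet_norm {k : ℕ} {c : ℂ} (hk : 1 ≤ k) (hc : c ≠ 0) {j : ℕ} (hj : 1 ≤ j) {z : ℂ}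
    (hz : z ∈ pet k c j) : ‖z‖^k < 4 / (k * ‖c‖ * j) := by
  have h1 := hz.2.trans_le (sg_le _)
  rw [norm_uf] at h1
  have hz0 : 0 < ‖z‖ := norm_pos_iff.2 hz.1
  have hc0 : 0 < ‖c‖ := norm_pos_iff.2 hc
  have hk0 : (0:ℝ) < k := by exact_mod_cast hk
  have hj0 : (0:ℝ) < j := by exact_mod_cast hj
  have hzk : 0 < ‖z‖^k := by positivity
  rw [lt_div_iff₀ (by positivity)]
  rw [mul_one_div, lt_div_iff₀ (by positivity)] at h1
  nlinarith

lemma pet_small {k : ℕ} {c : ℂ} (hk : 1 ≤ k) (hc : c ≠ 0) {ε : ℝ} (hε : 0 < ε) :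
    ∃ j, pet k c j ⊆ Metric.ball 0 ε := by
  have hc0 : 0 < ‖c‖ := norm_pos_iff.2 hc
  have hk0 : (0:ℝ) < k := by exact_mod_cast hk
  obtain ⟨j, hj⟩ := exists_nat_gt (4 / (k * ‖c‖ * ε^k))
  have hj0 : (0:ℝ) < j := lt_of_le_of_lt (by positivity) hj
  have hj1 : 1 ≤ j := by exact_mod_cast hj0
  refine ⟨j, fun z hz => ?_⟩
  rw [mem_ball_zero_iff]
  have h1 := pet_norm hk hc hj1 hz
  by_contra hcon
  push Not at hcon
  have h2 : ε^k ≤ ‖z‖^k := pow_le_pow_left₀ hε.le hcon k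
  have h3 := h2.trans_lt h1
  rw [div_lt_iff₀ (by positivity)] at hj
  rw [lt_div_iff₀ (by positivity)] at h3
  nlinarith

lemma pet_eventually {k : ℕ} {c : ℂ} (hk : 1 ≤ k) (hc : c ≠ 0) {p : ℂ → Prop}
    (h : ∀ᶠ z in 𝓝[≠] (0:ℂ), p z) : ∃ j0, ∀ j ≥ j0, ∀ z ∈ pet k c j, p z := by
  rw [eventually_nhdsWithin_iff, Metric.eventually_nhds_iff_ball] at h
  obtain ⟨ε, hε, h⟩ := h
  obtain ⟨j, hj⟩ := pet_small hk hc hε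
  exact ⟨j, fun i hi z hz => h z (hj (pet_anti k c hi hz)) hz.1⟩

lemma pet_cover {k : ℕ} {c : ℂ} (hk : 1 ≤ k) (hc : c ≠ 0) (j : ℕ) :
    ∀ᶠ z in 𝓝[≠] (0:ℂ), z ∈ pet k c j ∨ z ∈ pet k (-c) j := by
  have hc0 : 0 < ‖c‖ := norm_pos_iff.2 hc
  have hk0 : (0:ℝ) < k := by exact_mod_cast hk
  have h1 : ∀ᶠ z in 𝓝 (0:ℂ), (j:ℝ) * (k * ‖c‖ * ‖z‖^k) < 2 := by
    have : ContinuousAt (fun z : ℂ => (j:ℝ) * (k * ‖c‖ * ‖z‖^k)) 0 := by fun_prop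
    refine this.eventually_lt_const ?_
    simp [zero_pow (by omega : k ≠ 0)]
  filter_upwards [h1.filter_mono nhdsWithin_le_nhds, self_mem_nhdsWithin] with z h hz
  have hz : z ≠ 0 := hz
  have hz0 : 0 < ‖z‖ := norm_pos_iff.2 hz
  have h2 : (j:ℝ)/2 < ‖uf k c z‖ := by
    rw [norm_uf, lt_div_iff₀ (by positivity)]
    linarith
  have h3 := Complex.norm_le_abs_re_add_abs_im (uf k c z)
  rcases le_total 0 (uf k c z).re with h4 | h4
  · left
    refine ⟨hz, ?_⟩
    unfold sg
    rw [abs_of_nonneg h4] at h3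
    linarith
  · right
    refine ⟨hz, ?_⟩
    rw [uf_neg]
    unfold sg
    rw [abs_of_nonpos h4] at h3
    simp only [Complex.neg_re, Complex.neg_im, abs_neg]
    linarith

lemma pet_nonempty {k : ℕ} {c : ℂ} (hk : 1 ≤ k) (hc : c ≠ 0) (j : ℕ) : (pet k c j).Nonempty := by
  have hk0 : (k:ℂ) ≠ 0 := by exact_mod_cast (by omega : k ≠ 0)
  have hy : (((j:ℝ)+1 : ℝ):ℂ) ≠ 0 := by
    have : ((j:ℝ)+1) ≠ 0 := by positivity
    exact_mod_cast this
  obtain ⟨z, hz⟩ := IsAlgClosed.exists_pow_nat_eq (-1/(k*c*(((j:ℝ)+1 : ℝ):ℂ))) (by omega : 0 < k)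
  have hu : uf k c z = (((j:ℝ)+1 : ℝ):ℂ) := by
    unfold uf
    rw [hz]
    field_simp
  refine ⟨z, ?_, ?_⟩
  · rintro rfl
    rw [zero_pow (by omega)] at hz
    have : (-1/(k*c*(((j:ℝ)+1 : ℝ):ℂ))) ≠ 0 :=
      div_ne_zero (by norm_num) (mul_ne_zero (mul_ne_zero hk0 hc) hy)
    exact this hz.symm
  · rw [hu]
    unfold sg
    rw [Complex.ofReal_re, Complex.ofReal_im, abs_zero, add_zero]
    have : (0:ℝ) ≤ j := by positivity
    linarith

namespace Parab
variable {F v : ℂ → ℂ} {k : ℕ} {c : ℂ}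

lemma slope_tendsto (h : Parab F k c v) :
    Tendsto (fun z => (F z - z) / z^(k+1)) (𝓝[≠] 0) (𝓝 c) := by
  have h1 : Tendsto v (𝓝[≠] 0) (𝓝 c) := by
    have := h.hv.continuousAt.tendsto
    rw [h.hv0] at this
    exact this.mono_left nhdsWithin_le_nhds
  refine h1.congr' ?_
  filter_upwards [h.eq.filter_mono nhdsWithin_le_nhds, self_mem_nhdsWithin] with z e hz
  have hz : z ≠ 0 := hz
  rw [e]
  field_simp

lemma u_step (h : Parab F k c v) :
    Tendsto (fun z => uf k c (F z) - uf k c z) (𝓝[≠] 0) (𝓝 1) := by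
  have := uf_tendsto h.hk h.hc h.slope_tendsto
  rwa [div_self h.hc] at this

lemma ne_ev (h : Parab F k c v) : ∀ᶠ z in 𝓝[≠] (0:ℂ), F z - z ≠ 0 ∧ F z ≠ 0 := by
  have h1 := h.slope_tendsto.eventually_ne h.hc
  have h2 := h.hF.differentiableAt.hasDerivAt.eventually_ne (c := 0)
    (by rw [h.deriv0]; exact one_ne_zero)
  filter_upwards [h1, h2] with z a b
  refine ⟨fun e => a ?_, b⟩
  rw [e, zero_div]

lemma petal (h : Parab F k c v) : ∃ M, ∀ m0 ≥ M, ∃ β, Petal F (fun m => pet k c (m+m0)) β := by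
  have hk := h.hk
  have hc0 : 0 < ‖c‖ := norm_pos_iff.2 h.hc
  have hk0 : (0:ℝ) < k := by exact_mod_cast hk
  obtain ⟨C, hC, hq⟩ := h.q_bound
  set p : ℝ := ((k:ℝ)+1)/k with hp
  have hp1 : 1 < p := by rw [hp, lt_div_iff₀ hk0]; linarith
  set β0 : ℕ → ℝ := fun j => C * ((4/(k*‖c‖))^p * (1/(j:ℝ)^p)) with hβ0
  have hsum : Summable β0 :=
    ((Real.summable_one_div_nat_rpow.2 hp1).mul_left _).mul_left _
  have hhalf : ∀ᶠ j in atTop, β0 j < 1/2 :=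
    hsum.tendsto_atTop_zero.eventually_lt_const (by norm_num)
  obtain ⟨M1, hM1⟩ := eventually_atTop.1 hhalf
  have hu := h.u_step
  have hu' : ∀ᶠ z in 𝓝[≠] (0:ℂ), ‖uf k c (F z) - uf k c z - 1‖ < 1/4 := by
    have := Metric.tendsto_nhds.1 hu (1/4) (by norm_num)
    simpa [dist_eq_norm] using this
  have hdan := h.hF.eventually_analyticAt.filter_mono (nhdsWithin_le_nhds (s := {0}ᶜ))
  have hdne : ∀ᶠ z in 𝓝[≠] (0:ℂ), deriv F z ≠ 0 :=
    (h.hF.deriv.continuousAt.eventually_ne (by rw [h.deriv0]; exact one_ne_zero)).filter_mono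
      nhdsWithin_le_nhds
  obtain ⟨M2, hM2⟩ := pet_eventually hk h.hc (hq.and (hu'.and (hdan.and (hdne.and h.ne_ev))))
  refine ⟨max (max M1 M2) 1, fun m0 hm0 => ⟨fun m => β0 (m+m0), ?_⟩⟩
  have hm1 : M1 ≤ m0 := le_trans (le_trans (le_max_left _ _) (le_max_left _ _)) hm0
  have hm2 : M2 ≤ m0 := le_trans (le_trans (le_max_right _ _) (le_max_left _ _)) hm0
  have hm3 : 1 ≤ m0 := le_trans (le_max_right _ _) hm0
  exact {
    isOpen := fun m => pet_isOpen hk h.hc _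
    anti := fun m => pet_anti k c (by omega)
    maps := fun m z hz => by
      have H := hM2 _ (by omega : M2 ≤ m + m0) z hz
      refine ⟨H.2.2.2.2.2, ?_⟩
      have h1 := H.2.1
      set e := uf k c (F z) - uf k c z - 1 with he
      have h2 : uf k c (F z) = (uf k c z + 1) + e := by rw [he]; ring
      rw [h2]
      have h3 := sg_add (uf k c z + 1) e
      have h4 : sg (uf k c z + 1) = sg (uf k c z) + 1 := by
        unfold sg; simp; ring
      have h5 := hz.2
      push_cast at h5 ⊢
      linarith
    bound := fun m z hz => by
      have H := (hM2 _ (by omega : M2 ≤ m + m0) z hz).1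
      refine H.trans ?_
      have h1 := (pet_norm hk h.hc (by omega : 1 ≤ m + m0) hz).le
      simp only [hβ0]
      gcongr
      have e1 : ‖z‖^(k+1) = (‖z‖^k)^p := by
        rw [← Real.rpow_natCast, ← Real.rpow_natCast, ← Real.rpow_mul (norm_nonneg _), hp]
        congr 1
        push_cast
        field_simp
      rw [e1, ← div_eq_mul_one_div, ← Real.div_rpow (by positivity) (by positivity), div_div]
      exact Real.rpow_le_rpow (by positivity) h1 (by linarith)
    summ := (summable_nat_add_iff m0).2 hsum
    half := fun m => (hM1 _ (by omega)).le
    small := fun ε hε => by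
      obtain ⟨j, hj⟩ := pet_small hk h.hc hε
      exact ⟨j, (pet_anti k c (by omega)).trans hj⟩
    diff := fun z hz => (hM2 _ (by omega : M2 ≤ 0 + m0) z hz).2.2.1
    deriv_ne := fun z hz => (hM2 _ (by omega : M2 ≤ 0 + m0) z hz).2.2.2.1
    ne := fun z hz => (hM2 _ (by omega : M2 ≤ 0 + m0) z hz).2.2.2.2.1 }

/-- control on small balls of radius comparable to the displacement -/
lemma ball_control (h : Parab F k c v) {M η : ℝ} (hM : 0 < M) (hη : 0 < η) :
    ∀ᶠ z0 in 𝓝[≠] (0:ℂ), ∀ z, ‖z - z0‖ ≤ M * ‖F z0 - z0‖ →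
      z ≠ 0 ∧ ‖uf k c z - uf k c z0‖ ≤ 4 * M ∧ ‖(F z - z)/(F z0 - z0) - 1‖ ≤ η := by
  have hk := h.hk
  have hc0 : 0 < ‖c‖ := norm_pos_iff.2 h.hc
  obtain ⟨E, hE, hE1, hu⟩ := uf_expand k hk
  -- limits in three independent variables
  have hR : Tendsto (fun q : ℂ × ℂ × ℂ => (1 + q.1)^(k+1) * v q.2.1 / v q.2.2)
      (𝓝 (0, 0, 0)) (𝓝 1) := by
    have : ContinuousAt (fun q : ℂ × ℂ × ℂ => (1 + q.1)^(k+1) * v q.2.1 / v q.2.2) (0,0,0) := by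
      refine ContinuousAt.div (ContinuousAt.mul (by fun_prop) ?_) ?_ ?_
      · exact ContinuousAt.comp (f := fun q : ℂ × ℂ × ℂ => q.2.1) (x := (0,0,0)) h.hv.continuousAt (by fun_prop)
      · exact ContinuousAt.comp (f := fun q : ℂ × ℂ × ℂ => q.2.2) (x := (0,0,0)) h.hv.continuousAt (by fun_prop)
      · simp only [h.hv0]; exact h.hc
    have h2 := this.tendsto
    simpa [h.hv0, h.hc] using h2
  have hR' : ∀ᶠ q : ℂ × ℂ × ℂ in 𝓝 (0,0,0),
      ‖(1 + q.1)^(k+1) * v q.2.1 / v q.2.2 - 1‖ < η := by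
    have := Metric.tendsto_nhds.1 hR η hη
    simpa [dist_eq_norm] using this
  obtain ⟨δ, hδ, hRδ⟩ := Metric.eventually_nhds_iff_ball.1 hR'
  have hEe : ∀ᶠ W in 𝓝 (0:ℂ), ‖E W‖ < 2 :=
    hE.norm.eventually_lt_const (by simp [hE1])
  obtain ⟨δ1, hδ1, hEδ⟩ := Metric.eventually_nhds_iff_ball.1 hEe
  obtain ⟨δ2, hδ2, heq⟩ := Metric.eventually_nhds_iff_ball.1 h.eq
  set δ3 := min (min δ δ1) (min δ2 1) with hδ3
  have hposdel : 0 < δ3 := by positivity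
  have ev1 : ∀ᶠ z0 in 𝓝 (0:ℂ), M * (‖z0‖^k * ‖v z0‖) < δ3 := by
    have : ContinuousAt (fun z0 => M * (‖z0‖^k * ‖v z0‖)) 0 := by
      have := h.hv.continuousAt.norm
      fun_prop
    refine this.eventually_lt_const ?_
    simpa [zero_pow (by omega : k ≠ 0)] using hposdel
  have ev2 : ∀ᶠ z0 in 𝓝 (0:ℂ), ‖v z0‖ < 2 * ‖c‖ := by
    refine h.hv.continuousAt.norm.eventually_lt_const ?_
    simp only [h.hv0]; linarith
  have ev3 : ∀ᶠ z0 in 𝓝 (0:ℂ), ‖z0‖ < δ3/2 :=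
    continuous_norm.continuousAt.eventually_lt_const (by simp only [norm_zero]; positivity)
  have ev := (ev1.and (ev2.and ev3)).filter_mono (nhdsWithin_le_nhds (s := {0}ᶜ))
  filter_upwards [ev, self_mem_nhdsWithin, h.ne_ev] with z0 ⟨h1, h2, h3⟩ hz0 hne z hz
  have hz0 : z0 ≠ 0 := hz0
  have hz0n : 0 < ‖z0‖ := norm_pos_iff.2 hz0
  have a1 : δ3 ≤ δ := (min_le_left _ _).trans (min_le_left _ _)
  have a2 : δ3 ≤ δ1 := (min_le_left _ _).trans (min_le_right _ _)
  have a3 : δ3 ≤ δ2 := (min_le_right _ _).trans (min_le_left _ _)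
  have a4 : δ3 ≤ 1 := (min_le_right _ _).trans (min_le_right _ _)
  have e0 := heq z0 (by rw [mem_ball_zero_iff]; linarith)
  set W := (z - z0)/z0 with hW
  have ez : z = z0 * (1 + W) := by rw [hW]; field_simp; ring
  have hWn : ‖W‖ ≤ M * (‖z0‖^k * ‖v z0‖) := by
    rw [hW, norm_div, div_le_iff₀ hz0n]
    rw [e0, norm_mul, norm_pow] at hz
    calc _ ≤ _ := hz
      _ = _ := by ring
  have hW3 : ‖W‖ < δ3 := hWn.trans_lt h1
  have h1W : 1 + W ≠ 0 := by
    intro e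
    have : W = -1 := by linear_combination e
    rw [this, norm_neg, norm_one] at hW3
    linarith
  have hzne : z ≠ 0 := by rw [ez]; exact mul_ne_zero hz0 h1W
  have hzn : ‖z‖ < δ3 := by
    rw [ez, norm_mul]
    have : ‖1 + W‖ ≤ 1 + ‖W‖ := by
      have := norm_add_le 1 W
      rwa [norm_one] at this
    nlinarith
  have e1 := heq z (by rw [mem_ball_zero_iff]; linarith)
  refine ⟨hzne, ?_, ?_⟩
  · have hE2 := hEδ W (by rw [mem_ball_zero_iff]; linarith)
    rw [ez, hu c z0 W h.hc hz0 h1W, norm_mul, norm_div, norm_mul, norm_pow]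
    have : ‖W‖ / (‖c‖ * ‖z0‖^k) ≤ 2 * M := by
      rw [div_le_iff₀ (by positivity)]
      refine hWn.trans ?_
      have : 0 < ‖z0‖^k := by positivity
      calc M * (‖z0‖^k * ‖v z0‖) ≤ M * (‖z0‖^k * (2 * ‖c‖)) := by gcongr
        _ = _ := by ring
    calc _ ≤ (2 * M) * 2 := by gcongr
      _ = 4 * M := by ring
  · have hb : ((W, z, z0) : ℂ × ℂ × ℂ) ∈ Metric.ball ((0,0,0) : ℂ × ℂ × ℂ) δ := by
      have : ((0,0,0) : ℂ × ℂ × ℂ) = 0 := rfl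
      rw [this, mem_ball_zero_iff, Prod.norm_mk, Prod.norm_mk]
      refine max_lt (by linarith) (max_lt (by linarith) (by linarith))
    have hr := (hRδ _ hb).le
    simp only at hr
    have e2 : (F z - z)/(F z0 - z0) = (1 + W)^(k+1) * v z / v z0 := by
      rw [e1, e0, ez, mul_pow, mul_assoc, mul_div_mul_left _ _ (pow_ne_zero _ hz0)]
    rw [e2]
    exact hr

end Parab

lemma four_close {a b c d : ℂ} (ha : ‖a - 1‖ ≤ 1/40) (hb : ‖b - 1‖ ≤ 1/40) (hc : ‖c - 1‖ ≤ 1/40)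
    (hd : ‖d - 1‖ ≤ 1/40) : ‖a * b / (c * d) - 1‖ ≤ 1/4 := by
  have key : ∀ x y : ℂ, ∀ s : ℝ, s ≤ 1 → ‖x - 1‖ ≤ 1/40 → ‖y - 1‖ ≤ 1/40 →
      ‖x * y - 1‖ ≤ 3/40 := by
    intro x y s _ hx hy
    have : x * y - 1 = (x-1)*(y-1) + (x-1) + (y-1) := by ring
    rw [this]
    have h1 := norm_add₃_le (a := (x-1)*(y-1)) (b := x-1) (c := y-1)
    rw [norm_mul] at h1
    have : ‖x-1‖ * ‖y-1‖ ≤ 1/40 * 1 := by gcongr; linarith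
    linarith
  have h1 := key a b 1 le_rfl ha hb
  have h2 := key c d 1 le_rfl hc hd
  have h3 : 37/40 ≤ ‖c*d‖ := by
    have := norm_sub_norm_le (1:ℂ) (1 - c*d)
    rw [norm_one, sub_sub_cancel, ← norm_neg (1 - c*d), neg_sub] at this
    linarith
  have hcd : c * d ≠ 0 := by
    intro e; rw [e, norm_zero] at h3; norm_num at h3
  have : a * b / (c * d) - 1 = ((a*b - 1) - (c*d - 1)) / (c*d) := by
    rw [sub_sub_sub_cancel_right, sub_div, div_self hcd]
  rw [this, norm_div, div_le_iff₀ (by linarith)]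
  have := norm_sub_le (a*b-1) (c*d-1)
  linarith


lemma uf_hasDeriv {k : ℕ} (hk : 1 ≤ k) {c : ℂ} (hc : c ≠ 0) {w : ℂ} (hw : w ≠ 0) :
    HasDerivAt (uf k c) (1 / (c * w^(k+1))) w := by
  have hk' : (k:ℂ) ≠ 0 := by exact_mod_cast (by omega : k ≠ 0)
  have h1 : HasDerivAt (fun z : ℂ => k * c * z^k) (k * c * (k * w^(k-1))) w :=
    (hasDerivAt_pow k w).const_mul _
  have h2 := (hasDerivAt_const w (-1:ℂ)).fun_div h1 (by positivity)
  refine h2.congr_deriv ?_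
  obtain ⟨l, rfl⟩ : ∃ l, k = l + 1 := ⟨k - 1, by omega⟩
  simp only [Nat.add_sub_cancel]
  field_simp
  ring

lemma pet_of_close {k : ℕ} {c z z0 : ℂ} {J J1 : ℕ} {M : ℝ} (hz : z ≠ 0)
    (hu : ‖uf k c z - uf k c z0‖ ≤ M) (hz0 : z0 ∈ pet k c J) (hJ : (J1:ℝ) + 4 * M ≤ J) :
    z ∈ pet k c J1 := by
  refine ⟨hz, ?_⟩
  have := sg_add (uf k c z0) (uf k c z - uf k c z0)
  rw [add_sub_cancel] at this
  have h2 := hz0.2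
  linarith

lemma Parab.pet_iter {F : ℂ → ℂ} {k : ℕ} {c : ℂ} {m0 : ℕ} {β : ℕ → ℝ}
    (P : Petal F (fun m => pet k c (m+m0)) β) {J : ℕ} (hJ : m0 ≤ J) (n : ℕ) {z : ℂ}
    (hz : z ∈ pet k c J) : F^[n] z ∈ pet k c (J + n) := by
  have := P.iter n (J - m0) (x := z) (by simpa [Nat.sub_add_cancel hJ] using hz)
  have e : J - m0 + n + m0 = J + n := by omega
  simpa [e] using this

/-- Expansion estimate for `u ∘ F^n`. -/
lemma Parab.psi_expand {F v : ℂ → ℂ} {k : ℕ} {c : ℂ} (h : Parab F k c v) {m0 : ℕ} {β : ℕ → ℝ}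
    (P : Petal F (fun m => pet k c (m+m0)) β) {M : ℝ} (hM : 0 < M) (J2 : ℕ) :
    ∃ J, J2 ≤ J ∧ ∀ z0 ∈ pet k c J, ∀ z ∈ Metric.ball z0 (M * ‖F z0 - z0‖),
      z ∈ pet k c J2 ∧ ‖uf k c z - uf k c z0‖ ≤ 4 * M ∧ ‖F z - z‖ ≤ 2 * ‖F z0 - z0‖ ∧
      ∀ n, ‖z - z0‖ ≤ 4/3 * ‖F z0 - z0‖ * ‖uf k c (F^[n] z) - uf k c (F^[n] z0)‖ := by
  obtain ⟨m1, hm1⟩ := P.X_close (ε := 1/40) (by norm_num)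
  have hvc : ∀ᶠ z in 𝓝 (0:ℂ), ‖v z / c - 1‖ ≤ 1/40 := by
    have : Tendsto (fun z => ‖v z / c - 1‖) (𝓝 0) (𝓝 ‖v 0 / c - 1‖) :=
      ((h.hv.continuousAt.div_const c).sub continuousAt_const).norm
    rw [h.hv0, div_self h.hc, sub_self, norm_zero] at this
    exact (this.eventually_lt_const (by norm_num : (0:ℝ) < 1/40)).mono fun _ hx => hx.le
  obtain ⟨j1, hj1⟩ := pet_eventually (p := fun z => ‖v z / c - 1‖ ≤ 1/40 ∧
    F z - z = z^(k+1) * v z) h.hk h.hc ((hvc.and h.eq).filter_mono nhdsWithin_le_nhds)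
  obtain ⟨j2, hj2⟩ := pet_eventually h.hk h.hc (h.ball_control (η := 1/40) hM (by norm_num))
  obtain ⟨n1, hn1⟩ := exists_nat_ge (16 * M)
  set J1 := max J2 (max (m1 + m0) j1) with hJ1
  have hJm : m1 + m0 ≤ J1 := by simp [hJ1]
  have hJj : j1 ≤ J1 := by simp [hJ1]
  have hJ2 : J2 ≤ J1 := by simp [hJ1]
  refine ⟨max j2 (J1 + n1), by omega, fun z0 hz0 => ?_⟩
  have hbc := hj2 _ (le_max_left _ _) z0 hz0
  have hpet : ∀ z ∈ Metric.ball z0 (M * ‖F z0 - z0‖), z ∈ pet k c J1 := by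
    intro z hz
    obtain ⟨h1, h2, h3⟩ := hbc z (by rw [Metric.mem_ball, dist_eq_norm] at hz; exact hz.le)
    refine pet_of_close h1 h2 hz0 ?_
    have : ((J1 + n1 : ℕ) : ℝ) ≤ (max j2 (J1 + n1) : ℕ) := by exact_mod_cast le_max_right _ _
    push_cast at this ⊢
    linarith
  have hz0' : z0 ∈ pet k c J1 := pet_anti k c (by omega) hz0
  have hmem : ∀ z ∈ pet k c J1, z ∈ (fun m => pet k c (m+m0)) 0 := by
    intro z hz
    exact pet_anti k c (by omega) hz
  have hΔ0 : F z0 - z0 ≠ 0 := P.ne _ (hmem _ hz0')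
  intro z hz
  obtain ⟨h1, h2, h3⟩ := hbc z (by rw [Metric.mem_ball, dist_eq_norm] at hz; exact hz.le)
  refine ⟨pet_anti k c hJ2 (hpet z hz), h2, ?_, fun n => ?_⟩
  · have : ‖(F z - z)/(F z0 - z0)‖ ≤ 2 := by
      have := norm_le_norm_add_norm_sub' ((F z - z)/(F z0 - z0)) 1
      rw [norm_one] at this
      linarith
    rwa [norm_div, div_le_iff₀ (norm_pos_iff.2 hΔ0)] at this
  have hder : ∀ w ∈ Metric.ball z0 (M * ‖F z0 - z0‖),
      ∃ D, HasDerivAt (fun y => uf k c (F^[n] y) * (F z0 - z0) - y) D w ∧ ‖D‖ ≤ 1/4 := by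
    intro w hw
    have hwJ := hpet w hw
    have hw0 := hmem w hwJ
    set y := F^[n] w with hy
    have hyJ : y ∈ pet k c J1 :=
      pet_anti k c (by omega : J1 ≤ J1 + n) (Parab.pet_iter P (by omega) n hwJ)
    have hd := (P.iter_an n w hw0).differentiableAt.hasDerivAt
    have hdu := (uf_hasDeriv h.hk h.hc hyJ.1).comp w hd
    have hD := (hdu.mul_const (F z0 - z0)).sub (hasDerivAt_id w)
    refine ⟨_, hD, ?_⟩
    have hX := P.X_iter n hw0
    rw [← hy] at hX
    have hdF : deriv F^[n] w = Xf F y / Xf F w := by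
      rw [hX, mul_div_cancel_right₀ _ (P.X_ne hw0)]
    obtain ⟨hv1, hv2⟩ := hj1 J1 hJj y hyJ
    obtain ⟨_, _, h3w⟩ := hbc w (by rw [Metric.mem_ball, dist_eq_norm] at hw; exact hw.le)
    have hU : ∀ z ∈ pet k c J1, ‖Complex.exp (Lf F z) - 1‖ ≤ 1/40 := by
      intro z hz
      refine hm1 (J1 - m0) (by omega) z ?_
      simpa [Nat.sub_add_cancel (by omega : m0 ≤ J1)] using hz
    have e : 1 / (c * y^(k+1)) * deriv F^[n] w * (F z0 - z0) =
        (v y / c) * Complex.exp (Lf F y) / (((F w - w)/(F z0 - z0)) * Complex.exp (Lf F w)) := by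
      rw [hdF]
      unfold Xf
      rw [hv2]
      have a1 := P.ne w hw0
      have a2 := Complex.exp_ne_zero (Lf F w)
      have a3 := hyJ.1
      have a4 := h.hc
      field_simp
    rw [e]
    exact four_close hv1 (hU y hyJ) h3w (hU w hwJ)
  have hmv : ‖(uf k c (F^[n] z) * (F z0 - z0) - z) - (uf k c (F^[n] z0) * (F z0 - z0) - z0)‖
      ≤ 1/4 * ‖z - z0‖ := by
    refine Convex.norm_image_sub_le_of_norm_deriv_le
      (f := fun y => uf k c (F^[n] y) * (F z0 - z0) - y) (s := Metric.ball z0 (M * ‖F z0 - z0‖))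
      (fun w hw => ?_) (fun w hw => ?_) (convex_ball _ _) ?_ hz
    · obtain ⟨D, hD, _⟩ := hder w hw
      exact hD.differentiableAt
    · obtain ⟨D, hD, hb⟩ := hder w hw
      rw [hD.deriv]; exact hb
    · exact Metric.mem_ball_self (by have := norm_pos_iff.2 hΔ0; positivity)
  have e2 : z - z0 = (uf k c (F^[n] z) - uf k c (F^[n] z0)) * (F z0 - z0) -
     ((uf k c (F^[n] z) * (F z0 - z0) - z) - (uf k c (F^[n] z0) * (F z0 - z0) - z0)) := by ring
  have h5 := norm_sub_le ((uf k c (F^[n] z) - uf k c (F^[n] z0)) * (F z0 - z0))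
     ((uf k c (F^[n] z) * (F z0 - z0) - z) - (uf k c (F^[n] z0) * (F z0 - z0) - z0))
  rw [← e2, norm_mul] at h5
  nlinarith


def wst (F K : ℂ → ℂ) (t : ℝ) (p : ℂ × ℝ) : ℂ × ℝ :=
  if p.2 < 0 then (F p.1, p.2 + 1) else (K p.1, p.2 - t)

lemma Parab.walk {F K v : ℂ → ℂ} {k : ℕ} {c : ℂ} {t : ℝ} (h : Parab F k c v)
    {m0 : ℕ} {β : ℕ → ℝ}
    (P : Petal F (fun m => pet k c (m+m0)) β) (ht : 0 < t) (hirr : Irrational t)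
    (hKs : Tendsto (fun z => (K z - z) / z^(k+1)) (𝓝[≠] 0) (𝓝 (-(t:ℂ) * c)))
    (hcK : ∀ z ∈ pet k c m0, K (F z) = F (K z)) (J2 : ℕ) :
    ∃ J, ∀ z0 ∈ pet k c J, 0 < ‖F z0 - z0‖ ∧
      (∀ z ∈ Metric.ball z0 (5 * (1+t) * ‖F z0 - z0‖),
        z ∈ pet k c J2 ∧ ‖uf k c z - uf k c z0‖ ≤ 4 * (5 * (1+t))) ∧
      ∃ p : ℕ → ℂ, p 0 = z0 ∧ Function.Injective p ∧
        (∀ i, p i ∈ Metric.closedBall z0 (2 * (1+t) * ‖F z0 - z0‖)) ∧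
        ∀ i, p (i+1) = F (p i) ∨ p (i+1) = K (p i) := by
  have hc := h.hc
  have hratio : ∀ᶠ z in 𝓝[≠] (0:ℂ), ‖K z - z‖ ≤ (1+t) * ‖F z - z‖ := by
    have h1 : Tendsto (fun z => ((K z - z) / z^(k+1)) / ((F z - z) / z^(k+1))) (𝓝[≠] 0)
        (𝓝 (-(t:ℂ) * c / c)) := hKs.div h.slope_tendsto hc
    have h2 := h1.norm
    have e : ‖-(t:ℂ) * c / c‖ = t := by
      rw [mul_div_cancel_right₀ _ hc, norm_neg, Complex.norm_real, Real.norm_of_nonneg ht.le]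
    rw [e] at h2
    filter_upwards [h2.eventually_lt_const (by linarith : t < 1 + t), h.ne_ev,
      self_mem_nhdsWithin] with z hz hz2 hz3
    have hz3' : z ≠ 0 := hz3
    have e2 : ((K z - z) / z^(k+1)) / ((F z - z) / z^(k+1)) = (K z - z)/(F z - z) := by
      have := hz2.1
      field_simp
    rw [e2, norm_div, div_lt_iff₀ (norm_pos_iff.2 hz2.1)] at hz
    exact hz.le
  obtain ⟨j1, hj1⟩ := pet_eventually h.hk hc hratio
  obtain ⟨J, hJ, hpsi⟩ := h.psi_expand P (M := 5 * (1+t)) (by positivity) (max J2 (max j1 m0))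
  refine ⟨J, fun z0 hz0 => ?_⟩
  have hm0 : ∀ z ∈ pet k c (max J2 (max j1 m0)), z ∈ (fun m => pet k c (m+m0)) 0 :=
    fun z hz => pet_anti k c (by simp) hz
  have hz0' : z0 ∈ pet k c (max J2 (max j1 m0)) := pet_anti k c hJ hz0
  have hΔ0 : 0 < ‖F z0 - z0‖ := norm_pos_iff.2 (P.ne _ (hm0 _ hz0'))
  set D := ‖F z0 - z0‖ with hD
  refine ⟨hΔ0, fun z hz => ?_, ?_⟩
  · obtain ⟨h1, h2, _⟩ := hpsi z0 hz0 z hz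
    exact ⟨pet_anti k c (by simp) h1, h2⟩
  let q : ℕ → ℂ × ℝ := fun i => (wst F K t)^[i] (z0, 0)
  have hq : ∀ i, q (i+1) = wst F K t (q i) := fun i => Function.iterate_succ_apply' _ _ _
  have hsub : ∀ z ∈ Metric.closedBall z0 (2 * (1+t) * D),
      z ∈ Metric.ball z0 (5 * (1+t) * D) := by
    intro z hz
    refine Metric.closedBall_subset_ball ?_ hz
    nlinarith [mul_pos ht hΔ0]
  -- orbits
  have horb : ∀ z ∈ pet k c (max J2 (max j1 m0)),
      Tendsto (fun n => F^[n] z) atTop (𝓝[≠] 0) := by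
    intro z hz
    refine tendsto_nhdsWithin_iff.2 ⟨P.tendsto_iter (hm0 z hz), Eventually.of_forall fun n => ?_⟩
    exact (P.iter0 n (hm0 z hz)).1
  have hstep : ∀ z z' : ℂ, ∀ x y : ℝ, z ∈ Metric.closedBall z0 (2 * (1+t) * D) →
      ‖z' - z‖ ≤ 2 * (1+t) * D → |x + y| ≤ 1 + t →
      Tendsto (fun n => uf k c (F^[n] z) - uf k c (F^[n] z0)) atTop (𝓝 (x:ℂ)) →
      Tendsto (fun n => uf k c (F^[n] z') - uf k c (F^[n] z)) atTop (𝓝 (y:ℂ)) →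
      z' ∈ Metric.closedBall z0 (2 * (1+t) * D) ∧
      Tendsto (fun n => uf k c (F^[n] z') - uf k c (F^[n] z0)) atTop (𝓝 ((x + y : ℝ):ℂ)) := by
    intro z z' x y hz hz' hxy h1 h2
    have h3 : Tendsto (fun n => uf k c (F^[n] z') - uf k c (F^[n] z0)) atTop
        (𝓝 ((x + y : ℝ):ℂ)) := by
      push_cast
      refine (h1.add h2).congr (fun n => by ring)
    refine ⟨?_, h3⟩
    rw [Metric.mem_closedBall, dist_eq_norm] at hz ⊢
    have hb : z' ∈ Metric.ball z0 (5 * (1+t) * D) := by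
      rw [Metric.mem_ball, dist_eq_norm]
      have := norm_add_le (z' - z) (z - z0)
      rw [sub_add_sub_cancel] at this
      nlinarith [mul_pos ht hΔ0]
    obtain ⟨_, _, _, h4⟩ := hpsi z0 hz0 z' hb
    have h5 : Tendsto (fun n => 4/3 * D * ‖uf k c (F^[n] z') - uf k c (F^[n] z0)‖) atTop
      (𝓝 (4/3 * D * ‖((x + y : ℝ):ℂ)‖)) := h3.norm.const_mul _
    have h6 := ge_of_tendsto h5 (Eventually.of_forall h4)
    rw [Complex.norm_real, Real.norm_eq_abs] at h6
    have : 4/3 * D * |x + y| ≤ 4/3 * D * (1 + t) := by gcongr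
    nlinarith [mul_pos ht hΔ0]
  have hinv : ∀ i, (q i).1 ∈ Metric.closedBall z0 (2 * (1+t) * D) ∧
      -t ≤ (q i).2 ∧ (q i).2 ≤ 1 ∧
      Tendsto (fun n => uf k c (F^[n] (q i).1) - uf k c (F^[n] z0)) atTop
        (𝓝 (((q i).2 : ℝ) : ℂ)) ∧
      ∃ a b : ℕ, a + b = i ∧ (q i).2 = a - b * t := by
    intro i
    induction i with
    | zero =>
      refine ⟨Metric.mem_closedBall_self (by positivity), by simp [q, ht.le], by simp [q],
        by simp [q], 0, 0, rfl, by simp [q]⟩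
    | succ i ih =>
      obtain ⟨i1, i2, i3, i4, a, b, hab, i5⟩ := ih
      obtain ⟨hp1, hp2, hp3, _⟩ := hpsi z0 hz0 _ (hsub _ i1)
      have ho := horb _ hp1
      have hU0 := hm0 _ hp1
      rw [hq, wst]
      split_ifs with hx
      · obtain ⟨s1, s2⟩ := hstep (q i).1 (F (q i).1) (q i).2 1 i1
          (by nlinarith [mul_pos ht hΔ0]) (by rw [abs_le]; constructor <;> linarith) i4 (by
            have := h.u_step.comp ho
            rw [Complex.ofReal_one]
            refine this.congr (fun n => ?_)
            simp only [Function.comp]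
            rw [← Function.iterate_succ_apply' F, Function.iterate_succ_apply])
        refine ⟨s1, by linarith, by linarith, s2, a+1, b, by omega, ?_⟩
        push_cast; rw [i5]; ring
      · push Not at hx
        have hcn : ∀ n, K (F^[n] (q i).1) = F^[n] (K (q i).1) := by
          intro n
          induction n with
          | zero => rfl
          | succ n ih =>
            rw [Function.iterate_succ_apply', Function.iterate_succ_apply', ← ih,
              hcK _ (by simpa using P.iter0 n hU0)]
        have hKr := hj1 j1 le_rfl (q i).1 (pet_anti k c (by simp) hp1)
        obtain ⟨s1, s2⟩ := hstep (q i).1 (K (q i).1) (q i).2 (-t) i1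
          (hKr.trans (by nlinarith [mul_pos ht hΔ0])) (by rw [abs_le]; constructor <;> linarith) i4 (by
            have := (uf_tendsto h.hk hc hKs).comp ho
            rw [mul_div_cancel_right₀ _ hc] at this
            rw [Complex.ofReal_neg]
            refine this.congr (fun n => ?_)
            simp only [Function.comp]
            rw [hcn])
        rw [sub_eq_add_neg]
        refine ⟨s1, by linarith, by linarith, s2, a, b+1, by omega, ?_⟩
        push_cast; rw [i5]; ring
  refine ⟨fun i => (q i).1, rfl, ?_, fun i => (hinv i).1, fun i => ?_⟩
  · intro i j hij
    simp only at hij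
    obtain ⟨_, _, _, i4, a, b, hab, i5⟩ := hinv i
    obtain ⟨_, _, _, j4, a', b', hab', j5⟩ := hinv j
    rw [hij] at i4
    have hx : (q i).2 = (q j).2 := by exact_mod_cast tendsto_nhds_unique i4 j4
    rw [i5, j5] at hx
    have hb : b = b' := by
      by_contra hne
      have hne' : ((b:ℤ) - b' : ℤ) ≠ 0 := by omega
      have : t * (((b:ℤ) - b' : ℤ) : ℝ) = (((a:ℤ) - a' : ℤ) : ℝ) := by push_cast; linarith
      have hr := hirr.mul_intCast hne'
      rw [this] at hr
      exact (Int.not_irrational _) hr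
    subst hb
    have : (a:ℝ) = a' := by linarith
    have : a = a' := by exact_mod_cast this
    omega
  · simp only [hq, wst]
    split_ifs
    · left; rfl
    · right; rfl


lemma uf_scale {k : ℕ} {c z : ℂ} {s : ℝ} (hs : 0 < s) :
    uf k c (s * z) = ((s^k)⁻¹ : ℝ) * uf k c z := by
  unfold uf
  rw [mul_pow]
  push_cast
  have : (s:ℂ)^k ≠ 0 := pow_ne_zero _ (by exact_mod_cast hs.ne')
  rw [show (k:ℂ) * c * (s^k * z^k) = s^k * (k * c * z^k) by ring, ← div_div, ← div_div]
  rw [div_eq_mul_inv (-1 : ℂ) ((s:ℂ)^k)]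
  ring

lemma sg_smul {a : ℝ} (ha : 0 ≤ a) (u : ℂ) : sg (a * u) = a * sg u := by
  unfold sg
  simp [abs_mul, abs_of_nonneg ha]
  ring

lemma pet_scale {k : ℕ} {c z : ℂ} {s : ℝ} (hk : 1 ≤ k) (hs : 0 < s) (hs1 : s ≤ 1) {j J : ℕ}
    (hz : z ∈ pet k c j) (hJ : J * s ≤ j) : (s * z : ℂ) ∈ pet k c J := by
  refine ⟨mul_ne_zero (by exact_mod_cast hs.ne') hz.1, ?_⟩
  rw [uf_scale hs, sg_smul (by positivity)]
  have h1 := hz.2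
  have h2 : s^k ≤ s := pow_le_of_le_one hs.le hs1 (by omega)
  have h3 : 0 < s^k := by positivity
  rw [inv_mul_eq_div, lt_div_iff₀ h3]
  have : (J:ℝ) * s^k ≤ J * s := by gcongr
  linarith

/-- the two petal fields agree up to sign on overlaps -/
lemma Parab.rho {F Fi K v v' : ℂ → ℂ} {k : ℕ} {c : ℂ} {t : ℝ} (h : Parab F k c v)
    (hi : Parab Fi k (-c) v')
    {m0 : ℕ} {β β' : ℕ → ℝ} (hm0 : 1 ≤ m0)
    (P : Petal F (fun m => pet k c (m+m0)) β) (Pi : Petal Fi (fun m => pet k (-c) (m+m0)) β')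
    (ht : 0 < t) (hirr : Irrational t)
    (hKs : Tendsto (fun z => (K z - z) / z^(k+1)) (𝓝[≠] 0) (𝓝 (-(t:ℂ) * c)))
    (hFX : ∀ z ∈ pet k (-c) m0, F z ∈ pet k (-c) m0 → Xf Fi (F z) = deriv F z * Xf Fi z)
    (hKX : ∀ z ∈ pet k c m0, K z ∈ pet k c m0 → Xf F (K z) = deriv K z * Xf F z)
    (hKX' : ∀ z ∈ pet k (-c) m0, K z ∈ pet k (-c) m0 → Xf Fi (K z) = deriv K z * Xf Fi z)
    (hcK : ∀ z ∈ pet k c m0, K (F z) = F (K z))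
    (hK' : ∀ z ∈ pet k c m0, deriv K z ≠ 0) :
    ∃ J, m0 ≤ J ∧ ∀ z ∈ pet k c J, z ∈ pet k (-c) J → Xf F z = - Xf Fi z := by
  obtain ⟨J1, hJ1⟩ := h.walk P ht hirr hKs hcK m0
  obtain ⟨n1, hn1⟩ := exists_nat_ge (4 * (4 * (5 * (1+t))))
  set J := max J1 (m0 + n1) with hJ
  have hJm : m0 ≤ J := by omega
  let ρ : ℂ → ℂ := fun z => Xf F z / Xf Fi z
  have hz0 : ∀ z ∈ pet k c m0, z ∈ (fun m => pet k c (m+m0)) 0 := by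
    intro z hz; simpa using hz
  have hz0' : ∀ z ∈ pet k (-c) m0, z ∈ (fun m => pet k (-c) (m+m0)) 0 := by
    intro z hz; simpa using hz
  -- local constancy
  have hloc : ∀ z ∈ pet k c J, z ∈ pet k (-c) J → ∀ᶠ w in 𝓝 z, ρ w = ρ z := by
    intro z hz hz'
    obtain ⟨hD, hball, p, hp0, hpinj, hpb, hps⟩ := hJ1 z (pet_anti k c (le_max_left _ _) hz)
    set D := ‖F z - z‖
    set B := Metric.ball z (5 * (1+t) * D) with hB
    have hBp : ∀ w ∈ B, w ∈ pet k c m0 := fun w hw => (hball w hw).1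
    have hBm : ∀ w ∈ B, w ∈ pet k (-c) m0 := by
      intro w hw
      obtain ⟨h1, h2⟩ := hball w hw
      refine pet_of_close h1.1 (M := 4 * (5 * (1+t))) ?_ hz' ?_
      · rw [uf_neg, uf_neg, neg_sub_neg, norm_sub_rev]; exact h2
      · have : ((m0 + n1 : ℕ) : ℝ) ≤ J := by exact_mod_cast le_max_right _ _
        push_cast at this
        linarith
    have hsub : Metric.closedBall z (2 * (1+t) * D) ⊆ B :=
      Metric.closedBall_subset_ball (by nlinarith [mul_pos ht hD])
    have han : AnalyticOnNhd ℂ ρ B := by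
      refine DifferentiableOn.analyticOnNhd ?_ Metric.isOpen_ball
      refine DifferentiableOn.div (P.X_diff.mono fun w hw => hz0 _ (hBp w hw))
        (Pi.X_diff.mono fun w hw => hz0' _ (hBm w hw)) ?_
      intro w hw
      exact Pi.X_ne (hz0' _ (hBm w hw))
    have hval : ∀ i, ρ (p i) = ρ z := by
      intro i
      induction i with
      | zero => rw [hp0]
      | succ i ih =>
        rw [← ih]
        have b1 := hsub (hpb i)
        have b2 := hsub (hpb (i+1))
        simp only [ρ]
        rcases hps i with e | e
        · rw [e] at b2 ⊢
          rw [P.X_step (hz0 _ (hBp _ b1)), hFX _ (hBm _ b1) (hBm _ b2), mul_div_mul_left]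
          exact P.deriv_ne _ (hz0 _ (hBp _ b1))
        · rw [e] at b2 ⊢
          rw [hKX _ (hBp _ b1) (hBp _ b2), hKX' _ (hBm _ b1) (hBm _ b2), mul_div_mul_left]
          exact hK' _ (hBp _ b1)
    have hinf : (Set.range p).Infinite := Set.infinite_range_of_injective hpinj
    obtain ⟨y, hy, hacc⟩ := hinf.exists_accPt_of_subset_isCompact
      (isCompact_closedBall z (2 * (1+t) * D)) (by rintro _ ⟨i, rfl⟩; exact hpb i)
    have hfr : ∃ᶠ w in 𝓝[≠] y, ρ w = (fun _ => ρ z) w := by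
      rw [accPt_iff_frequently_nhdsNE] at hacc
      refine hacc.mono ?_
      rintro _ ⟨i, rfl⟩
      exact hval i
    have heq := han.eqOn_of_preconnected_of_frequently_eq analyticOnNhd_const
      (convex_ball _ _).isPreconnected (hsub hy) hfr
    have hzB : B ∈ 𝓝 z := Metric.ball_mem_nhds _ (by positivity)
    filter_upwards [hzB] with w hw
    exact heq hw
  refine ⟨J, hJm, fun z hz hz' => ?_⟩
  have hJ1' : 1 ≤ J := by omega
  -- scaling
  have hsc : ∀ s : ℝ, 0 < s → s ≤ 1 → ρ (s * z) = ρ z := by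
    intro s hs hs1
    have hl : ∀ s' : ℝ, 0 < s' → s' ≤ 1 →
        ∀ᶠ r : ℝ in 𝓝 s', ρ (r * z) = ρ (s' * z) := by
      intro s' hs' hs1'
      have h1 := hloc (s' * z) (pet_scale h.hk hs' hs1' hz (by nlinarith))
        (pet_scale h.hk hs' hs1' hz' (by nlinarith))
      have h2 : ContinuousAt (fun r : ℝ => (r:ℂ) * z) s' := by fun_prop
      exact h2.eventually h1
    have := constant_of_has_deriv_right_zero (f := fun r : ℝ => ρ (r * z)) (a := s) (b := 1)
      (fun x hx => ContinuousAt.continuousWithinAt (by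
        have := hl x (hs.trans_le hx.1) hx.2
        exact (continuousAt_const (y := ρ (x * z))).congr (by
          filter_upwards [this] with r hr
          rw [hr])))
      (fun x hx => by
        have h1 := hl x (hs.trans_le hx.1) hx.2.le
        exact ((hasDerivAt_const x (ρ (x * z))).congr_of_eventuallyEq h1).hasDerivWithinAt)
      1 ⟨hs1, le_rfl⟩
    simp only [Complex.ofReal_one, one_mul] at this
    exact this.symm
  -- limit
  let s : ℕ → ℝ := fun n => 1 / ((n:ℝ) + 1)
  have hs0 : ∀ n, 0 < s n := fun n => by positivity
  have hs1 : ∀ n, s n ≤ 1 := fun n => by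
    simp only [s]; rw [div_le_one (by positivity)]; linarith [Nat.cast_nonneg (α := ℝ) n]
  have hmul : ∀ n : ℕ, (n:ℝ) * s n ≤ J := by
    intro n
    have h1 : (1:ℝ) ≤ J := by exact_mod_cast hJ1'
    have : (n:ℝ) * s n ≤ 1 := by
      simp only [s]; rw [mul_one_div, div_le_one (by positivity)]; linarith
    linarith
  have hwp : ∀ n, (s n * z : ℂ) ∈ pet k c n := fun n => pet_scale h.hk (hs0 n) (hs1 n) hz (hmul n)
  have hwm : ∀ n, (s n * z : ℂ) ∈ pet k (-c) n :=
    fun n => pet_scale h.hk (hs0 n) (hs1 n) hz' (hmul n)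
  have hlim0 : Tendsto (fun n => (s n * z : ℂ)) atTop (𝓝[≠] 0) := by
    refine tendsto_nhdsWithin_iff.2 ⟨?_, Eventually.of_forall fun n => (hwp n).1⟩
    have h1 : Tendsto s atTop (𝓝 0) := tendsto_one_div_add_atTop_nhds_zero_nat
    have h2 : Tendsto (fun n => ((s n : ℝ) : ℂ)) atTop (𝓝 ((0:ℝ):ℂ)) :=
      (Complex.continuous_ofReal.tendsto _).comp h1
    simpa using h2.mul_const z
  have hexp : ∀ {G : ℂ → ℂ} {c' : ℂ} {b : ℕ → ℝ}, Petal G (fun m => pet k c' (m+m0)) b →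
      (∀ n, (s n * z : ℂ) ∈ pet k c' n) →
      Tendsto (fun n => Complex.exp (Lf G (s n * z))) atTop (𝓝 1) := by
    intro G c' b Q hw
    rw [Metric.tendsto_atTop]
    intro ε hε
    obtain ⟨m1, hm1⟩ := Q.X_close (half_pos hε)
    refine ⟨m1 + m0, fun n hn => ?_⟩
    rw [dist_eq_norm]
    have := hm1 (n - m0) (by omega) (s n * z) (by
      simpa [Nat.sub_add_cancel (by omega : m0 ≤ n)] using hw n)
    linarith
  have hr1 := h.slope_tendsto.comp hlim0
  have hr2 := hi.slope_tendsto.comp hlim0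
  have hlim : Tendsto (fun n => ρ (s n * z)) atTop (𝓝 ((c * 1) / (-c * 1))) := by
    refine ((hr1.mul (hexp P hwp)).div (hr2.mul (hexp Pi hwm))
      (by simpa using h.hc)).congr (fun n => ?_)
    simp only [ρ, Xf, Function.comp, _root_.Pi.div_apply]
    have hn : ((s n * z : ℂ))^(k+1) ≠ 0 := pow_ne_zero _ (hwp n).1
    rw [div_mul_eq_mul_div, div_mul_eq_mul_div, div_div_div_cancel_right₀ hn]
  have hconst : Tendsto (fun n => ρ (s n * z)) atTop (𝓝 (ρ z)) :=
    tendsto_const_nhds.congr (fun n => (hsc _ (hs0 n) (hs1 n)).symm)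
  have e := tendsto_nhds_unique hconst hlim
  have e2 : (c * 1) / (-c * 1) = -1 := by
    have := h.hc
    field_simp
  rw [e2] at e
  have hne := Pi.X_ne (hz0' _ (pet_anti k (-c) hJm hz'))
  simp only [ρ] at e
  rw [div_eq_iff hne] at e
  rw [e]; ring



theorem par_local {F Fi K v v' : ℂ → ℂ} {k : ℕ} {c : ℂ} {t : ℝ} (h : Parab F k c v)
    (hi : Parab Fi k (-c) v')
    (ht : 0 < t) (hirr : Irrational t) (hK : AnalyticAt ℂ K 0) (hK' : deriv K 0 ≠ 0)
    (hKs : Tendsto (fun z => (K z - z) / z^(k+1)) (𝓝[≠] 0) (𝓝 (-(t:ℂ) * c)))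
    (hFFi : ∀ᶠ z in 𝓝 (0:ℂ), F (Fi z) = Fi (F z))
    (hKF : ∀ᶠ z in 𝓝 (0:ℂ), K (F z) = F (K z))
    (hKFi : ∀ᶠ z in 𝓝 (0:ℂ), K (Fi z) = Fi (K z)) :
    ∃ X : ℂ → ℂ, AnalyticAt ℂ X 0 ∧ X 0 = 0 ∧
      Tendsto (fun z => X z / (F z - z)) (𝓝[≠] 0) (𝓝 1) ∧
      ∀ H : ℂ → ℂ, AnalyticAt ℂ H 0 → H 0 = 0 → deriv H 0 ≠ 0 →
        (∃ T, Tendsto (fun z => (H z - z) / z^(k+1)) (𝓝[≠] 0) (𝓝 T)) →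
        (∀ᶠ z in 𝓝 (0:ℂ), H (F z) = F (H z)) →
        ∀ᶠ z in 𝓝 (0:ℂ), X (H z) = deriv H z * X z := by
  classical
  have hk := h.hk
  have hc := h.hc
  have hc' : -c ≠ 0 := hi.hc
  have hF'0 : deriv F 0 ≠ 0 := by rw [h.deriv0]; exact one_ne_zero
  obtain ⟨ε1, hε1, g1⟩ := good_nhd h.hF hF'0 hFFi
  obtain ⟨ε2, hε2, g2⟩ := good_nhd hK hK' hKF
  obtain ⟨ε3, hε3, g3⟩ := good_nhd hK hK' hKFi
  obtain ⟨M, hM⟩ := h.petal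
  obtain ⟨M', hM'⟩ := hi.petal
  obtain ⟨j1, hj1⟩ := pet_small hk hc' hε1
  obtain ⟨j2, hj2⟩ := pet_small hk hc hε2
  obtain ⟨j3, hj3⟩ := pet_small hk hc' hε3
  set m0 := 1 + M + M' + j1 + j2 + j3 with hm0
  obtain ⟨β, P⟩ := hM m0 (by omega)
  obtain ⟨β', Pi⟩ := hM' m0 (by omega)
  have e0 : ∀ c' : ℂ, (fun m => pet k c' (m + m0)) 0 = pet k c' m0 := by intro c'; simp
  have s1 : pet k (-c) m0 ⊆ Metric.ball 0 ε1 := (pet_anti k (-c) (by omega)).trans hj1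
  have s2 : pet k c m0 ⊆ Metric.ball 0 ε2 := (pet_anti k c (by omega)).trans hj2
  have s3 : pet k (-c) m0 ⊆ Metric.ball 0 ε3 := (pet_anti k (-c) (by omega)).trans hj3
  obtain ⟨J, hJm, hrho⟩ := h.rho hi (by omega) P Pi ht hirr hKs
    (fun z hz hz' => Pi.X_comm (H := F) Metric.isOpen_ball (by simp only [zero_add]; exact s1)
      (fun w hw => (g1 w hw).1) (Metric.mem_ball_self hε1) hF'0 (fun w hw => (g1 w hw).2.1)
      (fun w hw => (g1 w hw).2.2) (by simp only [zero_add]; exact hz) (by simp only [zero_add]; exact hz'))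
    (fun z hz hz' => P.X_comm (H := K) Metric.isOpen_ball (by simp only [zero_add]; exact s2)
      (fun w hw => (g2 w hw).1) (Metric.mem_ball_self hε2) hK' (fun w hw => (g2 w hw).2.1)
      (fun w hw => (g2 w hw).2.2) (by simp only [zero_add]; exact hz) (by simp only [zero_add]; exact hz'))
    (fun z hz hz' => Pi.X_comm (H := K) Metric.isOpen_ball (by simp only [zero_add]; exact s3)
      (fun w hw => (g3 w hw).1) (Metric.mem_ball_self hε3) hK' (fun w hw => (g3 w hw).2.1)
      (fun w hw => (g3 w hw).2.2) (by simp only [zero_add]; exact hz) (by simp only [zero_add]; exact hz'))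
    (fun z hz => (g2 z (s2 hz)).2.2) (fun z hz => (g2 z (s2 hz)).2.1)
  let X : ℂ → ℂ := fun z => if z ∈ pet k c J then Xf F z else if z = 0 then 0 else - Xf Fi z
  have hXp : ∀ z ∈ pet k c J, X z = Xf F z := fun z hz => by simp only [X, if_pos hz]
  have hXm : ∀ z ∈ pet k (-c) J, X z = - Xf Fi z := by
    intro z hz
    by_cases hz' : z ∈ pet k c J
    · rw [hXp z hz', hrho z hz' hz]
    · simp only [X, if_neg hz', if_neg hz.1]
  have hX0 : X 0 = 0 := by
    have : (0:ℂ) ∉ pet k c J := fun hh => hh.1 rfl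
    simp only [X, if_neg this, if_true]
  have hlim : Tendsto (fun z => X z / (F z - z)) (𝓝[≠] 0) (𝓝 1) := by
    rw [Metric.tendsto_nhds]
    intro ε hε
    set η := min 1 (ε/4) with hη
    have hη0 : 0 < η := by positivity
    have hη1 : η ≤ 1 := min_le_left _ _
    have hη2 : η ≤ ε/4 := min_le_right _ _
    obtain ⟨m1, hm1⟩ := P.X_close hη0
    obtain ⟨m2, hm2⟩ := Pi.X_close hη0
    have hr : Tendsto (fun z => -((Fi z - z)/z^(k+1)) / ((F z - z)/z^(k+1))) (𝓝[≠] 0)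
        (𝓝 (-(-c) / c)) := hi.slope_tendsto.neg.div h.slope_tendsto hc
    rw [neg_neg, div_self hc] at hr
    have hr' := (Metric.tendsto_nhds.1 hr) η hη0
    filter_upwards [pet_cover hk hc (J + m1 + m2), hr', h.ne_ev, self_mem_nhdsWithin]
      with z hz hrz hne hz0
    rw [dist_eq_norm] at hrz ⊢
    have hzk : z^(k+1) ≠ 0 := pow_ne_zero _ hz0
    rcases hz with hz | hz
    · rw [hXp z (pet_anti k c (by omega) hz), Xf, mul_div_cancel_left₀ _ hne.1]
      have := hm1 (J + m1 + m2 - m0) (by omega) z (by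
        simpa [Nat.sub_add_cancel (by omega : m0 ≤ J + m1 + m2)] using hz)
      linarith
    · rw [hXm z (pet_anti k (-c) (by omega) hz), Xf]
      have hx := hm2 (J + m1 + m2 - m0) (by omega) z (by
        simpa [Nat.sub_add_cancel (by omega : m0 ≤ J + m1 + m2)] using hz)
      have e : -((Fi z - z) * Complex.exp (Lf Fi z)) / (F z - z) =
          (-((Fi z - z)/z^(k+1)) / ((F z - z)/z^(k+1))) * Complex.exp (Lf Fi z) := by
        rw [← neg_div, div_div_div_cancel_right₀ hzk]; ring
      rw [e]
      set a := -((Fi z - z)/z^(k+1)) / ((F z - z)/z^(k+1))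
      set b := Complex.exp (Lf Fi z)
      have e2 : a * b - 1 = (a-1)*(b-1) + (a-1) + (b-1) := by ring
      rw [e2]
      have h1 := norm_add₃_le (a := (a-1)*(b-1)) (b := a-1) (c := b-1)
      rw [norm_mul] at h1
      have : ‖a-1‖ * ‖b-1‖ ≤ η * 1 := by gcongr; linarith
      linarith
  have hXan : AnalyticAt ℂ X 0 := by
    refine field_analytic h.hF h.F0 hX0 ?_ (h.ne_ev.mono fun z hz => hz.1) hlim
    filter_upwards [pet_cover hk hc J] with z hz
    rcases hz with hz | hz
    · have hn := (pet_isOpen hk hc J).mem_nhds hz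
      have h1 : DifferentiableAt ℂ (Xf F) z :=
        P.X_diff.differentiableAt (by simp only [zero_add]; exact Filter.mem_of_superset hn (pet_anti k c hJm))
      exact h1.congr_of_eventuallyEq (by filter_upwards [hn] with w hw using hXp w hw)
    · have hn := (pet_isOpen hk hc' J).mem_nhds hz
      have h1 : DifferentiableAt ℂ (Xf Fi) z :=
        Pi.X_diff.differentiableAt
          (by simp only [zero_add]; exact Filter.mem_of_superset hn (pet_anti k (-c) hJm))
      exact h1.neg.congr_of_eventuallyEq (by filter_upwards [hn] with w hw using hXm w hw)
  refine ⟨X, hXan, hX0, hlim, ?_⟩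
  intro H hH hH0 hH' ⟨T, hT⟩ hHF
  obtain ⟨ε4, hε4, g4⟩ := good_nhd hH hH' hHF
  obtain ⟨j4, hj4⟩ := pet_small hk hc hε4
  set m1 := J + M + j4 with hm1
  obtain ⟨β2, P2⟩ := hM m1 (by omega)
  have e1 : (fun m => pet k c (m + m1)) 0 = pet k c m1 := by simp
  have s4 : pet k c m1 ⊆ Metric.ball 0 ε4 := (pet_anti k c (by omega)).trans hj4
  have hbd : ∀ᶠ z in 𝓝[≠] (0:ℂ), ‖uf k c (H z) - uf k c z‖ ≤ ‖T/c‖ + 1 ∧ H z ≠ 0 := by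
    have hne : ∀ᶠ z in 𝓝[≠] (0:ℂ), H z ≠ 0 := by
      have := hH.differentiableAt.hasDerivAt.eventually_ne (c := 0) hH'
      exact this
    filter_upwards [(uf_tendsto hk hc hT).norm.eventually_lt_const (lt_add_one _), hne]
      with z hz hz2 using ⟨hz.le, hz2⟩
  obtain ⟨j5, hj5⟩ := pet_eventually hk hc hbd
  obtain ⟨n1, hn1⟩ := exists_nat_ge (4 * (‖T/c‖ + 1))
  set J' := max j5 (m1 + n1) with hJ'
  have key : ∀ z ∈ pet k c J', X (H z) = deriv H z * X z := by
    intro z hz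
    obtain ⟨b1, b2⟩ := hj5 J' (le_max_left _ _) z hz
    have hHz : H z ∈ pet k c m1 := by
      refine pet_of_close b2 b1 hz ?_
      have : ((m1 + n1 : ℕ) : ℝ) ≤ J' := by exact_mod_cast le_max_right _ _
      push_cast at this
      linarith
    have hz1 : z ∈ pet k c m1 := pet_anti k c (by omega) hz
    rw [hXp _ (pet_anti k c (by omega) hHz), hXp _ (pet_anti k c (by omega) hz)]
    exact P2.X_comm (H := H) Metric.isOpen_ball (by simp only [zero_add]; exact s4)
      (fun w hw => (g4 w hw).1) (Metric.mem_ball_self hε4) hH' (fun w hw => (g4 w hw).2.1)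
      (fun w hw => (g4 w hw).2.2) (by simp only [zero_add]; exact hz1) (by simp only [zero_add]; exact hHz)
  obtain ⟨w, hw⟩ := pet_nonempty hk hc J'
  have hw0 : w ∈ (fun m => pet k c (m + m1)) 0 := by
    simp only [zero_add]; exact pet_anti k c (by omega) hw
  have horb : Tendsto (fun n => F^[n] w) atTop (𝓝[≠] 0) := by
    refine tendsto_nhdsWithin_iff.2 ⟨P2.tendsto_iter hw0, Eventually.of_forall fun n => ?_⟩
    exact (P2.iter0 n hw0).1
  have hfr : ∃ᶠ z in 𝓝[≠] (0:ℂ), X (H z) = deriv H z * X z := by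
    refine horb.frequently (Frequently.of_forall fun n => key _ ?_)
    exact pet_anti k c (by omega : J' ≤ J' + n) (Parab.pet_iter P2 (by omega) n hw)
  have a1 : AnalyticAt ℂ (fun z => X (H z)) 0 := by
    have : AnalyticAt ℂ X (H 0) := by rw [hH0]; exact hXan
    exact this.comp hH
  have a2 : AnalyticAt ℂ (fun z => deriv H z * X z) 0 := hH.deriv.mul hXan
  exact (a1.frequently_eq_iff_eventually_eq a2).1 hfr


/-- complexification of a real-analytic germ -/
lemma complexify {f : ℝ → ℝ} (hf : AnalyticAt ℝ f 0) :
    ∃ F : ℂ → ℂ, AnalyticAt ℂ F 0 ∧ ∀ᶠ y : ℝ in 𝓝 0, F y = f y := by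
  obtain ⟨q, hq⟩ := hf
  rw [hasFPowerSeriesAt_iff] at hq
  let a : ℕ → ℂ := fun n => (q.coeff n : ℂ)
  let Q := FormalMultilinearSeries.ofScalars ℂ a
  have hrad : 0 < Q.radius := by
    obtain ⟨δ, hδ, hb⟩ := Metric.eventually_nhds_iff.1 hq
    have h1 := hb (y := δ/2) (by rw [dist_zero_right, Real.norm_of_nonneg (by positivity)]; linarith)
    obtain ⟨C, hC⟩ := h1.summable.tendsto_atTop_zero.norm.bddAbove_range
    have := Q.le_radius_of_bound C (r := ⟨δ/2, by positivity⟩) (fun n => by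
      rw [FormalMultilinearSeries.ofScalars_norm]
      have := hC ⟨n, rfl⟩
      simp only [norm_smul, norm_pow] at this
      simp only [a, Complex.norm_real]
      rw [Real.norm_of_nonneg (by positivity : 0 ≤ δ/2)] at this
      rw [mul_comm]; exact this)
    refine lt_of_lt_of_le ?_ this
    exact ENNReal.coe_pos.2 (NNReal.coe_pos.1 (by show (0:ℝ) < δ/2; positivity))
  refine ⟨Q.sum, (Q.hasFPowerSeriesOnBall hrad).analyticAt, ?_⟩
  filter_upwards [hq] with y hy
  rw [zero_add] at hy
  have h2 : Q.sum (y:ℂ) = ∑' n, a n • (y:ℂ)^n := FormalMultilinearSeries.ofScalars_sum_eq a (y:ℂ)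
  rw [h2]
  have h3 : HasSum (fun n => a n • (y:ℂ)^n) ((f y : ℝ) : ℂ) := by
    have := Complex.hasSum_ofReal.2 hy
    refine this.congr_fun ?_
    intro n
    simp [a, mul_comm]
  exact h3.tsum_eq

lemma ofReal_tendsto_ne : Tendsto (fun y : ℝ => (y:ℂ)) (𝓝[≠] 0) (𝓝[≠] 0) := by
  refine tendsto_nhdsWithin_iff.2 ⟨?_, ?_⟩
  · have := (Complex.continuous_ofReal.tendsto 0).mono_left (nhdsWithin_le_nhds (s := {0}ᶜ))
    simpa using this
  · filter_upwards [self_mem_nhdsWithin] with y hy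
    have : y ≠ 0 := hy
    simpa using this

lemma ofReal_tendsto0 : Tendsto (fun y : ℝ => (y:ℂ)) (𝓝 0) (𝓝 0) := by
  simpa using Complex.continuous_ofReal.tendsto 0

lemma eq_of_real {A B : ℂ → ℂ} (hA : AnalyticAt ℂ A 0) (hB : AnalyticAt ℂ B 0)
    (h : ∀ᶠ y : ℝ in 𝓝 0, A y = B y) : ∀ᶠ z in 𝓝 (0:ℂ), A z = B z := by
  refine (hA.frequently_eq_iff_eventually_eq hB).1 ?_
  refine ofReal_tendsto_ne.frequently ?_
  exact (h.filter_mono nhdsWithin_le_nhds).frequently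

lemma deriv_of_real {A : ℂ → ℂ} {f : ℝ → ℝ} (hA : AnalyticAt ℂ A 0) (hf : AnalyticAt ℝ f 0)
    (h : ∀ᶠ y : ℝ in 𝓝 0, A y = f y) : ∀ᶠ y : ℝ in 𝓝 0, deriv A y = (deriv f y : ℝ) := by
  have h1 := ofReal_tendsto0.eventually hA.eventually_analyticAt
  filter_upwards [h.eventually_nhds, h1, hf.eventually_analyticAt] with y hy hy1 hy2
  have d1 := hy1.differentiableAt.hasDerivAt.comp_ofReal
  have d2 := hy2.differentiableAt.hasDerivAt.ofReal_comp
  exact (d1.congr_of_eventuallyEq (by filter_upwards [hy] with x hx using hx.symm)).unique d2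

/-- germ action of a commutative group near a common fixed point -/
structure GermAct {Γ : Type*} [CommGroup Γ] (f : Γ → ℝ → ℝ) (p : ℝ) : Prop where
  an : ∀ g, AnalyticAt ℝ (f g) p
  fix : ∀ g, f g p = p
  dpos : ∀ g, 0 < deriv (f g) p
  mul : ∀ g h, ∀ᶠ x in 𝓝 p, f (g * h) x = f g (f h x)
  ne : ∀ g, g ≠ 1 → ¬ ∀ᶠ x in 𝓝 p, f g x = x
  one : ∀ᶠ x in 𝓝 p, f 1 x = x

lemma deriv_pow_expand {w : ℝ → ℝ} (hw : AnalyticAt ℝ w 0) {φ : ℝ → ℝ} {n : ℕ} (hn : 1 ≤ n)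
    (h : ∀ᶠ y in 𝓝 0, φ y = y^n * w y) :
    ∀ᶠ y in 𝓝 0, DifferentiableAt ℝ φ y ∧
      deriv φ y = y^(n-1) * (n * w y + y * deriv w y) := by
  filter_upwards [h.eventually_nhds, hw.eventually_analyticAt] with y hy hy2
  have d : HasDerivAt (fun y => y^n * w y) (n * y^(n-1) * w y + y^n * deriv w y) y :=
    (hasDerivAt_pow n y).mul hy2.differentiableAt.hasDerivAt
  have d2 := d.congr_of_eventuallyEq hy
  refine ⟨d2.differentiableAt, ?_⟩
  rw [d2.deriv]
  obtain ⟨l, rfl⟩ : ∃ l, n = l + 1 := ⟨n-1, by omega⟩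
  simp only [Nat.add_sub_cancel, pow_succ]
  ring

/-- key asymptotics of difference of `φ` -/
lemma diff_asymp {w ψ φ : ℝ → ℝ} (hw : AnalyticAt ℝ w 0) (hw0 : w 0 ≠ 0) {n : ℕ} (hn : 1 ≤ n)
    (h : ∀ᶠ y in 𝓝 0, φ y = y^n * w y) (hψ : Tendsto (fun y => ψ y / y) (𝓝[≠] 0) (𝓝 0))
    (hψ0 : ∀ᶠ y in 𝓝[≠] 0, ψ y ≠ 0) :
    Tendsto (fun y => (φ (y + ψ y) - φ y) / ψ y * y / φ y) (𝓝[≠] 0) (𝓝 n) := by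
  have hD := deriv_pow_expand hw hn h
  obtain ⟨δ, hδ, hb⟩ := Metric.eventually_nhds_iff.1 hD
  have hψ' : ∀ᶠ y in 𝓝[≠] (0:ℝ), |ψ y| < |y| := by
    filter_upwards [(hψ.abs).eventually_lt_const (by norm_num : |(0:ℝ)| < 1),
      self_mem_nhdsWithin] with y hy hy0
    have : y ≠ 0 := hy0
    rwa [abs_div, div_lt_one (abs_pos.2 this)] at hy
  have hsmall : ∀ᶠ y in 𝓝[≠] (0:ℝ), |y| < δ/2 := by
    have : ∀ᶠ y in 𝓝 (0:ℝ), |y| < δ/2 :=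
      (continuous_abs.tendsto (0:ℝ)).eventually_lt_const (by simpa using hδ)
    exact this.filter_mono nhdsWithin_le_nhds
  -- choose intermediate points
  have hex : ∀ᶠ y in 𝓝[≠] (0:ℝ), ∃ ξ, |ξ - y| ≤ |ψ y| ∧
      (φ (y + ψ y) - φ y) / ψ y = ξ^(n-1) * (n * w ξ + ξ * deriv w ξ) := by
    filter_upwards [hψ', hsmall, hψ0] with y h1 h2 h3
    have hdd : ∀ x, |x - y| ≤ |ψ y| → DifferentiableAt ℝ φ x ∧
      deriv φ x = x^(n-1) * (n * w x + x * deriv w x) := by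
      intro x hx
      refine hb ?_
      rw [dist_zero_right, Real.norm_eq_abs]
      have := abs_add_le (x - y) y
      rw [sub_add_cancel] at this
      linarith
    rcases lt_or_gt_of_ne h3 with hneg | hpos
    · have hab : ∀ x ∈ Icc (y + ψ y) y, |x - y| ≤ |ψ y| := by
        intro x hx
        rw [abs_of_neg hneg, abs_le]
        constructor <;> linarith [hx.1, hx.2]
      obtain ⟨ξ, hξ, e⟩ := exists_deriv_eq_slope φ (a := y + ψ y) (b := y) (by linarith)
        (fun x hx => (hdd x (hab x hx)).1.continuousAt.continuousWithinAt)
        (fun x hx => (hdd x (hab x (Ioo_subset_Icc_self hx))).1.differentiableWithinAt)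
      have hm := hab ξ (Ioo_subset_Icc_self hξ)
      refine ⟨ξ, hm, ?_⟩
      rw [← (hdd ξ hm).2, e, ← neg_sub (φ y), ← neg_div_neg_eq, neg_neg]
      congr 1
      ring
    · have hab : ∀ x ∈ Icc y (y + ψ y), |x - y| ≤ |ψ y| := by
        intro x hx
        rw [abs_of_pos hpos, abs_le]
        constructor <;> linarith [hx.1, hx.2]
      obtain ⟨ξ, hξ, e⟩ := exists_deriv_eq_slope φ (a := y) (b := y + ψ y) (by linarith)
        (fun x hx => (hdd x (hab x hx)).1.continuousAt.continuousWithinAt)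
        (fun x hx => (hdd x (hab x (Ioo_subset_Icc_self hx))).1.differentiableWithinAt)
      have hm := hab ξ (Ioo_subset_Icc_self hξ)
      refine ⟨ξ, hm, ?_⟩
      rw [← (hdd ξ hm).2, e]
      congr 1
      ring
  obtain ⟨ξ, hξ⟩ := hex.choice
  have hξr : Tendsto (fun y => ξ y / y) (𝓝[≠] 0) (𝓝 1) := by
    have : Tendsto (fun y => ξ y / y - 1) (𝓝[≠] 0) (𝓝 0) := by
      refine squeeze_zero_norm' ?_ (by simpa using hψ.norm)
      filter_upwards [hξ, self_mem_nhdsWithin] with y hy hy0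
      have hy0' : y ≠ 0 := hy0
      have : ξ y / y - 1 = (ξ y - y)/y := by field_simp
      rw [this, norm_div]
      simp only [Real.norm_eq_abs, abs_div]
      exact div_le_div_of_nonneg_right hy.1 (abs_nonneg _)
    simpa using this.add_const 1
  have hid : Tendsto (fun y : ℝ => y) (𝓝[≠] 0) (𝓝 0) := tendsto_id.mono_left nhdsWithin_le_nhds
  have hξ0 : Tendsto ξ (𝓝[≠] 0) (𝓝 0) := by
    have := hξr.mul hid
    rw [mul_zero] at this
    refine this.congr' ?_
    filter_upwards [self_mem_nhdsWithin] with y hy0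
    have hy0' : y ≠ 0 := hy0
    field_simp
  have hV : Tendsto (fun y => n * w y + y * deriv w y) (𝓝 0) (𝓝 (n * w 0)) := by
    have := (hw.continuousAt.tendsto.const_mul (n:ℝ)).add
      (continuousAt_id.tendsto.mul hw.deriv.continuousAt.tendsto)
    simpa using this
  have hfin : Tendsto (fun y => (ξ y / y)^(n-1) * (n * w (ξ y) + ξ y * deriv w (ξ y)) / w y)
      (𝓝[≠] 0) (𝓝 (1^(n-1) * (n * w 0) / w 0)) :=
    ((hξr.pow _).mul (hV.comp hξ0)).div (hw.continuousAt.tendsto.mono_left nhdsWithin_le_nhds) hw0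
  have e : (1:ℝ)^(n-1) * (n * w 0) / w 0 = n := by field_simp; simp
  rw [e] at hfin
  have hwne : ∀ᶠ y in 𝓝[≠] (0:ℝ), w y ≠ 0 :=
    (hw.continuousAt.eventually_ne hw0).filter_mono nhdsWithin_le_nhds
  refine hfin.congr' ?_
  filter_upwards [hξ, self_mem_nhdsWithin, h.filter_mono nhdsWithin_le_nhds, hwne]
    with y h1 h2 h3 h4
  have h2' : y ≠ 0 := h2
  rw [h1.2, h3]
  obtain ⟨l, rfl⟩ : ∃ l, n = l + 1 := ⟨n-1, by omega⟩
  simp only [Nat.add_sub_cancel]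
  rw [div_pow, pow_succ]
  field_simp


lemma pow_factor {f : ℝ → ℝ} (hf : AnalyticAt ℝ f 0) (h0 : f 0 = 0) (h1 : deriv f 0 = 1)
    (hne : ¬ ∀ᶠ y in 𝓝 0, f y = y) :
    ∃ (n : ℕ) (w : ℝ → ℝ), 2 ≤ n ∧ AnalyticAt ℝ w 0 ∧ w 0 ≠ 0 ∧
      ∀ᶠ y in 𝓝 0, f y - y = y^n * w y := by
  have hφ : AnalyticAt ℝ (fun y => f y - y) 0 := hf.sub analyticAt_id
  obtain ⟨n, w, hw, hw0, hw1⟩ := hφ.exists_eventuallyEq_pow_smul_nonzero_iff.2 (by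
    intro h; apply hne; filter_upwards [h] with y hy; linarith)
  simp only [sub_zero, smul_eq_mul] at hw1
  refine ⟨n, w, ?_, hw, hw0, hw1⟩
  by_contra hn
  have hd : deriv (fun y => f y - y) 0 = 0 := by
    have := hf.differentiableAt.hasDerivAt.sub (hasDerivAt_id (0:ℝ))
    rw [h1, sub_self] at this
    exact this.deriv
  have : n = 0 ∨ n = 1 := by omega
  rcases this with rfl | rfl
  · have := hw1.self_of_nhds
    rw [h0] at this; simp at this; exact hw0 this.symm
  · have := (deriv_pow_expand hw le_rfl hw1).self_of_nhds.2
    rw [hd] at this; simp at this; exact hw0 this.symm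

lemma same_order {f g w w' : ℝ → ℝ} {n m : ℕ} (hn : 2 ≤ n) (hm : 2 ≤ m)
    (hw : AnalyticAt ℝ w 0) (hw0 : w 0 ≠ 0) (hw' : AnalyticAt ℝ w' 0) (hw0' : w' 0 ≠ 0)
    (hf : ∀ᶠ y in 𝓝 0, f y - y = y^n * w y) (hg : ∀ᶠ y in 𝓝 0, g y - y = y^m * w' y)
    (hc : ∀ᶠ y in 𝓝 0, f (g y) = g (f y)) : n = m := by
  have aux : ∀ {u v : ℝ → ℝ} {l : ℕ}, 2 ≤ l → AnalyticAt ℝ v 0 → v 0 ≠ 0 →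
      (∀ᶠ y in 𝓝 0, u y - y = y^l * v y) →
      Tendsto (fun y => (u y - y) / y) (𝓝[≠] 0) (𝓝 0) ∧ ∀ᶠ y in 𝓝[≠] 0, u y - y ≠ 0 := by
    intro u v l hl hv hv0 hu
    constructor
    · have : Tendsto (fun y => y^(l-1) * v y) (𝓝[≠] 0) (𝓝 (0^(l-1) * v 0)) :=
        (((continuousAt_id.pow (l-1)).mul hv.continuousAt).tendsto).mono_left nhdsWithin_le_nhds
      rw [zero_pow (by omega), zero_mul] at this
      refine this.congr' ?_
      filter_upwards [hu.filter_mono nhdsWithin_le_nhds, self_mem_nhdsWithin] with y h1 h2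
      have h2' : y ≠ 0 := h2
      rw [h1]
      obtain ⟨j, rfl⟩ : ∃ j, l = j + 1 := ⟨l-1, by omega⟩
      simp only [Nat.add_sub_cancel, pow_succ]
      field_simp
    · filter_upwards [hu.filter_mono nhdsWithin_le_nhds, self_mem_nhdsWithin,
        (hv.continuousAt.eventually_ne hv0).filter_mono nhdsWithin_le_nhds] with y h1 h2 h3
      have h2' : y ≠ 0 := h2
      rw [h1]; positivity
  obtain ⟨f1, f2⟩ := aux hn hw hw0 hf
  obtain ⟨g1, g2⟩ := aux hm hw' hw0' hg
  have A := diff_asymp hw hw0 (by omega : 1 ≤ n) hf g1 g2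
  have B := diff_asymp hw' hw0' (by omega : 1 ≤ m) hg f1 f2
  have C := tendsto_nhds_unique (A.congr' (f₂ := fun y =>
    (g (y + (f y - y)) - (y + (f y - y)) - (g y - y)) / (f y - y) * y / (g y - y)) (by
      filter_upwards [hc.filter_mono nhdsWithin_le_nhds, f2, g2] with y h1 h2 h3
      have e1 : y + (g y - y) = g y := by ring
      have e2 : y + (f y - y) = f y := by ring
      rw [e1, e2, h1]
      field_simp
      ring)) B
  exact_mod_cast C

lemma cyclic_of_rational {Γ : Type*} [CommGroup Γ] [hfg : Group.FG Γ] (t : Γ → ℝ)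
    (hadd : ∀ g h, t (g * h) = t g + t h) (hinj : ∀ g, t g = 0 → g = 1) {c : ℝ} (hc : c ≠ 0)
    (hq : ∀ g, ∃ q : ℚ, t g = q * c) : IsCyclic Γ := by
  obtain ⟨S, hS⟩ := Group.fg_iff'.1 hfg
  obtain ⟨S, -, hS⟩ := hS
  choose q hq using hq
  have h1 : t 1 = 0 := by have := hadd 1 1; simp at this; exact this
  let N : ℕ := ∏ s ∈ S, (q s).den
  have hN : (N:ℝ) ≠ 0 := by
    have : N ≠ 0 := Finset.prod_ne_zero_iff.2 (fun s _ => (q s).den_ne_zero)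
    exact_mod_cast this
  have key : ∀ g, ∃ m : ℤ, t g * N = m * c := by
    intro g
    have hg : g ∈ Subgroup.closure (S : Set Γ) := by rw [hS]; trivial
    induction hg using Subgroup.closure_induction with
    | mem x hx =>
      obtain ⟨M, hM⟩ : (q x).den ∣ N := Finset.dvd_prod_of_mem (fun s => (q s).den) hx
      refine ⟨(q x).num * M, ?_⟩
      rw [hq, hM]
      have : (q x : ℝ) * ((q x).den : ℝ) = (q x).num := by exact_mod_cast Rat.mul_den_eq_num (q x)
      push_cast
      rw [← this]; ring
    | one => exact ⟨0, by simp [h1]⟩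
    | mul x y _ _ hx hy =>
      obtain ⟨a, ha⟩ := hx
      obtain ⟨b, hb⟩ := hy
      exact ⟨a + b, by rw [hadd, add_mul, ha, hb]; push_cast; ring⟩
    | inv x _ hx =>
      obtain ⟨a, ha⟩ := hx
      refine ⟨-a, ?_⟩
      have := hadd x x⁻¹
      rw [mul_inv_cancel, h1] at this
      have e : t x⁻¹ = - t x := by linarith
      rw [e, neg_mul, ha]; push_cast; ring
  choose m hm using key
  let φ : Γ →* Multiplicative ℤ := MonoidHom.mk' (fun g => Multiplicative.ofAdd (m g)) (by
    intro a b
    rw [← ofAdd_add]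
    congr 1
    have : (m (a*b) : ℝ) * c = (m a + m b) * c := by
      rw [← hm, hadd, add_mul, hm, hm]; ring
    exact_mod_cast mul_right_cancel₀ hc this)
  refine isCyclic_of_injective φ ?_
  refine (injective_iff_map_eq_one φ).2 ?_
  intro a ha
  have : m a = 0 := ha
  apply hinj
  have h2 := hm a
  rw [this] at h2
  simpa [hN] using h2

section
variable {Γ : Type*} [CommGroup Γ] {f : Γ → ℝ → ℝ}

lemma GermAct.comm {p : ℝ} (ga : GermAct f p) (g h : Γ) :
    ∀ᶠ x in 𝓝 p, f g (f h x) = f h (f g x) := by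
  filter_upwards [ga.mul g h, ga.mul h g] with x h1 h2
  rw [← h1, ← h2, mul_comm]

lemma GermAct.deriv_mul {p : ℝ} (ga : GermAct f p) (g h : Γ) :
    deriv (f (g*h)) p = deriv (f g) p * deriv (f h) p := by
  rw [Filter.EventuallyEq.deriv_eq (f := fun x => f g (f h x)) (ga.mul g h)]
  have a := (ga.an g).differentiableAt.hasDerivAt
  have b := (ga.an h).differentiableAt.hasDerivAt
  rw [← ga.fix h] at a
  have := a.comp p b
  rw [ga.fix h] at this
  exact this.deriv

lemma GermAct.deriv_one {p : ℝ} (ga : GermAct f p) : deriv (f 1) p = 1 := by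
  rw [Filter.EventuallyEq.deriv_eq (f := fun x => x) ga.one]; simp

lemma real_field (ga : GermAct f 0) {F : Γ → ℂ → ℂ} (hFan : ∀ g, AnalyticAt ℂ (F g) 0)
    (hF : ∀ g, ∀ᶠ y : ℝ in 𝓝 0, F g y = f g y) {X : ℂ → ℂ} (hX : AnalyticAt ℂ X 0) (hX0 : X 0 = 0)
    {g0 : Γ} (hlim : Tendsto (fun z => X z / (F g0 z - z)) (𝓝[≠] 0) (𝓝 1))
    (hinv : ∀ h, ∀ᶠ z in 𝓝 0, X (F h z) = deriv (F h) z * X z) :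
    ∃ Y : ℝ → ℝ, AnalyticAt ℝ Y 0 ∧ Y 0 = 0 ∧ (∀ᶠ x in 𝓝[≠] 0, Y x ≠ 0) ∧
      ∀ g, ∀ᶠ x in 𝓝 0, Y (f g x) = deriv (f g) x * Y x := by
  refine ⟨fun y => (X y).re, ?_, by simp [hX0], ?_, ?_⟩
  · exact AnalyticAt.re_ofReal (by simpa using hX)
  · have h1 := (Complex.continuous_re.tendsto _).comp (hlim.comp ofReal_tendsto_ne)
    have h2 := h1.eventually_ne (show (1:ℂ).re ≠ 0 by simp)
    filter_upwards [h2, (hF g0).filter_mono nhdsWithin_le_nhds] with y hy hy2 h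
    apply hy
    simp only [Function.comp]
    rw [hy2, ← Complex.ofReal_sub, Complex.div_ofReal_re, h, zero_div]
  · intro g
    filter_upwards [ofReal_tendsto0.eventually (hinv g), hF g,
      deriv_of_real (hFan g) (ga.an g) (hF g)] with y h1 h2 h3
    rw [h2, h3] at h1
    rw [h1, Complex.re_ofReal_mul]

lemma real_local0 [Group.FG Γ] (hnc : ¬ IsCyclic Γ) (ga : GermAct f 0) :
    ∃ Y : ℝ → ℝ, AnalyticAt ℝ Y 0 ∧ Y 0 = 0 ∧ (∀ᶠ x in 𝓝[≠] 0, Y x ≠ 0) ∧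
      ∀ g, ∀ᶠ x in 𝓝 0, Y (f g x) = deriv (f g) x * Y x := by
  choose F hFan hF using fun g => complexify (ga.an g)
  have F0 : ∀ g, F g 0 = 0 := by
    intro g; have := (hF g).self_of_nhds; rw [ga.fix] at this; simpa using this
  have dF : ∀ g, deriv (F g) 0 = (deriv (f g) 0 : ℝ) := by
    intro g; have := (deriv_of_real (hFan g) (ga.an g) (hF g)).self_of_nhds; simpa using this
  have dF0 : ∀ g, deriv (F g) 0 ≠ 0 := by
    intro g; rw [dF]; exact_mod_cast (ga.dpos g).ne'
  have Fcomp : ∀ g h, AnalyticAt ℂ (fun z => F g (F h z)) 0 := by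
    intro g h
    exact AnalyticAt.comp' (by rw [F0]; exact hFan g) (hFan h)
  have Fcommr : ∀ g h, ∀ᶠ z in 𝓝 (0:ℂ), F g (F h z) = F h (F g z) := by
    intro g h
    refine eq_of_real (Fcomp g h) (Fcomp h g) ?_
    have c1 : Tendsto (f h) (𝓝 0) (𝓝 0) := by
      have := (ga.an h).continuousAt.tendsto; rwa [ga.fix] at this
    have c2 : Tendsto (f g) (𝓝 0) (𝓝 0) := by
      have := (ga.an g).continuousAt.tendsto; rwa [ga.fix] at this
    filter_upwards [hF g, hF h, c1.eventually (hF g), c2.eventually (hF h), ga.comm g h]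
      with y h1 h2 h3 h4 h5
    rw [h1, h2, h3, h4, h5]
  by_cases hpar : ∀ g, deriv (f g) 0 = 1
  · -- parabolic case
    obtain ⟨g0, hg0⟩ : ∃ g0 : Γ, g0 ≠ 1 := by
      by_contra! h
      have : Subsingleton Γ := ⟨fun a b => by rw [h a, h b]⟩
      exact hnc inferInstance
    obtain ⟨n, w0, hn, hw0a, hw0, hw0e⟩ := pow_factor (ga.an g0) (ga.fix g0) (hpar g0) (ga.ne g0 hg0)
    obtain ⟨k, rfl⟩ : ∃ k, n = k + 1 := ⟨n-1, by omega⟩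
    have hall : ∀ g, ∃ w : ℝ → ℝ, AnalyticAt ℝ w 0 ∧ (g ≠ 1 → w 0 ≠ 0) ∧
        ∀ᶠ y in 𝓝 0, f g y - y = y^(k+1) * w y := by
      intro g
      by_cases hg : g = 1
      · refine ⟨0, analyticAt_const, fun h => absurd hg h, ?_⟩
        subst hg
        filter_upwards [ga.one] with y hy
        rw [hy]; simp
      · obtain ⟨m, w, hm, hwa, hw, hwe⟩ := pow_factor (ga.an g) (ga.fix g) (hpar g) (ga.ne g hg)
        have : m = k + 1 := same_order hm hn hwa hw hw0a hw0 hwe hw0e (ga.comm g g0)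
        subst this
        exact ⟨w, hwa, fun _ => hw, hwe⟩
    choose w hwa hwne hwe using hall
    have hadd : ∀ g h, w (g*h) 0 = w g 0 + w h 0 := by
      intro g h
      have c1 : Tendsto (f h) (𝓝 0) (𝓝 0) := by
        have := (ga.an h).continuousAt.tendsto; rwa [ga.fix] at this
      have hA : Tendsto (w (g*h)) (𝓝[≠] 0) (𝓝 (w (g*h) 0)) :=
        (hwa _).continuousAt.tendsto.mono_left nhdsWithin_le_nhds
      have hr : Tendsto (fun y => 1 + y^k * w h y) (𝓝[≠] 0) (𝓝 (1 + 0^k * w h 0)) :=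
        (((continuousAt_id.pow k).mul (hwa h).continuousAt).const_add 1).tendsto.mono_left
          nhdsWithin_le_nhds
      have hk0 : k ≠ 0 := by omega
      rw [zero_pow hk0, zero_mul, add_zero] at hr
      have hB : Tendsto (fun y => (1 + y^k * w h y)^(k+1) * w g (f h y) + w h y) (𝓝[≠] 0)
          (𝓝 (1^(k+1) * w g 0 + w h 0)) :=
        ((hr.pow _).mul (((hwa g).continuousAt.tendsto.comp c1).mono_left nhdsWithin_le_nhds)).add
          ((hwa h).continuousAt.tendsto.mono_left nhdsWithin_le_nhds)
      rw [one_pow, one_mul] at hB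
      refine tendsto_nhds_unique (hA.congr' ?_) hB
      filter_upwards [self_mem_nhdsWithin, (hwe (g*h)).filter_mono nhdsWithin_le_nhds,
        (hwe h).filter_mono nhdsWithin_le_nhds, (c1.eventually (hwe g)).filter_mono nhdsWithin_le_nhds,
        (ga.mul g h).filter_mono nhdsWithin_le_nhds] with y h1 h2 h3 h4 h5
      have h1' : y ≠ 0 := h1
      have e : f h y = y * (1 + y^k * w h y) := by
        have : f h y = y + y^(k+1) * w h y := by linarith
        rw [this, pow_succ]; ring
      have h6 : y^(k+1) * w (g*h) y = y^(k+1) * ((1 + y^k * w h y)^(k+1) * w g (f h y) + w h y) := by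
        rw [← h2, h5]
        have : f g (f h y) - y = (f g (f h y) - f h y) + (f h y - y) := by ring
        rw [this, h4, h3]
        have : (f h y)^(k+1) = y^(k+1) * (1 + y^k * w h y)^(k+1) := by rw [← mul_pow, ← e]
        rw [this]; ring
      exact mul_left_cancel₀ (pow_ne_zero _ h1') h6
    have hinj : ∀ g, w g 0 = 0 → g = 1 := by
      intro g hg; by_contra h; exact hwne g h hg
    have h1 : w 1 0 = 0 := by have := hadd 1 1; simp at this; exact this
    have hinvt : ∀ g, w g⁻¹ 0 = - w g 0 := by
      intro g
      have := hadd g g⁻¹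
      rw [mul_inv_cancel, h1] at this; linarith
    have hc0 := hwne g0 hg0
    obtain ⟨g1, t, ht, hirr, hg1⟩ : ∃ (g1 : Γ) (t : ℝ), 0 < t ∧ Irrational t ∧ w g1 0 = -t * w g0 0 := by
      by_contra! hcon
      apply hnc
      refine cyclic_of_rational (fun g => w g 0) hadd hinj hc0 ?_
      intro g
      by_contra! hq
      have hir : Irrational (w g 0 / w g0 0) := by
        rintro ⟨q, hq'⟩
        apply hq q
        rw [hq']; field_simp
      rcases lt_or_gt_of_ne hir.ne_zero with hlt | hgt
      · refine hcon g (-(w g 0 / w g0 0)) (by linarith) hir.neg ?_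
        field_simp
      · refine hcon g⁻¹ ((w g 0 / w g0 0)) hgt hir ?_
        rw [hinvt]; field_simp
    choose W hWa hW using fun g => complexify (hwa g)
    have W0 : ∀ g, W g 0 = (w g 0 : ℝ) := by
      intro g; have := (hW g).self_of_nhds; simpa using this
    have hWe : ∀ g, ∀ᶠ z in 𝓝 (0:ℂ), F g z - z = z^(k+1) * W g z := by
      intro g
      refine eq_of_real ((hFan g).sub analyticAt_id) ((analyticAt_id.pow _).mul (hWa g)) ?_
      filter_upwards [hF g, hW g, hwe g] with y h1 h2 h3
      show F g y - y = (y:ℂ)^(k+1) * W g y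
      rw [h1, h2]; exact_mod_cast h3
    have slope : ∀ g, Tendsto (fun z => (F g z - z)/z^(k+1)) (𝓝[≠] 0) (𝓝 (w g 0 : ℝ)) := by
      intro g
      rw [← W0]
      refine ((hWa g).continuousAt.tendsto.mono_left nhdsWithin_le_nhds).congr' ?_
      filter_upwards [(hWe g).filter_mono nhdsWithin_le_nhds, self_mem_nhdsWithin] with z h1 h2
      have h2' : z ≠ 0 := h2
      rw [h1]; field_simp
    have P0 : Parab (F g0) k (w g0 0 : ℝ) (W g0) :=
      { hk := by omega, hF := hFan g0, hv := hWa g0, hv0 := W0 g0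
        hc := by exact_mod_cast hc0, eq := hWe g0 }
    have Pi0 : Parab (F g0⁻¹) k (-((w g0 0 : ℝ):ℂ)) (W g0⁻¹) :=
      { hk := by omega, hF := hFan _, hv := hWa _, hv0 := by rw [W0, hinvt]; push_cast; rfl
        hc := by rw [neg_ne_zero]; exact_mod_cast hc0, eq := hWe _ }
    obtain ⟨X, hX, hX0, hlim, hinv⟩ := par_local P0 Pi0 ht hirr (hFan g1) (dF0 g1)
      (by have := slope g1; rw [hg1] at this; push_cast at this; exact this)
      (Fcommr _ _) (Fcommr _ _) (Fcommr _ _)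
    exact real_field ga hFan hF hX hX0 hlim
      (fun h => hinv (F h) (hFan h) (F0 h) (dF0 h) ⟨_, slope h⟩ (Fcommr _ _))
  · push Not at hpar
    obtain ⟨g, hg⟩ := hpar
    obtain ⟨g0, hg0⟩ : ∃ g0, deriv (f g0) 0 < 1 := by
      rcases lt_or_gt_of_ne hg with h | h
      · exact ⟨g, h⟩
      · refine ⟨g⁻¹, ?_⟩
        have h1 := ga.deriv_mul g g⁻¹
        rw [mul_inv_cancel, ga.deriv_one] at h1
        have := ga.dpos g⁻¹
        nlinarith
    obtain ⟨X, hX, hX0, hlim, hinv⟩ := hyp_local (hFan g0) (F0 g0) (dF0 g0)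
      (by rw [dF, Complex.norm_real, Real.norm_of_nonneg (ga.dpos g0).le]; exact hg0)
    exact real_field ga hFan hF hX hX0 hlim
      (fun h => hinv (F h) (hFan h) (F0 h) (dF0 h) (Fcommr _ _))

lemma real_local [Group.FG Γ] (hnc : ¬ IsCyclic Γ) {p : ℝ} (ga : GermAct f p) :
    ∃ Y : ℝ → ℝ, AnalyticAt ℝ Y p ∧ Y p = 0 ∧ (∀ᶠ x in 𝓝[≠] p, Y x ≠ 0) ∧
      ∀ g, ∀ᶠ x in 𝓝 p, Y (f g x) = deriv (f g) x * Y x := by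
  have tr : Tendsto (fun y : ℝ => p + y) (𝓝 0) (𝓝 p) := by
    have : Continuous fun y : ℝ => p + y := by fun_prop
    simpa using this.tendsto 0
  have tl : Tendsto (fun x : ℝ => x - p) (𝓝 p) (𝓝 0) := by
    have : Continuous fun x : ℝ => x - p := by fun_prop
    simpa using this.tendsto p
  have dd : ∀ g y, deriv (fun y => f g (p + y) - p) y = deriv (f g) (p + y) := by
    intro g y
    rw [deriv_sub_const, deriv_comp_const_add]
  have ga0 : GermAct (fun g y => f g (p + y) - p) 0 := by
    refine ⟨?_, ?_, ?_, ?_, ?_, ?_⟩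
    · intro g
      refine AnalyticAt.sub ?_ analyticAt_const
      exact AnalyticAt.comp' (g := f g) (f := fun y : ℝ => p + y) (by simpa using ga.an g)
        (analyticAt_const.add analyticAt_id)
    · intro g; simp [ga.fix]
    · intro g; rw [dd]; simpa using ga.dpos g
    · intro g h
      filter_upwards [tr.eventually (ga.mul g h)] with y hy
      rw [hy]; simp
    · intro g hg h
      apply ga.ne g hg
      filter_upwards [tl.eventually h] with x hx
      simp at hx; linarith
    · filter_upwards [tr.eventually ga.one] with y hy
      rw [hy]; ring
  obtain ⟨Y, hY, hY0, hne, hinv⟩ := real_local0 hnc ga0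
  refine ⟨fun x => Y (x - p), ?_, by simpa using hY0, ?_, ?_⟩
  · exact AnalyticAt.comp' (g := Y) (f := fun x : ℝ => x - p) (by simpa using hY)
        (analyticAt_id.sub analyticAt_const)
  · have : Tendsto (fun x : ℝ => x - p) (𝓝[≠] p) (𝓝[≠] 0) := by
      refine tendsto_nhdsWithin_iff.2 ⟨tl.mono_left nhdsWithin_le_nhds, ?_⟩
      filter_upwards [self_mem_nhdsWithin] with x hx
      exact sub_ne_zero.2 hx
    exact this.eventually hne
  · intro g
    filter_upwards [tl.eventually (hinv g)] with x hx
    rw [dd] at hx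
    simpa using hx
end


/-- left inverse of an analytic map with nonzero derivative is analytic -/
lemma analytic_leftinv {f g : ℝ → ℝ} {a : ℝ} (hf : AnalyticAt ℝ f a) (hd : deriv f a ≠ 0)
    (hg : ∀ᶠ x in 𝓝 a, g (f x) = x) :
    AnalyticAt ℝ g (f a) ∧ HasStrictDerivAt g (deriv f a)⁻¹ (f a) := by
  have h1 := HasStrictFDerivAt.localInverse_unique
    (hf.hasStrictDerivAt.hasStrictFDerivAt_equiv hd) hg
  have h2 := hf.analyticAt_localInverse hd
  have h3 := hf.hasStrictDerivAt.to_localInverse hd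
  refine ⟨h2.congr ?_, h3.congr_of_eventuallyEq ?_⟩
  · filter_upwards [h1] with y hy using hy.symm
  · filter_upwards [h1] with y hy using hy.symm

structure GAct {Γ : Type*} [CommGroup Γ] (R : Γ → ℝ → ℝ) : Prop where
  an : ∀ g, AnalyticOnNhd ℝ (R g) (Icc (0:ℝ) 1)
  zero : ∀ g, R g 0 = 0
  one : ∀ g, R g 1 = 1
  dpos : ∀ g, ∀ x ∈ Icc (0:ℝ) 1, 0 < deriv (R g) x
  mul : ∀ g h, ∀ x ∈ Icc (0:ℝ) 1, R (g * h) x = R g (R h x)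
  unit : ∀ x ∈ Icc (0:ℝ) 1, R 1 x = x
  faithful : ∀ g, (∀ x ∈ Icc (0:ℝ) 1, R g x = x) → g = 1

/-- common fixed set -/
def CFix {Γ : Type*} (R : Γ → ℝ → ℝ) : Set ℝ := {x | x ∈ Icc (0:ℝ) 1 ∧ ∀ g, R g x = x}

def Cons (S : Set ℝ) (a b : ℝ) : Prop := a ∈ S ∧ b ∈ S ∧ a < b ∧ ∀ x ∈ Ioo a b, x ∉ S

lemma frequently_I {p : ℝ} (hp : p ∈ Icc (0:ℝ) 1) : ∃ᶠ x in 𝓝[≠] p, x ∈ Icc (0:ℝ) 1 := by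
  rcases eq_or_lt_of_le hp.2 with h | h
  · have h1 : ∀ᶠ x in 𝓝[<] p, x ∈ Icc (0:ℝ) 1 := by
      have : Ioo 0 p ∈ 𝓝[<] p := Ioo_mem_nhdsLT (by rw [h]; norm_num)
      filter_upwards [this] with x hx
      exact ⟨hx.1.le, hx.2.le.trans hp.2⟩
    exact h1.frequently.filter_mono (nhdsWithin_mono _ (fun x hx => ne_of_lt hx))
  · have h1 : ∀ᶠ x in 𝓝[>] p, x ∈ Icc (0:ℝ) 1 := by
      filter_upwards [Ioo_mem_nhdsGT h] with x hx
      exact ⟨hp.1.trans hx.1.le, hx.2.le⟩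
    exact h1.frequently.filter_mono (nhdsWithin_mono _ (fun x hx => ne_of_gt hx))

lemma ident_I {A B : ℝ → ℝ} {p : ℝ} (hp : p ∈ Icc (0:ℝ) 1) (hA : AnalyticAt ℝ A p)
    (hB : AnalyticAt ℝ B p) (h : ∀ x ∈ Icc (0:ℝ) 1, A x = B x) : ∀ᶠ x in 𝓝 p, A x = B x :=
  (hA.frequently_eq_iff_eventually_eq hB).1 ((frequently_I hp).mono h)

section
variable {Γ : Type*} [CommGroup Γ] {R : Γ → ℝ → ℝ}

lemma GAct.smono (G : GAct R) (g : Γ) : StrictMonoOn (R g) (Icc (0:ℝ) 1) :=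
  strictMonoOn_of_deriv_pos (convex_Icc 0 1) (G.an g).continuousOn
    (fun x hx => G.dpos g x (interior_subset hx))

lemma GAct.maps (G : GAct R) (g : Γ) {x : ℝ} (hx : x ∈ Icc (0:ℝ) 1) : R g x ∈ Icc (0:ℝ) 1 := by
  constructor
  · have := (G.smono g).monotoneOn (left_mem_Icc.2 zero_le_one) hx hx.1
    rwa [G.zero] at this
  · have := (G.smono g).monotoneOn hx (right_mem_Icc.2 zero_le_one) hx.2
    rwa [G.one] at this

lemma GAct.comm (G : GAct R) (g h : Γ) {x : ℝ} (hx : x ∈ Icc (0:ℝ) 1) :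
    R g (R h x) = R h (R g x) := by rw [← G.mul _ _ _ hx, ← G.mul _ _ _ hx, mul_comm]

lemma GAct.inv_app (G : GAct R) (g : Γ) {x : ℝ} (hx : x ∈ Icc (0:ℝ) 1) : R g⁻¹ (R g x) = x := by
  rw [← G.mul _ _ _ hx, inv_mul_cancel, G.unit _ hx]

lemma GAct.app_inv (G : GAct R) (g : Γ) {x : ℝ} (hx : x ∈ Icc (0:ℝ) 1) : R g (R g⁻¹ x) = x := by
  rw [← G.mul _ _ _ hx, mul_inv_cancel, G.unit _ hx]

lemma GAct.eq_one_of_freq (G : GAct R) {g : Γ} {p : ℝ} (hp : p ∈ Icc (0:ℝ) 1)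
    (h : ∃ᶠ x in 𝓝[≠] p, R g x = x) : g = 1 :=
  G.faithful g ((G.an g).eqOn_of_preconnected_of_frequently_eq analyticOnNhd_id
    isPreconnected_Icc hp h)

lemma GAct.fin_fix (G : GAct R) {g : Γ} (hg : g ≠ 1) :
    {x | x ∈ Icc (0:ℝ) 1 ∧ R g x = x}.Finite := by
  by_contra h
  obtain ⟨z, hz, hacc⟩ := Set.Infinite.exists_accPt_of_subset_isCompact h
    (isCompact_Icc (a := (0:ℝ)) (b := 1)) (fun x hx => hx.1)
  refine hg (G.eq_one_of_freq hz ?_)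
  rw [accPt_iff_frequently] at hacc
  rw [frequently_nhdsWithin_iff]
  exact hacc.mono (fun x hx => ⟨hx.2.2, hx.1⟩)

lemma GAct.pow_lt (G : GAct R) {h : Γ} {x : ℝ} (hx : x ∈ Icc (0:ℝ) 1) (hlt : x < R h x) (n : ℕ) :
    R (h^n) x < R (h^(n+1)) x := by
  rw [pow_succ, G.mul _ _ _ hx]
  exact G.smono _ hx (G.maps _ hx) hlt

lemma GAct.pow_smono (G : GAct R) {h : Γ} {x : ℝ} (hx : x ∈ Icc (0:ℝ) 1) (hlt : x < R h x) :
    StrictMono (fun n : ℕ => R (h^n) x) := strictMono_nat_of_lt_succ (G.pow_lt hx hlt)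

lemma GAct.lt_inv (G : GAct R) {h : Γ} {x : ℝ} (hx : x ∈ Icc (0:ℝ) 1) (hlt : R h x < x) :
    x < R h⁻¹ x := by
  have := G.smono h⁻¹ (G.maps h hx) hx hlt
  rwa [G.inv_app _ hx] at this

lemma GAct.inv_lt (G : GAct R) {h : Γ} {x : ℝ} (hx : x ∈ Icc (0:ℝ) 1) (hlt : x < R h x) :
    R h⁻¹ x < x := by
  have := G.smono h⁻¹ hx (G.maps h hx) hlt
  rwa [G.inv_app _ hx] at this

lemma GAct.fix_eq (G : GAct R) {g : Γ} (hg : g ≠ 1) {x : ℝ} (hx : x ∈ Icc (0:ℝ) 1)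
    (hgx : R g x = x) : x ∈ CFix R := by
  have aux : ∀ h : Γ, ¬ x < R h x := by
    intro h hlt
    refine Set.infinite_of_injective_forall_mem (G.pow_smono hx hlt).injective
      (s := {x | x ∈ Icc (0:ℝ) 1 ∧ R g x = x}) ?_ (G.fin_fix hg)
    intro n
    refine ⟨G.maps _ hx, ?_⟩
    rw [G.comm _ _ hx, hgx]
  refine ⟨hx, fun h => ?_⟩
  rcases lt_trichotomy (R h x) x with h1 | h1 | h1
  · exact absurd (G.lt_inv hx h1) (aux _)
  · exact h1
  · exact absurd h1 (aux _)

lemma GAct.germ (G : GAct R) {p : ℝ} (hp : p ∈ CFix R) : GermAct R p := by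
  refine ⟨fun g => G.an g p hp.1, hp.2, fun g => G.dpos g p hp.1, ?_, ?_, ?_⟩
  · intro g h
    refine ident_I hp.1 (G.an _ p hp.1) ?_ (G.mul g h)
    exact AnalyticAt.comp' (by rw [hp.2]; exact G.an g p hp.1) (G.an h p hp.1)
  · intro g hg h
    exact hg (G.eq_one_of_freq hp.1 (h.filter_mono nhdsWithin_le_nhds).frequently)
  · exact ident_I hp.1 (G.an _ p hp.1) analyticAt_id G.unit

lemma GAct.zero_mem (G : GAct R) : (0:ℝ) ∈ CFix R := ⟨by simp, G.zero⟩
lemma GAct.one_mem (G : GAct R) : (1:ℝ) ∈ CFix R := ⟨by simp, G.one⟩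

lemma GAct.finS (G : GAct R) [Nontrivial Γ] : (CFix R).Finite := by
  obtain ⟨g, hg⟩ := exists_ne (1:Γ)
  exact (G.fin_fix hg).subset (fun x hx => ⟨hx.1, hx.2 g⟩)

lemma exists_pred {S : Set ℝ} (hS : S.Finite) {q p : ℝ} (hq : q ∈ S) (hp : p ∈ S) (hqp : q < p) :
    ∃ a, Cons S a p := by
  obtain ⟨a, ha, hmax⟩ := Set.exists_max_image (S ∩ Iio p) id (hS.inter_of_left _) ⟨q, hq, hqp⟩
  refine ⟨a, ha.1, hp, ha.2, fun x hx hxS => ?_⟩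
  have := hmax x ⟨hxS, hx.2⟩
  exact absurd hx.1 (not_lt.2 this)

lemma exists_cons {S : Set ℝ} (hS : S.Finite) {q p x : ℝ} (hq : q ∈ S) (hp : p ∈ S)
    (hx : x ∈ Icc q p) (hxS : x ∉ S) : ∃ a b, Cons S a b ∧ x ∈ Ioo a b := by
  have hqx : q < x := lt_of_le_of_ne hx.1 (fun h => hxS (h ▸ hq))
  have hxp : x < p := lt_of_le_of_ne hx.2 (fun h => hxS (h ▸ hp))
  obtain ⟨a, ha, hmax⟩ := Set.exists_max_image (S ∩ Iio x) id (hS.inter_of_left _) ⟨q, hq, hqx⟩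
  obtain ⟨b, hb, hmin⟩ := Set.exists_min_image (S ∩ Ioi x) id (hS.inter_of_left _) ⟨p, hp, hxp⟩
  refine ⟨a, b, ⟨ha.1, hb.1, ha.2.trans hb.2, fun y hy hyS => ?_⟩, ha.2, hb.2⟩
  rcases lt_trichotomy y x with h | h | h
  · exact absurd hy.1 (not_lt.2 (hmax y ⟨hyS, h⟩))
  · exact hxS (h ▸ hyS)
  · exact absurd hy.2 (not_lt.2 (hmin y ⟨hyS, h⟩))

lemma cons_unique {S : Set ℝ} {a b a' b' x : ℝ} (h : Cons S a b) (h' : Cons S a' b')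
    (hx : x ∈ Ioo a b) (hx' : x ∈ Ioo a' b') : a = a' ∧ b = b' := by
  constructor
  · rcases lt_trichotomy a a' with l | l | l
    · exact absurd h'.1 (h.2.2.2 _ ⟨l, hx'.1.trans hx.2⟩)
    · exact l
    · exact absurd h.1 (h'.2.2.2 _ ⟨l, hx.1.trans hx'.2⟩)
  · rcases lt_trichotomy b b' with l | l | l
    · exact absurd h.2.1 (h'.2.2.2 _ ⟨hx'.1.trans hx.2, l⟩)
    · exact l
    · exact absurd h'.2.1 (h.2.2.2 _ ⟨hx.1.trans hx'.2, l⟩)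

lemma S_induct {S : Set ℝ} (hS : S.Finite) {q : ℝ} (hq : q ∈ S) (hmin : ∀ x ∈ S, q ≤ x)
    (P : ℝ → Prop) (h0 : P q) (hstep : ∀ a b, Cons S a b → P a → P b) : ∀ p ∈ S, P p := by
  by_contra! hcon
  obtain ⟨p0, hp0, hn0⟩ := hcon
  obtain ⟨p, hp, hpm⟩ := Set.exists_min_image (S ∩ {x | ¬ P x}) id (hS.inter_of_left _) ⟨p0, hp0, hn0⟩
  have hqp : q < p := lt_of_le_of_ne (hmin p hp.1) (fun h => hp.2 (h ▸ h0))
  obtain ⟨a, ha⟩ := exists_pred hS hq hp.1 hqp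
  refine hp.2 (hstep a p ha ?_)
  by_contra hPa
  exact absurd ha.2.2.1 (not_lt.2 (hpm a ⟨ha.1, hPa⟩))

/-! dynamics on a component -/

lemma GAct.JI {a b : ℝ} (hc : Cons (CFix R) a b) {x : ℝ} (hx : x ∈ Ioo a b) :
    x ∈ Icc (0:ℝ) 1 := ⟨hc.1.1.1.trans hx.1.le, hx.2.le.trans hc.2.1.1.2⟩

lemma GAct.Jmaps (G : GAct R) {a b : ℝ} (hc : Cons (CFix R) a b) (g : Γ) {x : ℝ}
    (hx : x ∈ Ioo a b) : R g x ∈ Ioo a b := by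
  constructor
  · have := G.smono g hc.1.1 (GAct.JI hc hx) hx.1
    rwa [hc.1.2] at this
  · have := G.smono g (GAct.JI hc hx) hc.2.1.1 hx.2
    rwa [hc.2.1.2] at this

lemma GAct.Jfree (G : GAct R) {a b : ℝ} (hc : Cons (CFix R) a b) {g : Γ} {x : ℝ}
    (hx : x ∈ Ioo a b) (hgx : R g x = x) : g = 1 := by
  by_contra hg
  exact hc.2.2.2 x hx (G.fix_eq hg (GAct.JI hc hx) hgx)

lemma GAct.Jall (G : GAct R) {a b : ℝ} (hc : Cons (CFix R) a b) {g : Γ} {x y : ℝ}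
    (hx : x ∈ Ioo a b) (hy : y ∈ Ioo a b) (hgx : x < R g x) : y < R g y := by
  by_contra hcon
  have hcont : ContinuousOn (fun z => R g z - z) (Ioo a b) :=
    ((G.an g).continuousOn.mono (fun z hz => GAct.JI hc hz)).sub continuousOn_id
  obtain ⟨z, hz, hz0⟩ := (isPreconnected_Ioo).intermediate_value hy hx hcont
    (show (0:ℝ) ∈ Icc (R g y - y) (R g x - x) from ⟨by linarith, by linarith⟩)
  have : g = 1 := G.Jfree hc hz (by simp only at hz0; linarith)
  rw [this, G.unit _ (GAct.JI hc hx)] at hgx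
  exact lt_irrefl _ hgx

lemma GAct.Jtend (G : GAct R) {a b : ℝ} (hc : Cons (CFix R) a b) {g : Γ} {x : ℝ}
    (hx : x ∈ Ioo a b) (hgx : x < R g x) : Tendsto (fun n : ℕ => R (g^n) x) atTop (𝓝 b) := by
  have hxI := GAct.JI hc hx
  have hm := (G.pow_smono hxI hgx).monotone
  have hb : BddAbove (range (fun n : ℕ => R (g^n) x)) :=
    ⟨b, by rintro _ ⟨n, rfl⟩; exact (G.Jmaps hc _ hx).2.le⟩
  have ht := tendsto_atTop_ciSup hm hb
  set L := ⨆ n : ℕ, R (g^n) x with hL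
  have h1 : x ≤ L := by
    have := le_ciSup hb 0
    simpa [G.unit _ hxI] using this
  have h2 : L ≤ b := ciSup_le (fun n => (G.Jmaps hc _ hx).2.le)
  have hLI : L ∈ Icc (0:ℝ) 1 := ⟨hxI.1.trans h1, h2.trans hc.2.1.1.2⟩
  have hfix : R g L = L := by
    have t1 := ((G.an g L hLI).continuousAt.tendsto).comp ht
    refine tendsto_nhds_unique t1 ?_
    have t2 := ht.comp (tendsto_add_atTop_nat 1)
    refine t2.congr ?_
    intro n
    simp only [Function.comp]
    rw [pow_succ', G.mul _ _ _ hxI]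
  rcases eq_or_lt_of_le h2 with h | h
  · rwa [h] at ht
  · have : g = 1 := G.Jfree hc ⟨lt_of_lt_of_le hx.1 h1, h⟩ hfix
    rw [this, G.unit _ hxI] at hgx
    exact absurd hgx (lt_irrefl _)

lemma GAct.Jtend' (G : GAct R) {a b : ℝ} (hc : Cons (CFix R) a b) {g : Γ} {x : ℝ}
    (hx : x ∈ Ioo a b) (hgx : R g x < x) : Tendsto (fun n : ℕ => R (g^n) x) atTop (𝓝 a) := by
  have hxI := GAct.JI hc hx
  have hm : Antitone (fun n : ℕ => R (g^n) x) := by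
    refine antitone_nat_of_succ_le (fun n => ?_)
    rw [pow_succ, G.mul _ _ _ hxI]
    exact (G.smono _ (G.maps _ hxI) hxI hgx).le
  have hb : BddBelow (range (fun n : ℕ => R (g^n) x)) :=
    ⟨a, by rintro _ ⟨n, rfl⟩; exact (G.Jmaps hc _ hx).1.le⟩
  have ht := tendsto_atTop_ciInf hm hb
  set L := ⨅ n : ℕ, R (g^n) x with hL
  have h1 : L ≤ x := by
    have := ciInf_le hb 0
    simpa [G.unit _ hxI] using this
  have h2 : a ≤ L := le_ciInf (fun n => (G.Jmaps hc _ hx).1.le)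
  have hLI : L ∈ Icc (0:ℝ) 1 := ⟨hc.1.1.1.trans h2, h1.trans hxI.2⟩
  have hfix : R g L = L := by
    have t1 := ((G.an g L hLI).continuousAt.tendsto).comp ht
    refine tendsto_nhds_unique t1 ?_
    have t2 := ht.comp (tendsto_add_atTop_nat 1)
    refine t2.congr ?_
    intro n
    simp only [Function.comp]
    rw [pow_succ', G.mul _ _ _ hxI]
  rcases eq_or_lt_of_le h2 with h | h
  · rwa [← h] at ht
  · have : g = 1 := G.Jfree hc ⟨h, lt_of_le_of_lt h1 hx.2⟩ hfix
    rw [this, G.unit _ hxI] at hgx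
    exact absurd hgx (lt_irrefl _)

/-- orbits accumulate inside the component when the group is not cyclic -/
lemma GAct.accum (G : GAct R) (hnc : ¬ IsCyclic Γ) {a b : ℝ} (hc : Cons (CFix R) a b) {x : ℝ}
    (hx : x ∈ Ioo a b) : ∃ z ∈ Ioo a b, ∃ᶠ y in 𝓝[≠] z, ∃ g, R g x = y := by
  have hxI := GAct.JI hc hx
  obtain ⟨f, hf⟩ : ∃ f : Γ, x < R f x := by
    obtain ⟨g, hg⟩ : ∃ g0 : Γ, g0 ≠ 1 := by
      by_contra! h
      have : Subsingleton Γ := ⟨fun a b => by rw [h a, h b]⟩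
      exact hnc inferInstance
    rcases lt_trichotomy (R g x) x with h1 | h1 | h1
    · exact ⟨_, G.lt_inv hxI h1⟩
    · exact absurd (G.Jfree hc hx h1) hg
    · exact ⟨_, h1⟩
  let O : Set ℝ := {y | y ∈ Ioc x (R f x) ∧ ∃ g, R g x = y}
  by_cases hO : O.Finite
  · exfalso
    obtain ⟨y, hy, hmin⟩ := Set.exists_min_image O id hO ⟨R f x, ⟨hf, le_rfl⟩, f, rfl⟩
    obtain ⟨⟨hy1, hy2⟩, h, rfl⟩ := hy
    apply hnc
    refine ⟨h, fun g => ?_⟩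
    have hgx := G.Jmaps hc g hx
    have hlt := G.pow_smono hxI hy1
    have hmono : StrictMono (fun n : ℤ => R (h^n) x) := by
      refine strictMono_int_of_lt_succ (fun n => ?_)
      rw [zpow_add, zpow_one, G.mul _ _ _ hxI]
      exact G.smono _ hxI (G.maps _ hxI) hy1
    obtain ⟨n, hn, hn2⟩ := Int.exists_greatest_of_bdd (P := fun n : ℤ => R (h^n) x ≤ R g x) (by
        obtain ⟨N, hN⟩ := ((G.Jtend hc hx hy1).eventually_const_lt hgx.2).exists
        refine ⟨N, fun z hz => ?_⟩
        by_contra hzN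
        have := hmono (not_le.1 hzN)
        simp only [zpow_natCast] at this
        linarith) (by
        obtain ⟨N, hN⟩ := ((G.Jtend' hc hx (G.inv_lt hxI hy1)).eventually_lt_const hgx.1).exists
        refine ⟨-N, ?_⟩
        simp only [zpow_neg, zpow_natCast]
        rw [← inv_pow]; exact hN.le)
    have hn3 : R g x < R (h^(n+1)) x := by
      by_contra hcon
      have := hn2 (n+1) (not_lt.1 hcon)
      omega
    have e1 : R (h^(-n) * g) x = R (h^(-n)) (R g x) := G.mul _ _ _ hxI
    have k1 : x ≤ R (h^(-n) * g) x := by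
      rw [e1]
      have := (G.smono (h^(-n))).monotoneOn (G.maps _ hxI) (G.maps _ hxI) hn
      rwa [← G.mul _ _ _ hxI, ← zpow_add, neg_add_cancel, zpow_zero, G.unit _ hxI] at this
    have k2 : R (h^(-n) * g) x < R h x := by
      rw [e1]
      have := G.smono (h^(-n)) (G.maps _ hxI) (G.maps _ hxI) hn3
      rwa [← G.mul (h^(-n)) (h^(n+1)) x hxI, ← zpow_add, neg_add_cancel_left, zpow_one] at this
    rcases eq_or_lt_of_le k1 with k | k
    · have := G.Jfree hc hx k.symm
      refine ⟨n, ?_⟩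
      have h3 : h^(-n) * g = 1 := this
      rw [zpow_neg] at h3
      exact inv_mul_eq_one.1 h3
    · have := hmin _ ⟨⟨k, k2.le.trans hy2⟩, _, rfl⟩
      simp only [id] at this
      linarith
  · obtain ⟨z, hz, hacc⟩ := Set.Infinite.exists_accPt_of_subset_isCompact hO
      (isCompact_Icc (a := x) (b := R f x)) (fun y hy => Ioc_subset_Icc_self hy.1)
    refine ⟨z, ⟨lt_of_lt_of_le hx.1 hz.1, lt_of_le_of_lt hz.2 (G.Jmaps hc f hx).2⟩, ?_⟩
    rw [accPt_iff_frequently] at hacc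
    rw [frequently_nhdsWithin_iff]
    exact hacc.mono (fun y hy => ⟨hy.2.2, hy.1⟩)
end


section
variable {Γ : Type*} [CommGroup Γ] {R : Γ → ℝ → ℝ}

lemma GAct.deriv_mul (G : GAct R) (g h : Γ) {x : ℝ} (hx : x ∈ Icc (0:ℝ) 1) :
    deriv (R (g*h)) x = deriv (R g) (R h x) * deriv (R h) x := by
  have hcomp : AnalyticAt ℝ (fun x => R g (R h x)) x :=
    AnalyticAt.comp' (G.an g _ (G.maps h hx)) (G.an h x hx)
  have e := ident_I hx (G.an (g*h) x hx) hcomp (G.mul g h)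
  rw [Filter.EventuallyEq.deriv_eq (f := fun x => R g (R h x)) e]
  exact ((G.an g _ (G.maps h hx)).differentiableAt.hasDerivAt.comp x
    (G.an h x hx).differentiableAt.hasDerivAt).deriv

lemma GAct.deriv_one (G : GAct R) {x : ℝ} (hx : x ∈ Icc (0:ℝ) 1) : deriv (R 1) x = 1 := by
  have e := ident_I hx (G.an 1 x hx) analyticAt_id G.unit
  rw [Filter.EventuallyEq.deriv_eq (f := id) e]; simp

lemma GAct.extend (G : GAct R) {a b : ℝ} (hc : Cons (CFix R) a b) {p : ℝ} {φ : Γ}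
    (hconv : ∀ x ∈ Ioo a b, Tendsto (fun n : ℕ => R (φ^n) x) atTop (𝓝 p))
    (hcontr : ∀ x ∈ Ioo a b, |R φ x - p| ≤ |x - p|) {X : ℝ → ℝ} {ε : ℝ} (hε : 0 < ε)
    (hXan : ∀ x ∈ Ioo a b, |x - p| < ε → AnalyticAt ℝ X x)
    (hXne : ∀ x ∈ Ioo a b, |x - p| < ε → X x ≠ 0)
    (hXφ : ∀ x ∈ Ioo a b, |x - p| < ε → X (R φ x) = deriv (R φ) x * X x)
    (hXg : ∀ g, ∀ᶠ x in 𝓝 p, X (R g x) = deriv (R g) x * X x) :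
    ∃ Y : ℝ → ℝ, (∀ x ∈ Ioo a b, AnalyticAt ℝ Y x) ∧ (∀ x ∈ Ioo a b, Y x ≠ 0) ∧
      (∀ g, ∀ x ∈ Ioo a b, Y (R g x) = deriv (R g) x * Y x) ∧
      ∀ x ∈ Ioo a b, |x - p| < ε → Y x = X x := by
  let D : ℕ → ℝ → ℝ := fun n x => deriv (R (φ^n)) x
  let V : ℕ → ℝ → ℝ := fun n x => X (R (φ^n) x) / D n x
  have hD : ∀ n, ∀ x ∈ Ioo a b, D n x ≠ 0 := fun n x hx => (G.dpos _ x (GAct.JI hc hx)).ne'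
  have hev : ∀ x ∈ Ioo a b, ∀ᶠ n : ℕ in atTop, |R (φ^n) x - p| < ε := by
    intro x hx
    have := (hconv x hx).eventually (Metric.ball_mem_nhds p hε)
    filter_upwards [this] with n hn
    rwa [Real.dist_eq] at hn
  have hN : ∀ x, ∃ n : ℕ, x ∈ Ioo a b → |R (φ^n) x - p| < ε := by
    intro x
    by_cases hx : x ∈ Ioo a b
    · obtain ⟨n, hn⟩ := (hev x hx).exists
      exact ⟨n, fun _ => hn⟩
    · exact ⟨0, fun h => absurd h hx⟩
  choose N hN using hN
  have step : ∀ x ∈ Ioo a b, ∀ n, |R (φ^n) x - p| < ε → |R (φ^(n+1)) x - p| < ε ∧ V (n+1) x = V n x := by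
    intro x hx n hn
    have hxI := GAct.JI hc hx
    have hJ := G.Jmaps hc (φ^n) hx
    have e : R (φ^(n+1)) x = R φ (R (φ^n) x) := by rw [pow_succ', G.mul _ _ _ hxI]
    refine ⟨by rw [e]; exact lt_of_le_of_lt (hcontr _ hJ) hn, ?_⟩
    simp only [V, D]
    rw [e, hXφ _ hJ hn, pow_succ', G.deriv_mul _ _ hxI]
    have h1 := (G.dpos φ _ (GAct.JI hc hJ)).ne'
    have h2 := (G.dpos (φ^n) _ hxI).ne'
    field_simp
  have steps : ∀ x ∈ Ioo a b, ∀ n, |R (φ^n) x - p| < ε → ∀ m, n ≤ m →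
      |R (φ^m) x - p| < ε ∧ V m x = V n x := by
    intro x hx n hn m hm
    induction m, hm using Nat.le_induction with
    | base => exact ⟨hn, rfl⟩
    | succ m _ ih =>
      have := step x hx m ih.1
      exact ⟨this.1, this.2.trans ih.2⟩
  have key : ∀ x ∈ Ioo a b, ∀ n, |R (φ^n) x - p| < ε → V (N x) x = V n x := by
    intro x hx n hn
    have h1 := (steps x hx _ (hN x hx) (max (N x) n) (le_max_left _ _)).2
    have h2 := (steps x hx _ hn (max (N x) n) (le_max_right _ _)).2
    rw [← h1, h2]
  refine ⟨fun x => V (N x) x, ?_, ?_, ?_, ?_⟩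
  · intro x hx
    have hxI := GAct.JI hc hx
    have han : AnalyticAt ℝ (V (N x)) x := by
      refine AnalyticAt.div ?_ ((G.an _ x hxI).deriv) (hD _ x hx)
      exact AnalyticAt.comp' (hXan _ (G.Jmaps hc _ hx) (hN x hx)) (G.an _ x hxI)
    refine han.congr ?_
    have hcont : ContinuousAt (fun y => |R (φ^(N x)) y - p|) x :=
      ((G.an (φ^(N x)) x hxI).continuousAt.sub continuousAt_const).abs
    filter_upwards [Ioo_mem_nhds hx.1 hx.2, hcont.tendsto.eventually_lt_const (hN x hx)] with y h1 h2
    exact (key y h1 _ h2).symm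
  · intro x hx
    exact div_ne_zero (hXne _ (G.Jmaps hc _ hx) (hN x hx)) (hD _ x hx)
  · intro g x hx
    have hxI := GAct.JI hc hx
    have hgx := G.Jmaps hc g hx
    obtain ⟨n, h1, h2, h3⟩ := ((hev x hx).and ((hev _ hgx).and ((hconv x hx).eventually (hXg g)))).exists
    show V (N (R g x)) (R g x) = deriv (R g) x * V (N x) x
    rw [key _ hgx n h2, key x hx n h1]
    simp only [V, D]
    rw [G.comm _ _ hxI, h3]
    have e1 := G.deriv_mul (φ^n) g hxI
    have e2 := G.deriv_mul g (φ^n) hxI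
    rw [mul_comm, e2] at e1
    have k1 := hD n x hx
    have k2 := hD n _ hgx
    simp only [D] at k1 k2
    rw [div_eq_iff k2]
    field_simp
    linear_combination (X (R (φ^n) x)) * e1
  · intro x hx hxe
    have hxI := GAct.JI hc hx
    have h0 : |R (φ^0) x - p| < ε := by rwa [pow_zero, G.unit _ hxI]
    show V (N x) x = X x
    rw [key x hx 0 h0]
    simp only [V, D]
    rw [pow_zero, G.unit _ hxI, G.deriv_one hxI, div_one]

structure GoodF (R : Γ → ℝ → ℝ) (X : ℝ → ℝ) (p : ℝ) : Prop where
  an : AnalyticOnNhd ℝ X (Icc 0 p)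
  zero : ∀ x ∈ Icc 0 p, (X x = 0 ↔ x ∈ CFix R)
  inv : ∀ g, ∀ x ∈ Icc 0 p, X (R g x) = deriv (R g) x * X x
  ne : ∀ᶠ x in 𝓝[≠] p, X x ≠ 0
  germ : ∀ g, ∀ᶠ x in 𝓝 p, X (R g x) = deriv (R g) x * X x

lemma GAct.exists_down (G : GAct R) (hnc : ¬ IsCyclic Γ) {a b : ℝ} (hc : Cons (CFix R) a b) :
    ∃ φ : Γ, ∀ x ∈ Ioo a b, R φ x < x ∧ x < R φ⁻¹ x := by
  obtain ⟨x, hx⟩ : (Ioo a b).Nonempty := nonempty_Ioo.2 hc.2.2.1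
  have hxI := GAct.JI hc hx
  obtain ⟨f, hf⟩ : ∃ f : Γ, x < R f x := by
    obtain ⟨g, hg⟩ : ∃ g0 : Γ, g0 ≠ 1 := by
      by_contra! h
      have : Subsingleton Γ := ⟨fun a b => by rw [h a, h b]⟩
      exact hnc inferInstance
    rcases lt_trichotomy (R g x) x with h1 | h1 | h1
    · exact ⟨_, G.lt_inv hxI h1⟩
    · exact absurd (G.Jfree hc hx h1) hg
    · exact ⟨_, h1⟩
  refine ⟨f⁻¹, fun y hy => ?_⟩
  have := G.Jall hc hx hy hf
  exact ⟨G.inv_lt (GAct.JI hc hy) this, by rwa [inv_inv]⟩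

lemma GAct.extend_of_local (G : GAct R) {a b : ℝ} (hc : Cons (CFix R) a b) {p : ℝ} {φ : Γ}
    (hp : p ∉ Ioo a b)
    (hconv : ∀ x ∈ Ioo a b, Tendsto (fun n : ℕ => R (φ^n) x) atTop (𝓝 p))
    (hcontr : ∀ x ∈ Ioo a b, |R φ x - p| ≤ |x - p|) {X : ℝ → ℝ}
    (hX : AnalyticAt ℝ X p) (hne : ∀ᶠ x in 𝓝[≠] p, X x ≠ 0)
    (hXg : ∀ g, ∀ᶠ x in 𝓝 p, X (R g x) = deriv (R g) x * X x) :
    ∃ Y : ℝ → ℝ, (∀ x ∈ Ioo a b, AnalyticAt ℝ Y x) ∧ (∀ x ∈ Ioo a b, Y x ≠ 0) ∧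
      (∀ g, ∀ x ∈ Ioo a b, Y (R g x) = deriv (R g) x * Y x) ∧
      ∀ᶠ x in 𝓝 p, x ∈ Ioo a b → Y x = X x := by
  rw [eventually_nhdsWithin_iff] at hne
  obtain ⟨ε, hε, hb⟩ := Metric.eventually_nhds_iff.1 (hX.eventually_analyticAt.and (hne.and (hXg φ)))
  simp only [Real.dist_eq] at hb
  obtain ⟨Y, h1, h2, h3, h4⟩ := G.extend hc hconv hcontr hε (fun x _ hx => (hb hx).1)
    (fun x hx hx' => (hb hx').2.1 (fun h => hp (h ▸ hx))) (fun x _ hx => (hb hx).2.2) hXg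
  refine ⟨Y, h1, h2, h3, ?_⟩
  filter_upwards [Metric.ball_mem_nhds p hε] with x hx hxJ
  exact h4 x hxJ (by rwa [Metric.mem_ball, Real.dist_eq] at hx)

lemma GAct.glue_step (G : GAct R) [Group.FG Γ] (hnc : ¬ IsCyclic Γ) {a b : ℝ}
    (hc : Cons (CFix R) a b) {X : ℝ → ℝ} (hX : GoodF R X a) : ∃ X', GoodF R X' b := by
  obtain ⟨φ, hφ⟩ := G.exists_down hnc hc
  obtain ⟨B, hB, hB0, hBne, hBg⟩ := real_local hnc (G.germ hc.2.1)
  have h0a : 0 ≤ a := hc.1.1.1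
  have hab := hc.2.2.1
  obtain ⟨Y, Yan, Yne, Yinv, YX⟩ := G.extend_of_local hc (p := a) (φ := φ) (fun h => lt_irrefl _ h.1)
    (fun x hx => G.Jtend' hc hx (hφ x hx).1) (fun x hx => by
      rw [abs_of_pos (sub_pos.2 hx.1), abs_of_pos (sub_pos.2 (G.Jmaps hc φ hx).1)]
      linarith [(hφ x hx).1]) (hX.an a ⟨h0a, le_rfl⟩) hX.ne hX.germ
  obtain ⟨Z, Zan, Zne, Zinv, ZB⟩ := G.extend_of_local hc (p := b) (φ := φ⁻¹) (fun h => lt_irrefl _ h.2)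
    (fun x hx => G.Jtend hc hx (hφ x hx).2) (fun x hx => by
      rw [abs_of_neg (sub_neg.2 hx.2), abs_of_neg (sub_neg.2 (G.Jmaps hc φ⁻¹ hx).2)]
      linarith [(hφ x hx).2]) hB hBne hBg
  obtain ⟨x0, hx0⟩ : (Ioo a b).Nonempty := nonempty_Ioo.2 hab
  set c := Z x0 / Y x0 with hcdef
  have hc0 : c ≠ 0 := div_ne_zero (Zne _ hx0) (Yne _ hx0)
  have hZY : EqOn Z (fun x => c * Y x) (Ioo a b) := by
    obtain ⟨z, hz, hfr⟩ := G.accum hnc hc hx0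
    refine AnalyticOnNhd.eqOn_of_preconnected_of_frequently_eq Zan
      (fun x hx => analyticAt_const.mul (Yan x hx)) isPreconnected_Ioo hz ?_
    refine hfr.mono ?_
    rintro y ⟨g, rfl⟩
    have := Yne _ hx0
    rw [Zinv g _ hx0, Yinv g _ hx0, hcdef]
    field_simp
  let X' : ℝ → ℝ := fun x => if x ≤ a then X x else if x < b then Y x else c⁻¹ * B x
  have V1 : ∀ x, x ≤ a → X' x = X x := fun x hx => by simp only [X']; rw [if_pos hx]
  have V2 : ∀ x ∈ Ioo a b, X' x = Y x := fun x hx => by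
    simp only [X']; rw [if_neg (not_le.2 hx.1), if_pos hx.2]
  have V3 : ∀ x, b ≤ x → X' x = c⁻¹ * B x := fun x hx => by
    simp only [X']; rw [if_neg (not_le.2 (hab.trans_le hx)), if_neg (not_lt.2 hx)]
  have E1 : ∀ᶠ x in 𝓝 a, X' x = X x := by
    filter_upwards [YX, Iio_mem_nhds hab] with x h1 h2
    rcases le_or_gt x a with h | h
    · exact V1 x h
    · rw [V2 x ⟨h, h2⟩, h1 ⟨h, h2⟩]
  have E4 : ∀ᶠ x in 𝓝 b, X' x = c⁻¹ * B x := by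
    filter_upwards [ZB, Ioi_mem_nhds hab] with x h1 h2
    rcases lt_or_ge x b with h | h
    · have hx : x ∈ Ioo a b := ⟨h2, h⟩
      have e := hZY hx
      simp only at e
      rw [V2 x hx, ← h1 hx, e]
      field_simp
    · exact V3 x h
  have hbI := hc.2.1.1
  have hcases : ∀ x ∈ Icc 0 b, (x ∈ Icc 0 a) ∨ x ∈ Ioo a b ∨ x = b := by
    intro x hx
    rcases le_or_gt x a with h | h
    · exact Or.inl ⟨hx.1, h⟩
    · rcases eq_or_lt_of_le hx.2 with h' | h'
      · exact Or.inr (Or.inr h')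
      · exact Or.inr (Or.inl ⟨h, h'⟩)
  have hBan : AnalyticAt ℝ (fun x => c⁻¹ * B x) b := analyticAt_const.mul hB
  have hX'b : X' b = 0 := by rw [V3 b le_rfl, hB0, mul_zero]
  refine ⟨X', ?_, ?_, ?_, ?_, ?_⟩
  · intro x hx
    rcases hcases x hx with h | h | rfl
    · refine (hX.an x h).congr ?_
      rcases eq_or_lt_of_le h.2 with rfl | h'
      · filter_upwards [E1] with y hy using hy.symm
      · filter_upwards [Iio_mem_nhds h'] with y hy using (V1 y (le_of_lt hy)).symm
    · refine (Yan x h).congr ?_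
      filter_upwards [Ioo_mem_nhds h.1 h.2] with y hy using (V2 y hy).symm
    · refine hBan.congr ?_
      filter_upwards [E4] with y hy using hy.symm
  · intro x hx
    rcases hcases x hx with h | h | rfl
    · rw [V1 x h.2]; exact hX.zero x h
    · rw [V2 x h]
      exact ⟨fun hh => absurd hh (Yne x h), fun hh => absurd hh (hc.2.2.2 x h)⟩
    · exact ⟨fun _ => hc.2.1, fun _ => hX'b⟩
  · intro g x hx
    rcases hcases x hx with h | h | rfl
    · have hxI : x ∈ Icc (0:ℝ) 1 := ⟨h.1, h.2.trans hc.1.1.2⟩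
      have : R g x ≤ a := by
        have := (G.smono g).monotoneOn hxI hc.1.1 h.2
        rwa [hc.1.2] at this
      rw [V1 x h.2, V1 _ this]; exact hX.inv g x h
    · rw [V2 x h, V2 _ (G.Jmaps hc g h)]; exact Yinv g x h
    · rw [hc.2.1.2, hX'b, mul_zero]
  · filter_upwards [hBne, E4.filter_mono nhdsWithin_le_nhds] with x h1 h2
    rw [h2]; exact mul_ne_zero (inv_ne_zero hc0) h1
  · intro g
    have ht : Tendsto (R g) (𝓝 b) (𝓝 b) := by
      have := (G.an g b hbI).continuousAt.tendsto
      rwa [hc.2.1.2] at this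
    filter_upwards [hBg g, E4, ht.eventually E4] with x h1 h2 h3
    rw [h2, h3, h1]; ring

lemma nontriv_of_not_cyclic (hnc : ¬ IsCyclic Γ) : Nontrivial Γ := by
  by_contra h
  rw [not_nontrivial_iff_subsingleton] at h
  exact hnc inferInstance

lemma GAct.global_field (G : GAct R) [Group.FG Γ] (hnc : ¬ IsCyclic Γ) : ∃ X, GoodF R X 1 := by
  have := nontriv_of_not_cyclic hnc
  refine S_induct G.finS G.zero_mem (fun x hx => hx.1.1) (fun p => ∃ X, GoodF R X p) ?_ ?_ 1 G.one_mem
  · obtain ⟨B, hB, hB0, hBne, hBg⟩ := real_local hnc (G.germ G.zero_mem)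
    refine ⟨B, ?_, ?_, ?_, hBne, hBg⟩
    · intro x hx
      rw [Icc_self] at hx
      rw [hx]; exact hB
    · intro x hx
      rw [Icc_self] at hx
      rw [hx]; exact ⟨fun _ => G.zero_mem, fun _ => hB0⟩
    · intro g x hx
      rw [Icc_self] at hx
      rw [hx, G.zero, hB0, mul_zero]
  · rintro a b hc ⟨X, hX⟩
    exact G.glue_step hnc hc hX
end


section
variable {Γ : Type*} [CommGroup Γ] {R : Γ → ℝ → ℝ}

structure Chart (R : Γ → ℝ → ℝ) (X : ℝ → ℝ) (a b : ℝ) (u v : ℝ → ℝ) : Prop where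
  vJ : ∀ t, v t ∈ Ioo a b
  uv : ∀ t, u (v t) = t
  vu : ∀ x ∈ Ioo a b, v (u x) = x
  dv : ∀ t, HasDerivAt v (X (v t)) t
  bet : ∀ r s, ∀ η ∈ uIcc r s, v η ∈ uIcc (v r) (v s)
  tau : ∀ g, ∃ τ, ∀ x ∈ Ioo a b, R g x = v (u x + τ)

lemma GAct.exists_chart (G : GAct R) (hnc : ¬ IsCyclic Γ) {X : ℝ → ℝ} (hX : GoodF R X 1) {a b : ℝ}
    (hc : Cons (CFix R) a b) : ∃ u v, Chart R X a b u v := by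
  have hXa : ∀ x ∈ Ioo a b, AnalyticAt ℝ X x := fun x hx => hX.an x (GAct.JI hc hx)
  have hXne : ∀ x ∈ Ioo a b, X x ≠ 0 := fun x hx h =>
    hc.2.2.2 x hx ((hX.zero x (GAct.JI hc hx)).1 h)
  have hcont : ContinuousOn (fun x => (X x)⁻¹) (Ioo a b) := fun x hx =>
    ((hXa x hx).continuousAt.inv₀ (hXne x hx)).continuousWithinAt
  obtain ⟨x0, hx0⟩ : (Ioo a b).Nonempty := nonempty_Ioo.2 hc.2.2.1
  let u : ℝ → ℝ := fun x => ∫ y in x0..x, (X y)⁻¹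
  have du : ∀ x ∈ Ioo a b, HasDerivAt u (X x)⁻¹ x := by
    intro x hx
    have hsub : uIcc x0 x ⊆ Ioo a b := ordConnected_Ioo.uIcc_subset hx0 hx
    exact intervalIntegral.integral_hasDerivAt_right
      ((hcont.mono hsub).intervalIntegrable)
      (hcont.stronglyMeasurableAtFilter isOpen_Ioo x hx)
      (hcont.continuousAt (Ioo_mem_nhds hx.1 hx.2))
  have ucont : ContinuousOn u (Ioo a b) := fun x hx => (du x hx).continuousAt.continuousWithinAt
  have uinj : InjOn u (Ioo a b) := by
    have aux : ∀ x ∈ Ioo a b, ∀ y ∈ Ioo a b, x < y → u x ≠ u y := by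
      intro x hx y hy hxy he
      have hsub : Icc x y ⊆ Ioo a b := fun z hz => ⟨hx.1.trans_le hz.1, hz.2.trans_lt hy.2⟩
      obtain ⟨z, hz, hz0⟩ := exists_hasDerivAt_eq_zero hxy (ucont.mono hsub) he
        (fun z hz => du z (hsub (Ioo_subset_Icc_self hz)))
      exact inv_ne_zero (hXne z (hsub (Ioo_subset_Icc_self hz))) hz0
    intro x hx y hy he
    rcases lt_trichotomy x y with h | h | h
    · exact absurd he (aux x hx y hy h)
    · exact h
    · exact absurd he.symm (aux y hy x hx h)
  have htau : ∀ g, ∃ τ, ∀ x ∈ Ioo a b, u (R g x) = u x + τ := by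
    intro g
    have hd : ∀ x ∈ Ioo a b, HasDerivAt (fun x => u (R g x) - u x) 0 x := by
      intro x hx
      have hxI := GAct.JI hc hx
      have h1 := (du _ (G.Jmaps hc g hx)).comp x (G.an g x hxI).differentiableAt.hasDerivAt
      have h2 := h1.sub (du x hx)
      have e : (X (R g x))⁻¹ * deriv (R g) x - (X x)⁻¹ = 0 := by
        rw [hX.inv g x hxI]
        have k1 := hXne x hx
        have k2 := (G.dpos g x hxI).ne'
        field_simp
        ring
      rw [e] at h2
      exact h2
    obtain ⟨τ, hτ⟩ := isOpen_Ioo.exists_is_const_of_deriv_eq_zero isPreconnected_Ioo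
      (fun x hx => (hd x hx).differentiableAt.differentiableWithinAt)
      (fun x hx => (hd x hx).deriv)
    exact ⟨τ, fun x hx => by have := hτ x hx; linarith⟩
  choose T hT using htau
  have usurj : ∀ t, ∃ x ∈ Ioo a b, u x = t := by
    obtain ⟨φ, hφ⟩ := G.exists_down hnc hc
    have hpow : ∀ g, ∀ n : ℕ, u (R (g^n) x0) = u x0 + n * T g := by
      intro g n
      induction n with
      | zero => rw [pow_zero, G.unit _ (GAct.JI hc hx0)]; simp
      | succ n ih =>
        rw [pow_succ', G.mul _ _ _ (GAct.JI hc hx0), hT g _ (G.Jmaps hc _ hx0), ih]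
        push_cast; ring
    have hTinv : T φ⁻¹ = - T φ := by
      have h1 := hT φ _ (G.Jmaps hc φ⁻¹ hx0)
      rw [G.app_inv _ (GAct.JI hc hx0), hT φ⁻¹ _ hx0] at h1
      linarith
    have hT0 : T φ ≠ 0 := by
      intro h
      have h1 := hT φ _ hx0
      rw [h, add_zero] at h1
      exact absurd (uinj (G.Jmaps hc φ hx0) hx0 h1) (hφ x0 hx0).1.ne
    intro t
    obtain ⟨n, hn⟩ := exists_nat_ge (|t - u x0| / |T φ|)
    rw [div_le_iff₀ (abs_pos.2 hT0)] at hn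
    have hO : (u '' Ioo a b).OrdConnected := (isPreconnected_Ioo.image u ucont).ordConnected
    have m1 : u x0 + n * T φ ∈ u '' Ioo a b := ⟨_, G.Jmaps hc _ hx0, hpow φ n⟩
    have m2 : u x0 + n * (- T φ) ∈ u '' Ioo a b :=
      ⟨_, G.Jmaps hc _ hx0, by rw [← hTinv]; exact hpow φ⁻¹ n⟩
    have hm := hO.uIcc_subset m1 m2
    have ht : t ∈ uIcc (u x0 + n * T φ) (u x0 + n * (- T φ)) := by
      obtain ⟨k1, k2⟩ := abs_le.1 hn
      rw [mem_uIcc]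
      rcases abs_cases (T φ) with ⟨e, -⟩ | ⟨e, -⟩
      · rw [e] at k1 k2
        right; constructor <;> linarith
      · rw [e] at k1 k2
        left; constructor <;> linarith
    obtain ⟨x, hx, e⟩ := hm ht
    exact ⟨x, hx, e⟩
  choose v vJ uv using usurj
  have vu : ∀ x ∈ Ioo a b, v (u x) = x := fun x hx => uinj (vJ _) hx (uv _)
  have dv : ∀ t, HasDerivAt v (X (v t)) t := by
    intro t
    have hx := vJ t
    have hs : HasStrictDerivAt u (X (v t))⁻¹ (v t) :=
      hasStrictDerivAt_of_hasDerivAt_of_continuousAt (f' := fun x => (X x)⁻¹)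
        (by filter_upwards [Ioo_mem_nhds hx.1 hx.2] with y hy using du y hy)
        (hcont.continuousAt (Ioo_mem_nhds hx.1 hx.2))
    have hne : (X (v t))⁻¹ ≠ 0 := inv_ne_zero (hXne _ hx)
    have h1 := HasStrictFDerivAt.localInverse_unique (g := v)
      (hs.hasStrictFDerivAt_equiv hne)
      (by filter_upwards [Ioo_mem_nhds hx.1 hx.2] with y hy using vu y hy)
    have h3 := (hs.to_localInverse hne).hasDerivAt.congr_of_eventuallyEq h1
    rwa [uv, inv_inv] at h3
  refine ⟨u, v, vJ, uv, vu, dv, ?_, ?_⟩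
  · have hcv : Continuous v := continuous_iff_continuousAt.2 (fun t => (dv t).continuousAt)
    have hinj : Function.Injective v := fun s t h => by rw [← uv s, ← uv t, h]
    intro r s η hη
    rcases hcv.strictMono_of_inj hinj with h | h
    · exact h.monotone.image_uIcc_subset ⟨η, hη, rfl⟩
    · exact h.antitone.image_uIcc_subset ⟨η, hη, rfl⟩
  · intro g
    exact ⟨T g, fun x hx => by rw [← hT g x hx, vu _ (G.Jmaps hc g hx)]⟩

lemma mvt0 {f f' : ℝ → ℝ} (h : ∀ t, HasDerivAt f (f' t) t) (r s : ℝ) :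
    ∃ η ∈ uIcc 0 s, f (r + s) - f r = s * f' (r + η) := by
  have hcf : Continuous f := continuous_iff_continuousAt.2 (fun t => (h t).continuousAt)
  rcases lt_trichotomy s 0 with hs | rfl | hs
  · obtain ⟨c, hc, e⟩ := exists_hasDerivAt_eq_slope f f' (by linarith : r + s < r)
      hcf.continuousOn (fun x _ => h x)
    refine ⟨c - r, ?_, ?_⟩
    · rw [mem_uIcc]; right; constructor <;> linarith [hc.1, hc.2]
    · rw [add_sub_cancel, e]
      have : r - (r + s) = -s := by ring
      rw [this]
      have hs' : s ≠ 0 := hs.ne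
      field_simp
      ring
  · exact ⟨0, by simp, by simp⟩
  · obtain ⟨c, hc, e⟩ := exists_hasDerivAt_eq_slope f f' (by linarith : r < r + s)
      hcf.continuousOn (fun x _ => h x)
    refine ⟨c - r, ?_, ?_⟩
    · rw [mem_uIcc]; left; constructor <;> linarith [hc.1, hc.2]
    · rw [add_sub_cancel, e]
      have : r + s - r = s := by ring
      rw [this]
      field_simp

lemma tend_between {l : Filter ℝ} {α β γ : ℝ → ℝ} {p : ℝ} (hα : Tendsto α l (𝓝 p))
    (hβ : Tendsto β l (𝓝 p)) (h : ∀ᶠ x in l, γ x ∈ uIcc (α x) (β x)) : Tendsto γ l (𝓝 p) := by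
  have h1 := hα.min hβ
  have h2 := hα.max hβ
  rw [min_self] at h1
  rw [max_self] at h2
  exact tendsto_of_tendsto_of_tendsto_of_le_of_le' h1 h2 (h.mono fun x hx => hx.1)
    (h.mono fun x hx => hx.2)

lemma limit_sides {A B : ℝ → ℝ} {p c c' : ℝ} (hA : AnalyticAt ℝ A p) (hB : AnalyticAt ℝ B p)
    (h1 : Tendsto (fun x => A x / B x) (𝓝[<] p) (𝓝 c))
    (h2 : Tendsto (fun x => A x / B x) (𝓝[>] p) (𝓝 c')) : c = c' := by
  have hm : MeromorphicAt (fun x => A x / B x) p := hA.meromorphicAt.div hB.meromorphicAt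
  have l1 : 𝓝[<] p ≤ 𝓝[≠] p := nhdsWithin_mono _ (fun x hx => ne_of_lt hx)
  have l2 : 𝓝[>] p ≤ 𝓝[≠] p := nhdsWithin_mono _ (fun x hx => ne_of_gt hx)
  rcases le_or_gt 0 (meromorphicOrderAt (fun x => A x / B x) p) with h | h
  · obtain ⟨d, hd⟩ := tendsto_nhds_of_meromorphicOrderAt_nonneg hm h
    rw [tendsto_nhds_unique h1 (hd.mono_left l1), tendsto_nhds_unique h2 (hd.mono_left l2)]
  · have hd := (tendsto_cobounded_of_meromorphicOrderAt_neg h).mono_left l1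
    exact absurd h1 (hd.not_tendsto (Metric.disjoint_nhds_cobounded c).symm)

lemma GAct.one_side (G : GAct R) {X : ℝ → ℝ} (hX : GoodF R X 1) {a b : ℝ}
    (hc : Cons (CFix R) a b) {u v : ℝ → ℝ} (C : Chart R X a b u v) {p : ℝ} (hp : p ∈ CFix R)
    {l : Filter ℝ} [l.NeBot] (hl : l ≤ 𝓝 p) (hlJ : ∀ᶠ x in l, x ∈ Ioo a b) {g : Γ} {τ : ℝ}
    (hτ : ∀ x ∈ Ioo a b, R g x = v (u x + τ)) :
    Real.log (deriv (R g) p) = τ * deriv X p ∧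
    (deriv X p = 0 → Tendsto (fun x => (R g x - x) / X x) l (𝓝 τ)) := by
  have hXa : ∀ x ∈ Ioo a b, AnalyticAt ℝ X x := fun x hx => hX.an x (GAct.JI hc hx)
  have hXne : ∀ x ∈ Ioo a b, X x ≠ 0 := fun x hx h =>
    hc.2.2.2 x hx ((hX.zero x (GAct.JI hc hx)).1 h)
  have hXp : AnalyticAt ℝ X p := hX.an p hp.1
  have hdX : Tendsto (deriv X) (𝓝 p) (𝓝 (deriv X p)) := hXp.deriv.continuousAt.tendsto
  have t1 : Tendsto (fun x => x) l (𝓝 p) := hl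
  have t2 : Tendsto (R g) l (𝓝 p) := by
    have := (G.an g p hp.1).continuousAt.tendsto
    rw [hp.2] at this
    exact this.mono_left hl
  have hlogd : ∀ t, HasDerivAt (fun t => Real.log (X (v t))) (deriv X (v t)) t := by
    intro t
    have h1 := ((hXa _ (C.vJ t)).differentiableAt.hasDerivAt.comp t (C.dv t)).log (hXne _ (C.vJ t))
    have e : deriv X (v t) * X (v t) / (X ∘ v) t = deriv X (v t) := by
      have := hXne _ (C.vJ t)
      simp only [Function.comp]
      field_simp
    rw [e] at h1
    exact h1
  have between : ∀ x ∈ Ioo a b, ∀ η ∈ uIcc 0 τ, v (u x + η) ∈ uIcc x (R g x) := by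
    intro x hx η hη
    have h1 := C.bet (u x) (u x + τ) (u x + η) (by
      rw [mem_uIcc] at hη ⊢
      rcases hη with h | h
      · left; constructor <;> linarith [h.1, h.2]
      · right; constructor <;> linarith [h.1, h.2])
    rwa [C.vu x hx, ← hτ x hx] at h1
  have tb : ∀ η : ℝ → ℝ, (∀ x, η x ∈ uIcc 0 τ) → Tendsto (fun x => v (u x + η x)) l (𝓝 p) := by
    intro η hη
    refine tend_between t1 t2 ?_
    filter_upwards [hlJ] with x hx using between x hx _ (hη x)
  constructor
  · choose η hη he using fun x => mvt0 hlogd (u x) τ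
    have h1 := (hdX.comp (tb η hη)).const_mul τ
    refine tendsto_nhds_unique ?_ h1
    have h2 : Tendsto (fun x => Real.log (deriv (R g) x)) l (𝓝 (Real.log (deriv (R g) p))) :=
      ((G.an g p hp.1).deriv.continuousAt.log (G.dpos g p hp.1).ne').tendsto.mono_left hl
    refine h2.congr' ?_
    filter_upwards [hlJ] with x hx
    have hxI := GAct.JI hc hx
    simp only [Function.comp]
    rw [← he x, ← hτ x hx, C.vu x hx, hX.inv g x hxI,
      Real.log_mul (G.dpos g x hxI).ne' (hXne x hx)]
    ring
  · intro h0
    rw [h0] at hdX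
    choose η hη he using fun x => mvt0 C.dv (u x) τ
    choose ζ hζ hze using fun x => mvt0 hlogd (u x) (η x)
    have hζ' : ∀ x, ζ x ∈ uIcc 0 τ := fun x =>
      uIcc_subset_uIcc_left (hη x) (hζ x)
    have hη' : ∀ x, |η x| ≤ |τ| := by
      intro x
      have := hη x
      rw [mem_uIcc] at this
      rcases this with h | h
      · rw [abs_of_nonneg h.1, abs_of_nonneg (h.1.trans h.2)]; exact h.2
      · rw [abs_of_nonpos h.2, abs_of_nonpos (h.1.trans h.2)]; linarith [h.1]
    have h1 : Tendsto (fun x => η x * deriv X (v (u x + ζ x))) l (𝓝 0) := by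
      have h2 := ((hdX.comp (tb ζ hζ')).abs).const_mul |τ|
      rw [abs_zero, mul_zero] at h2
      refine squeeze_zero_norm (fun x => ?_) h2
      rw [Real.norm_eq_abs, abs_mul]
      exact mul_le_mul_of_nonneg_right (hη' x) (abs_nonneg _)
    have h2 := ((Real.continuous_exp.tendsto 0).comp h1).const_mul τ
    rw [Real.exp_zero, mul_one] at h2
    refine h2.congr' ?_
    filter_upwards [hlJ] with x hx
    have hpos : 0 < X (v (u x + η x)) / X x := by
      by_contra hneg
      have hO : (X '' Ioo a b).OrdConnected := (isPreconnected_Ioo.image X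
        (fun y hy => (hXa y hy).continuousAt.continuousWithinAt)).ordConnected
      have hne1 := hXne _ (C.vJ (u x + η x))
      have hne2 := hXne x hx
      have hm := hO.uIcc_subset ⟨_, C.vJ (u x + η x), rfl⟩ ⟨x, hx, rfl⟩
      have : (0:ℝ) ∈ uIcc (X (v (u x + η x))) (X x) := by
        rw [mem_uIcc]
        rcases lt_or_gt_of_ne hne1 with k1 | k1 <;> rcases lt_or_gt_of_ne hne2 with k2 | k2
        · exact absurd (div_pos_of_neg_of_neg k1 k2) hneg
        · left; exact ⟨k1.le, k2.le⟩
        · right; exact ⟨k2.le, k1.le⟩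
        · exact absurd (div_pos k1 k2) hneg
      obtain ⟨z, hz, hz0⟩ := hm this
      exact hXne z hz hz0
    simp only [Function.comp]
    have e1 := he x
    rw [← hτ x hx, C.vu x hx] at e1
    have e2 := hze x
    rw [C.vu x hx, ← Real.log_div (hXne _ (C.vJ _)) (hXne x hx)] at e2
    rw [e1, ← e2, Real.exp_log hpos]
    ring

lemma GAct.junction (G : GAct R) {X : ℝ → ℝ} (hX : GoodF R X 1) {a p b : ℝ}
    (hc : Cons (CFix R) a p) (hc' : Cons (CFix R) p b) {u v u' v' : ℝ → ℝ}
    (C : Chart R X a p u v) (C' : Chart R X p b u' v') {g : Γ} {τ τ' : ℝ}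
    (hτ : ∀ x ∈ Ioo a p, R g x = v (u x + τ)) (hτ' : ∀ x ∈ Ioo p b, R g x = v' (u' x + τ')) :
    τ = τ' := by
  have hp := hc.2.1
  have A := G.one_side hX hc C hp (l := 𝓝[<] p) nhdsWithin_le_nhds (Ioo_mem_nhdsLT hc.2.2.1) hτ
  have B := G.one_side hX hc' C' hp (l := 𝓝[>] p) nhdsWithin_le_nhds (Ioo_mem_nhdsGT hc'.2.2.1) hτ'
  by_cases h : deriv X p = 0
  · exact limit_sides (A := fun x => R g x - x) ((G.an g p hp.1).sub analyticAt_id) (hX.an p hp.1)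
      (A.2 h) (B.2 h)
  · exact mul_right_cancel₀ h (A.1.symm.trans B.1)

lemma exists_succ {S : Set ℝ} (hS : S.Finite) {q p : ℝ} (hq : q ∈ S) (hp : p ∈ S) (hqp : q < p) :
    ∃ b, Cons S q b := by
  obtain ⟨b, hb, hmin⟩ := Set.exists_min_image (S ∩ Ioi q) id (hS.inter_of_left _) ⟨p, hp, hqp⟩
  refine ⟨b, hq, hb.1, hb.2, fun x hx hxS => ?_⟩
  exact absurd hx.2 (not_lt.2 (hmin x ⟨hxS, hx.1⟩))

lemma GAct.flow (G : GAct R) [Group.FG Γ] (hnc : ¬ IsCyclic Γ) :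
    ∃ (Φ : ℝ → ℝ → ℝ) (X : ℝ → ℝ), IsAnalyticFlowOf Φ X ∧
      ∀ g, ∃ τ : ℝ, ∀ x ∈ Icc (0:ℝ) 1, R g x = Φ τ x := by
  classical
  have hnt := nontriv_of_not_cyclic hnc
  obtain ⟨X, hX⟩ := G.global_field hnc
  have hch : ∀ a b, ∃ u v, Cons (CFix R) a b → Chart R X a b u v := by
    intro a b
    by_cases hc : Cons (CFix R) a b
    · obtain ⟨u, v, h⟩ := G.exists_chart hnc hX hc
      exact ⟨u, v, fun _ => h⟩
    · exact ⟨id, id, fun h => absurd h hc⟩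
  choose U V hUV using hch
  have hAB : ∀ x, ∃ a b, x ∈ Icc (0:ℝ) 1 → x ∉ CFix R → Cons (CFix R) a b ∧ x ∈ Ioo a b := by
    intro x
    by_cases hx : x ∈ Icc (0:ℝ) 1 ∧ x ∉ CFix R
    · obtain ⟨a, b, h⟩ := exists_cons G.finS G.zero_mem G.one_mem hx.1 hx.2
      exact ⟨a, b, fun _ _ => h⟩
    · exact ⟨0, 0, fun h1 h2 => absurd ⟨h1, h2⟩ hx⟩
  choose A B hAB using hAB
  let Φ : ℝ → ℝ → ℝ := fun t x =>
    if x ∈ CFix R then x else V (A x) (B x) (U (A x) (B x) x + t)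
  have ΦS : ∀ t, ∀ x ∈ CFix R, Φ t x = x := fun t x hx => by simp only [Φ]; rw [if_pos hx]
  have ΦJ : ∀ t a b, Cons (CFix R) a b → ∀ x ∈ Ioo a b, Φ t x = V a b (U a b x + t) := by
    intro t a b hc x hx
    have hxS := hc.2.2.2 x hx
    obtain ⟨h1, h2⟩ := hAB x (GAct.JI hc hx) hxS
    obtain ⟨e1, e2⟩ := cons_unique h1 hc h2 hx
    simp only [Φ]; rw [if_neg hxS, e1, e2]
  have cases' : ∀ x ∈ Icc (0:ℝ) 1, x ∈ CFix R ∨ ∃ a b, Cons (CFix R) a b ∧ x ∈ Ioo a b := by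
    intro x hx
    by_cases h : x ∈ CFix R
    · exact Or.inl h
    · exact Or.inr ⟨_, _, hAB x hx h⟩
  refine ⟨Φ, X, ⟨hX.an, (hX.zero 0 (by simp)).2 G.zero_mem, (hX.zero 1 (by simp)).2 G.one_mem,
    ?_, ?_, ?_, ?_⟩, ?_⟩
  · intro t x hx
    rcases cases' x hx with h | ⟨a, b, hc, hxJ⟩
    · rw [ΦS t x h]; exact hx
    · rw [ΦJ t a b hc x hxJ]
      exact GAct.JI hc ((hUV a b hc).vJ _)
  · intro x hx
    rcases cases' x hx with h | ⟨a, b, hc, hxJ⟩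
    · exact ΦS 0 x h
    · rw [ΦJ 0 a b hc x hxJ, add_zero, (hUV a b hc).vu x hxJ]
  · intro s t x hx
    rcases cases' x hx with h | ⟨a, b, hc, hxJ⟩
    · rw [ΦS _ x h, ΦS _ x h, ΦS _ x h]
    · rw [ΦJ t a b hc x hxJ, ΦJ s a b hc _ ((hUV a b hc).vJ _), ΦJ _ a b hc x hxJ,
        (hUV a b hc).uv]
      congr 1; ring
  · intro x hx t
    rcases cases' x hx with h | ⟨a, b, hc, hxJ⟩
    · have e : (fun τ => Φ τ x) = fun _ => x := by funext τ; exact ΦS τ x h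
      rw [e, ΦS t x h, (hX.zero x hx).2 h]
      exact hasDerivAt_const t x
    · have e : (fun τ => Φ τ x) = fun τ => V a b (U a b x + τ) := by
        funext τ; exact ΦJ τ a b hc x hxJ
      rw [e, ΦJ t a b hc x hxJ]
      exact HasDerivAt.comp_const_add (U a b x) t ((hUV a b hc).dv _)
  · intro g
    have hT : ∀ a b, ∃ τ, Cons (CFix R) a b → ∀ x ∈ Ioo a b, R g x = V a b (U a b x + τ) := by
      intro a b
      by_cases hc : Cons (CFix R) a b
      · obtain ⟨τ, h⟩ := (hUV a b hc).tau g
        exact ⟨τ, fun _ => h⟩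
      · exact ⟨0, fun h => absurd h hc⟩
    choose T hT using hT
    obtain ⟨b0, hb0⟩ := exists_succ G.finS G.zero_mem G.one_mem zero_lt_one
    have pred_eq : ∀ a a' b, Cons (CFix R) a b → Cons (CFix R) a' b → a = a' := by
      intro a a' b h h'
      have hx : (max a a' + b) / 2 ∈ Ioo (max a a') b := by
        have := max_lt h.2.2.1 h'.2.2.1
        constructor <;> linarith
      exact (cons_unique h h' ⟨(le_max_left _ _).trans_lt hx.1, hx.2⟩
        ⟨(le_max_right _ _).trans_lt hx.1, hx.2⟩).1
    have succ_eq : ∀ a b b', Cons (CFix R) a b → Cons (CFix R) a b' → b = b' := by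
      intro a b b' h h'
      have hx : (a + min b b') / 2 ∈ Ioo a (min b b') := by
        have := lt_min h.2.2.1 h'.2.2.1
        constructor <;> linarith
      exact (cons_unique h h' ⟨hx.1, hx.2.trans_le (min_le_left _ _)⟩
        ⟨hx.1, hx.2.trans_le (min_le_right _ _)⟩).2
    have hall : ∀ p ∈ CFix R, ∀ a, Cons (CFix R) a p → T a p = T 0 b0 := by
      refine S_induct G.finS G.zero_mem (fun x hx => hx.1.1)
        (fun p => ∀ a, Cons (CFix R) a p → T a p = T 0 b0) ?_ ?_
      · intro a ha
        exact absurd ha.2.2.1 (not_lt.2 ha.1.1.1)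
      · intro a b hc ih a' hc'
        rw [pred_eq a' a b hc' hc]
        rcases eq_or_lt_of_le hc.1.1.1 with h | h
        · rw [← h] at hc ⊢
          rw [succ_eq 0 b b0 hc hb0]
        · obtain ⟨c, hcc⟩ := exists_pred G.finS G.zero_mem hc.1 h
          rw [← ih c hcc]
          exact (G.junction hX hcc hc (hUV _ _ hcc) (hUV _ _ hc) (hT _ _ hcc) (hT _ _ hc)).symm
    refine ⟨T 0 b0, fun x hx => ?_⟩
    rcases cases' x hx with h | ⟨a, b, hc, hxJ⟩
    · rw [ΦS _ x h, h.2]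
    · rw [ΦJ _ a b hc x hxJ, hT a b hc x hxJ, hall b hc.2.1 a hc]
end


/-- `e` is induced by an orientation preserving analytic diffeomorphism -/
def AnPerm (e : Equiv.Perm (Icc (0:ℝ) 1)) : Prop :=
  ∃ F : ℝ → ℝ, AnalyticOnNhd ℝ F (Icc (0:ℝ) 1) ∧ F 0 = 0 ∧ F 1 = 1 ∧
    (∀ x ∈ Icc (0:ℝ) 1, 0 < deriv F x) ∧ ∀ x : Icc (0:ℝ) 1, F x = e x

lemma AnPerm.one : AnPerm 1 :=
  ⟨id, fun x _ => analyticAt_id, rfl, rfl, fun x _ => by simp, fun x => rfl⟩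

lemma AnPerm.mul {e e' : Equiv.Perm (Icc (0:ℝ) 1)} (h : AnPerm e) (h' : AnPerm e') :
    AnPerm (e * e') := by
  obtain ⟨F, a, b, c, d, h⟩ := h
  obtain ⟨F', a', b', c', d', h'⟩ := h'
  have hm : ∀ x ∈ Icc (0:ℝ) 1, F' x ∈ Icc (0:ℝ) 1 := fun x hx => by
    rw [h' ⟨x, hx⟩]; exact (e' ⟨x, hx⟩).2
  refine ⟨F ∘ F', fun x hx => (a _ (hm x hx)).comp (a' x hx), by simp [b, b'], by simp [c, c'],
    fun x hx => ?_, fun x => ?_⟩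
  · rw [deriv_comp x (a _ (hm x hx)).differentiableAt (a' x hx).differentiableAt]
    exact mul_pos (d _ (hm x hx)) (d' x hx)
  · rw [Function.comp, h' x, h (e' x)]; rfl

lemma AnPerm.inv {e : Equiv.Perm (Icc (0:ℝ) 1)} (h : AnPerm e) : AnPerm e⁻¹ := by
  obtain ⟨F, a, b, c, d, h⟩ := h
  have hO : IsOpen {x | AnalyticAt ℝ F x ∧ 0 < deriv F x} := by
    rw [isOpen_iff_mem_nhds]
    intro x hx
    have h1 := hx.1.eventually_analyticAt
    have h2 := hx.1.deriv.continuousAt.eventually_const_lt hx.2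
    filter_upwards [h1, h2] with y hy hy' using ⟨hy, hy'⟩
  obtain ⟨δ, hδ, hsub⟩ := (isCompact_Icc (a := (0:ℝ)) (b := 1)).exists_thickening_subset_open hO
    (fun x hx => ⟨a x hx, d x hx⟩)
  have hJ : ∀ x ∈ Ioo (-δ) (1 + δ), AnalyticAt ℝ F x ∧ 0 < deriv F x := by
    intro x hx
    apply hsub
    rw [Metric.mem_thickening_iff]
    rcases lt_or_ge x 0 with h0 | h0
    · exact ⟨0, by simp, by rw [Real.dist_eq, abs_lt]; constructor <;> linarith [hx.1, hx.2]⟩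
    rcases lt_or_ge 1 x with h1 | h1
    · exact ⟨1, by simp, by rw [Real.dist_eq, abs_lt]; constructor <;> linarith [hx.1, hx.2]⟩
    · exact ⟨x, ⟨h0, h1⟩, by simpa using hδ⟩
  have hmono : StrictMonoOn F (Ioo (-δ) (1 + δ)) := by
    apply strictMonoOn_of_deriv_pos (convex_Ioo _ _)
    · exact fun x hx => (hJ x hx).1.continuousAt.continuousWithinAt
    · intro x hx
      rw [interior_Ioo] at hx
      exact (hJ x hx).2
  have hI : Icc (0:ℝ) 1 ⊆ Ioo (-δ) (1 + δ) := fun x hx =>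
    ⟨by linarith [hx.1], by linarith [hx.2]⟩
  have hG : ∀ x ∈ Ioo (-δ) (1 + δ), Function.invFunOn F (Ioo (-δ) (1 + δ)) (F x) = x :=
    fun x hx => hmono.injOn.leftInvOn_invFunOn hx
  have key : ∀ x ∈ Icc (0:ℝ) 1, _ := fun x hx =>
    analytic_leftinv (a x hx) (d x hx).ne'
      (Filter.eventually_of_mem (isOpen_Ioo.mem_nhds (hI hx)) hG)
  have hsurj : ∀ y ∈ Icc (0:ℝ) 1, ∃ x ∈ Icc (0:ℝ) 1, F x = y := fun y hy =>
    ⟨e⁻¹ ⟨y, hy⟩, (e⁻¹ ⟨y, hy⟩).2, by rw [h]; simp⟩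
  refine ⟨Function.invFunOn F (Ioo (-δ) (1 + δ)), fun y hy => ?_, ?_, ?_, fun y hy => ?_,
    fun y => ?_⟩
  · obtain ⟨x, hx, rfl⟩ := hsurj y hy
    exact (key x hx).1
  · have := hG 0 (hI (by simp)); rwa [b] at this
  · have := hG 1 (hI (by simp)); rwa [c] at this
  · obtain ⟨x, hx, rfl⟩ := hsurj y hy
    rw [(key x hx).2.hasDerivAt.deriv]
    exact inv_pos.2 (d x hx)
  · have h2 := hG (e⁻¹ y) (hI (e⁻¹ y).2)
    rw [h] at h2
    simpa using h2

lemma zpowFun_eq {Γ : Type*} [CommGroup Γ] {R : Γ → ℝ → ℝ} (G : GAct R) (g : Γ) (k : ℤ) :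
    ∀ x ∈ Icc (0:ℝ) 1, zpowFun (R g) (R g⁻¹) k x = R (g ^ k) x := by
  have key : ∀ (g : Γ) (n : ℕ), ∀ x ∈ Icc (0:ℝ) 1, (R g)^[n] x = R (g ^ n) x := by
    intro g n
    induction n with
    | zero => intro x hx; simp [G.unit x hx]
    | succ n ih =>
      intro x hx
      rw [Function.iterate_succ_apply', ih x hx, pow_succ', G.mul _ _ x hx]
  intro x hx
  unfold zpowFun
  split_ifs with h
  · rw [key g _ x hx]
    congr 1
    rw [← zpow_natCast, Int.toNat_of_nonneg h]
  · rw [key g⁻¹ _ x hx]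
    congr 1
    rw [← zpow_natCast, Int.toNat_of_nonneg (by omega), inv_zpow, zpow_neg, inv_inv]

lemma main_aux {Γ : Type*} [CommGroup Γ] [Group.FG Γ] {R : Γ → ℝ → ℝ} (G : GAct R) (d : ℕ)
    (f : Fin d → ℝ → ℝ) (γ : Fin d → Γ) (hγ : ∀ i, ∀ x ∈ Icc (0:ℝ) 1, f i x = R (γ i) x) :
    (∃ (Φ : ℝ → ℝ → ℝ) (X : ℝ → ℝ), IsAnalyticFlowOf Φ X ∧
      ∃ τ : Fin d → ℝ, ∀ i : Fin d, ∀ x ∈ Icc (0:ℝ) 1, f i x = Φ (τ i) x) ∨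
    (∃ (h : AnDiffeo) (hinv : ℝ → ℝ),
      (∀ x ∈ Icc (0:ℝ) 1, hinv (h.toFun x) = x) ∧
      (∀ x ∈ Icc (0:ℝ) 1, h.toFun (hinv x) = x) ∧
      ∃ k : Fin d → ℤ, ∀ i : Fin d, ∀ x ∈ Icc (0:ℝ) 1,
        f i x = zpowFun h.toFun hinv (k i) x) := by
  by_cases hc : IsCyclic Γ
  · right
    obtain ⟨g, hg⟩ := hc.exists_generator
    have l : ∀ x ∈ Icc (0:ℝ) 1, R g⁻¹ (R g x) = x := fun x hx => by
      rw [← G.mul _ _ x hx, inv_mul_cancel, G.unit x hx]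
    have r : ∀ x ∈ Icc (0:ℝ) 1, R g (R g⁻¹ x) = x := fun x hx => by
      rw [← G.mul _ _ x hx, mul_inv_cancel, G.unit x hx]
    choose k hk using fun i => Subgroup.mem_zpowers_iff.1 (hg (γ i))
    refine ⟨⟨R g, G.zero g, G.one g, ⟨fun x hx => G.maps g hx, ?_, ?_⟩, G.an g, G.dpos g⟩, R g⁻¹,
      l, r, k, fun i x hx => ?_⟩
    · intro x hx y hy hxy
      rw [← l x hx, ← l y hy, hxy]
    · intro y hy
      exact ⟨R g⁻¹ y, G.maps g⁻¹ hy, r y hy⟩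
    · rw [hγ i x hx, zpowFun_eq G g (k i) x hx, hk]
  · left
    obtain ⟨Φ, X, h, hτ⟩ := G.flow hc
    choose τ hτ using hτ
    exact ⟨Φ, X, h, fun i => τ (γ i), fun i x hx => by rw [hγ i x hx, hτ (γ i) x hx]⟩


/-- Any `d`-tuple of commuting orientation-preserving real-analytic diffeomorphisms of `[0,1]`
either embeds in the flow of a real-analytic vector field, or lies in an infinite cyclic
subgroup of the group of real-analytic diffeomorphisms of `[0,1]`. -/
theorem analytic_commuting_tuple_flowable_or_cyclic (d : ℕ) (f : Fin d → AnDiffeo)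
    (hcomm : ∀ i j : Fin d, ∀ x ∈ Icc (0:ℝ) 1,
      (f i).toFun ((f j).toFun x) = (f j).toFun ((f i).toFun x)) :
    (∃ (Φ : ℝ → ℝ → ℝ) (X : ℝ → ℝ), IsAnalyticFlowOf Φ X ∧
      ∃ τ : Fin d → ℝ, ∀ i : Fin d, ∀ x ∈ Icc (0:ℝ) 1, (f i).toFun x = Φ (τ i) x) ∨
    (∃ (h : AnDiffeo) (hinv : ℝ → ℝ),
      (∀ x ∈ Icc (0:ℝ) 1, hinv (h.toFun x) = x) ∧
      (∀ x ∈ Icc (0:ℝ) 1, h.toFun (hinv x) = x) ∧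
      ∃ k : Fin d → ℤ, ∀ i : Fin d, ∀ x ∈ Icc (0:ℝ) 1,
        (f i).toFun x = zpowFun h.toFun hinv (k i) x) := by
  classical
  set e : Fin d → Equiv.Perm (Icc (0:ℝ) 1) := fun i => (f i).bijOn.equiv (f i).toFun with he
  have hev : ∀ i (x : Icc (0:ℝ) 1), ((e i x : Icc (0:ℝ) 1) : ℝ) = (f i).toFun x :=
    fun i x => rfl
  have hcm : ∀ a ∈ range e, ∀ b ∈ range e, a * b = b * a := by
    rintro _ ⟨i, rfl⟩ _ ⟨j, rfl⟩
    ext x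
    rw [Equiv.Perm.mul_apply, Equiv.Perm.mul_apply, hev, hev, hev, hev]
    exact hcomm i j x x.2
  have hcm' : ∀ a b : Subgroup.closure (range e), a * b = b * a := by
    have h1 : Subgroup.closure (range e) ≤ Subgroup.centralizer (range e) := by
      rw [Subgroup.closure_le]
      intro a ha
      exact Subgroup.mem_centralizer_iff.2 (fun b hb => hcm b hb a ha)
    have h2 : Subgroup.closure (range e) ≤
        Subgroup.centralizer (Subgroup.closure (range e) : Set (Equiv.Perm (Icc (0:ℝ) 1))) := by
      rw [Subgroup.closure_le]
      intro a ha
      refine Subgroup.mem_centralizer_iff.2 (fun b hb => ?_)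
      exact (Subgroup.mem_centralizer_iff.1 (h1 hb) a ha).symm
    intro a b
    apply Subtype.ext
    exact (Subgroup.mem_centralizer_iff.1 (h2 b.2) a a.2)
  letI : CommGroup (Subgroup.closure (range e)) :=
    { (inferInstance : Group (Subgroup.closure (range e))) with mul_comm := hcm' }
  haveI : Group.FG (Subgroup.closure (range e)) := Group.closure_finite_fg _
  have han : ∀ g : Subgroup.closure (range e), AnPerm g := by
    intro g
    refine Subgroup.closure_induction (p := fun g _ => AnPerm g) ?_ AnPerm.one
      (fun _ _ _ _ h h' => h.mul h') (fun _ _ h => h.inv) g.2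
    rintro _ ⟨i, rfl⟩
    exact ⟨(f i).toFun, (f i).analytic, (f i).map_zero, (f i).map_one, (f i).deriv_pos,
      fun x => (hev i x).symm⟩
  choose R ha h0 h1 hd hR using han
  have G : GAct R :=
    { an := ha
      zero := h0
      one := h1
      dpos := hd
      mul := fun g h x hx => by
        have e1 := hR (g * h) ⟨x, hx⟩
        have e2 := hR h ⟨x, hx⟩
        have e3 := hR g ((h : Equiv.Perm (Icc (0:ℝ) 1)) ⟨x, hx⟩)
        simp only at e1 e2 e3
        rw [e1, e2, e3]
        rfl
      unit := fun x hx => hR 1 ⟨x, hx⟩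
      faithful := fun g hg => by
        apply Subtype.ext
        ext x
        rw [← hR g x, hg x x.2]
        rfl }
  exact main_aux G d (fun i => (f i).toFun)
    (fun i => ⟨e i, Subgroup.subset_closure ⟨i, rfl⟩⟩)
    (fun i x hx => (hR ⟨e i, Subgroup.subset_closure ⟨i, rfl⟩⟩ ⟨x, hx⟩).symm)
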